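/- arXiv:1707.04965 — 4 statements merged into one kernel-verified Lean document; each statement's English description precedes it below -/
import Mathlib

section
/- There exist positive constants c1 and c2, depending only on n, such that for every integer n ≥ 2 and every integer H ≥ 3, the number of generalized degenerate monic integer polynomials of degree n and height at most H that are irreducible over ℤ satisfies c1·H^(n−1) ≤ #I_n(H) ≤ c2·H^(n−1)·(log H)^(2n²−n−1). -/
open Polynomial MeasureTheory

/-- A finite set of (nonzero) complex numbers is multiplicatively dependent:
there are integer exponents, not all zero, whose corresponding power product is 1. -/
def MulDep (S : Finset ℂ) : Prop :=
  ∃ k : ℂ → ℤ, (∃ z ∈ S, k z ≠ 0) ∧ ∏ z ∈ S, z ^ k z = 1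

/-- The distinct nonzero complex roots of an integer polynomial. -/
noncomputable def nzRoots (f : Polynomial ℤ) : Finset ℂ :=
  ((f.map (Int.castRingHom ℂ)).roots.toFinset).filter (fun z => z ≠ 0)

/-- A polynomial of degree at least 2 is generalized degenerate if its distinct
nonzero complex roots are multiplicatively dependent. -/
def GenDeg (f : Polynomial ℤ) : Prop :=
  2 ≤ f.natDegree ∧ MulDep (nzRoots f)

/-- Height (max absolute value of coefficients) at most `H`. -/
def HeightLe (f : Polynomial ℤ) (H : ℤ) : Prop :=
  ∀ i, |f.coeff i| ≤ H

def Iset (n : ℕ) (H : ℤ) : Set (Polynomial ℤ) :=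
  {f | f.Monic ∧ f.natDegree = n ∧ HeightLe f H ∧ Irreducible f ∧ GenDeg f}

def Rset (n : ℕ) (H : ℤ) : Set (Polynomial ℤ) :=
  {f | f.Monic ∧ f.natDegree = n ∧ HeightLe f H ∧ ¬ Irreducible f ∧ GenDeg f}

def Mset (n : ℕ) (H : ℤ) : Set (Polynomial ℤ) :=
  {f | f.Monic ∧ f.natDegree = n ∧ HeightLe f H ∧ GenDeg f}

def IstarSet (n : ℕ) (H : ℤ) : Set (Polynomial ℤ) :=
  {f | f.natDegree = n ∧ HeightLe f H ∧ Irreducible f ∧ GenDeg f}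

def RstarSet (n : ℕ) (H : ℤ) : Set (Polynomial ℤ) :=
  {f | f.natDegree = n ∧ HeightLe f H ∧ ¬ Irreducible f ∧ GenDeg f}

def MstarSet (n : ℕ) (H : ℤ) : Set (Polynomial ℤ) :=
  {f | f.natDegree = n ∧ HeightLe f H ∧ GenDeg f}

/-- `nu n` is the (n-1)-dimensional Lebesgue volume of the convex body
`|x_i| ≤ 1 (1 ≤ i ≤ n-1)`, `|x_1 + ⋯ + x_{n-1}| ≤ 1`. -/
noncomputable def nu (n : ℕ) : ℝ :=
  (volume {x : Fin (n - 1) → ℝ | (∀ i, |x i| ≤ 1) ∧ |∑ i, x i| ≤ 1}).toReal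

open NumberField in
/-- If `γ ^ N * V = U`, then `γ` has a denominator whose `N`-th power is at most the norm of `V`. -/
theorem exists_natCast_mul_isIntegral {K : Type*} [Field K] [NumberField K] {γ : K} {N : ℕ}
    (hN : N ≠ 0) {U V : 𝓞 K} (hV : V ≠ 0)
    (h : γ ^ N * algebraMap (𝓞 K) K V = algebraMap (𝓞 K) K U) :
    ∃ m : ℕ, 0 < m ∧ m ^ N ≤ Ideal.absNorm (Ideal.span {V}) ∧ IsIntegral ℤ ((m : K) * γ) := by
  obtain ⟨A, B, hB, rfl⟩ := IsFractionRing.div_surjective (A := 𝓞 K) γ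
  have hB0 : B ≠ 0 := nonZeroDivisors.ne_zero hB
  have hBK : (algebraMap (𝓞 K) K B) ≠ 0 := by
    simpa using hB0
  obtain ⟨D, hD⟩ : Ideal.span {A, B} ∣ Ideal.span {B} :=
    Ideal.dvd_iff_le.2 (Ideal.span_mono (by simp))
  have hI0 : Ideal.span {A, B} ≠ ⊥ := by
    intro h0
    rw [Ideal.span_eq_bot] at h0
    exact hB0 (h0 B (by simp))
  have hmem : ∀ i ≤ N, A ^ i * B ^ (N - i) * V ∈ Ideal.span {B ^ N} := by
    intro i hi
    set g := algebraMap (𝓞 K) K A / algebraMap (𝓞 K) K B with hg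
    have hint : IsIntegral ℤ (g ^ i * algebraMap (𝓞 K) K V) := by
      refine IsIntegral.of_pow (Nat.pos_of_ne_zero hN) ?_
      have : (g ^ i * algebraMap (𝓞 K) K V) ^ N =
          algebraMap (𝓞 K) K (U ^ i * V ^ (N - i)) := by
        rw [map_mul, map_pow, map_pow, ← h, mul_pow, mul_pow, mul_assoc, ← pow_add,
          Nat.add_sub_cancel' hi]
        ring
      rw [this]
      exact RingOfIntegers.isIntegral_coe _
    obtain ⟨c, hc⟩ := (IsIntegralClosure.isIntegral_iff (A := 𝓞 K)).1 hint
    rw [Ideal.mem_span_singleton]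
    refine ⟨c, FaithfulSMul.algebraMap_injective (𝓞 K) K ?_⟩
    simp only [map_mul, map_pow, hc]
    rw [hg, div_pow]
    obtain ⟨j, rfl⟩ := Nat.exists_eq_add_of_le hi
    rw [Nat.add_sub_cancel_left, pow_add]
    field_simp
  have hle : Ideal.span {A, B} ^ N * Ideal.span {V} ≤ Ideal.span {B} ^ N := by
    rw [Ideal.span_insert, ← Ideal.add_eq_sup, add_pow, Finset.sum_mul, Ideal.span_singleton_pow]
    refine Finset.sum_induction _ (fun J => J ≤ Ideal.span {B ^ N}) (fun a b ha hb => ?_)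
      bot_le fun i hi => ?_
    · exact sup_le ha hb
    · refine (mul_le_mul_left Ideal.mul_le_left _).trans ?_
      rw [Ideal.span_singleton_pow, Ideal.span_singleton_pow,
        Ideal.span_singleton_mul_span_singleton, Ideal.span_singleton_mul_span_singleton,
        Ideal.span_singleton_le_iff_mem]
      exact hmem i (by simpa [Nat.lt_succ_iff] using hi)
  have hdvd : D ^ N ∣ Ideal.span {V} := by
    rw [hD, mul_pow, ← Ideal.dvd_iff_le] at hle
    exact (mul_dvd_mul_iff_left (pow_ne_zero N hI0)).1 hle
  have hV' : Ideal.absNorm (Ideal.span {V}) ≠ 0 := by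
    rw [Ne, Ideal.absNorm_eq_zero_iff]
    simpa using hV
  have hnorm : Ideal.absNorm D ^ N ∣ Ideal.absNorm (Ideal.span {V}) := by
    rw [← map_pow]; exact map_dvd _ hdvd
  refine ⟨Ideal.absNorm D, ?_, Nat.le_of_dvd (Nat.pos_of_ne_zero hV') hnorm, ?_⟩
  · refine Nat.pos_of_ne_zero fun h0 => hV' ?_
    rw [h0, zero_pow hN] at hnorm
    exact Nat.eq_zero_of_zero_dvd hnorm
  · have : (Ideal.absNorm D : 𝓞 K) * A ∈ Ideal.span {B} := by
      rw [hD, mul_comm (Ideal.absNorm D : 𝓞 K)]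
      exact Ideal.mul_mem_mul (Ideal.subset_span (by simp)) (Ideal.absNorm_mem D)
    obtain ⟨c, hc⟩ := Ideal.mem_span_singleton.1 this
    have hc' := congrArg (algebraMap (𝓞 K) K) hc
    rw [map_mul, map_mul, map_natCast] at hc'
    have : ((Ideal.absNorm D : ℕ) : K) * (algebraMap (𝓞 K) K A / algebraMap (𝓞 K) K B) =
        algebraMap (𝓞 K) K c := by
      rw [← mul_div_assoc, div_eq_iff hBK, hc', mul_comm]
    rw [this]
    exact RingOfIntegers.isIntegral_coe _

/-- Northcott's theorem, uniformly in the number field: the algebraic integers of degree at most `D`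
all of whose conjugates are bounded by `4` lie in a fixed finite set. -/
theorem exists_finite_of_embeddings_le (D : ℕ) : ∃ F : Set ℂ, F.Finite ∧
    ∀ (K : Type) [Field K] [NumberField K] (φ : K →+* ℂ) (x : K), Module.finrank ℚ K ≤ D →
      IsIntegral ℤ x → (∀ ψ : K →+* ℂ, ‖ψ x‖ ≤ 4) → φ x ∈ F := by
  classical
  let B : ℝ := 4 ^ D * 2 ^ D
  let C := Nat.ceil B
  refine ⟨_, Polynomial.bUnion_roots_finite (algebraMap ℤ ℂ) D (Set.finite_Icc (-C : ℤ) C), ?_⟩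
  intro K _ _ φ x hD hx hψ
  simp_rw [Set.mem_iUnion]
  have hm := minpoly.isIntegrallyClosed_eq_field_fractions' ℚ hx
  refine ⟨minpoly ℤ x, ⟨?_, fun i => ?_⟩, ?_⟩
  · rw [← (minpoly.monic hx).natDegree_map (algebraMap ℤ ℚ), ← hm]
    exact (minpoly.natDegree_le x).trans hD
  · rw [Set.mem_Icc, ← abs_le, ← @Int.cast_le ℝ]
    have h1 := NumberField.Embeddings.coeff_bdd_of_norm_le hψ i
    have h2 : ((Module.finrank ℚ K).choose (Module.finrank ℚ K / 2) : ℝ) ≤ 2 ^ D := by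
      have := (Nat.choose_le_two_pow (Module.finrank ℚ K) (Module.finrank ℚ K / 2)).trans
        (Nat.pow_le_pow_right two_pos hD)
      exact_mod_cast this
    refine (Eq.trans_le ?_ <| h1.trans (?_ : _ ≤ B)).trans (Nat.le_ceil _)
    · rw [hm, coeff_map, eq_intCast, Int.norm_cast_rat, Int.norm_eq_abs, Int.cast_abs]
    · rw [max_eq_left (by norm_num)]
      refine mul_le_mul (pow_le_pow_right₀ (by norm_num) hD) h2 (by positivity) (by positivity)
  · simp only [Finset.mem_coe, Multiset.mem_toFinset]
    rw [mem_roots ((Polynomial.map_ne_zero_iff (algebraMap ℤ ℂ).injective_int).2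
      (minpoly.ne_zero hx)), IsRoot, eval_map]
    have := congrArg φ (minpoly.aeval ℤ x)
    rw [map_zero, aeval_def, hom_eval₂] at this
    rwa [RingHom.ext_int (algebraMap ℤ ℂ) (φ.comp (algebraMap ℤ K))]

open NumberField in
/-- A number whose large power has small numerator and denominator is a root of unity of bounded
order. -/
theorem exists_forall_pow_eq_one (D : ℕ) : ∃ J : ℕ, 0 < J ∧
    ∀ (K : Type) [Field K] [NumberField K], Module.finrank ℚ K ≤ D →
      ∀ (γ : K) (N : ℕ) (U V : 𝓞 K) (X : ℝ), γ ≠ 0 → N ≠ 0 → V ≠ 0 →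
        γ ^ N * algebraMap (𝓞 K) K V = algebraMap (𝓞 K) K U → 1 ≤ X →
        (∀ ψ : K →+* ℂ, ‖ψ (algebraMap (𝓞 K) K V)‖ ≤ X) →
        (∀ ψ : K →+* ℂ, ‖ψ γ‖ ^ N ≤ X) → X ^ (J * D) ≤ 2 ^ N →
        ∃ t : ℕ, 0 < t ∧ t ≤ J ∧ γ ^ t = 1 := by
  classical
  obtain ⟨F, hF, hmem⟩ := exists_finite_of_embeddings_le D
  have hF' : (F ∪ (fun z => z / 2) '' F).Finite := hF.union (hF.image _)
  set F' := hF'.toFinset with hF'def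
  refine ⟨F'.card + 1, Nat.succ_pos _, ?_⟩
  intro K _ _ hD γ N U V X hγ hN hV h hX hVX hγX hXN
  set J := F'.card + 1 with hJ
  obtain ⟨φ⟩ : Nonempty (K →+* ℂ) := inferInstance
  have hD1 : 1 ≤ D := (Module.finrank_pos (R := ℚ) (M := K)).trans_le hD
  have key : ∀ j ≤ J, φ (γ ^ j) ∈ F' := by
    intro j hj
    have h' : (γ ^ j) ^ N * algebraMap (𝓞 K) K (V ^ j) = algebraMap (𝓞 K) K (U ^ j) := by
      rw [map_pow, map_pow, ← h]; ring
    obtain ⟨m, hm0, hmN, hint⟩ := exists_natCast_mul_isIntegral hN (pow_ne_zero j hV) h'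
    have hm2 : m ≤ 2 := by
      have h1 : (Ideal.absNorm (Ideal.span {V ^ j}) : ℝ) ≤ X ^ (j * D) := by
        rw [Ideal.absNorm_span_singleton, Nat.cast_natAbs, Int.cast_abs]
        have h2 : (algebraMap ℚ ℂ) (Algebra.norm ℚ (algebraMap (𝓞 K) K (V ^ j))) =
            ∏ σ : K →ₐ[ℚ] ℂ, σ (algebraMap (𝓞 K) K (V ^ j)) :=
          Algebra.norm_eq_prod_embeddings ℚ ℂ _
        have h3 : ((Algebra.norm ℤ (V ^ j) : ℤ) : ℂ) =
            ∏ σ : K →ₐ[ℚ] ℂ, σ (algebraMap (𝓞 K) K (V ^ j)) := by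
          rw [← h2, ← Algebra.coe_norm_int]; simp
        have h4 : |((Algebra.norm ℤ (V ^ j) : ℤ) : ℝ)| =
            ∏ σ : K →ₐ[ℚ] ℂ, ‖σ (algebraMap (𝓞 K) K (V ^ j))‖ := by
          rw [← norm_prod, ← h3, Complex.norm_intCast]
        rw [h4]
        calc _ ≤ ∏ σ : K →ₐ[ℚ] ℂ, X ^ j := by
              refine Finset.prod_le_prod (fun _ _ => norm_nonneg _) fun σ _ => ?_
              rw [map_pow, map_pow, norm_pow]
              exact pow_le_pow_left₀ (norm_nonneg _) (hVX σ.toRingHom) j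
          _ = X ^ (j * Module.finrank ℚ K) := by
              rw [Finset.prod_const, Finset.card_univ, AlgHom.card, pow_mul]
          _ ≤ _ := pow_le_pow_right₀ hX (by gcongr)
      have h5 : (m : ℝ) ^ N ≤ 2 ^ N := by
        refine le_trans ?_ ((h1.trans (pow_le_pow_right₀ hX (by gcongr))).trans hXN)
        exact_mod_cast hmN
      have := (pow_le_pow_iff_left₀ (Nat.cast_nonneg m) zero_le_two hN).1 h5
      exact_mod_cast this
    have hψ : ∀ ψ : K →+* ℂ, ‖ψ (m * γ ^ j)‖ ≤ 4 := by
      intro ψ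
      have h6 : ‖ψ γ‖ ^ j ≤ 2 := by
        refine (pow_le_pow_iff_left₀ (by positivity) zero_le_two hN).1 ?_
        rw [← pow_mul, mul_comm, pow_mul]
        refine (pow_le_pow_left₀ (by positivity) (hγX ψ) j).trans (le_trans ?_ hXN)
        exact pow_le_pow_right₀ hX (by nlinarith)
      rw [map_mul, map_pow, map_natCast, norm_mul, norm_pow, Complex.norm_natCast]
      have : (m : ℝ) ≤ 2 := by exact_mod_cast hm2
      nlinarith [norm_nonneg (ψ γ), pow_nonneg (norm_nonneg (ψ γ)) j]
    have := hmem K φ _ hD hint hψ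
    rw [hF'def, Set.Finite.mem_toFinset]
    interval_cases m
    · left; simpa using this
    · right; exact ⟨_, this, by rw [map_mul, map_natCast]; simp⟩
  obtain ⟨x, hx, y, hy, hxy, he⟩ := Finset.exists_ne_map_eq_of_card_lt_of_maps_to
    (s := Finset.range (J + 1)) (t := F') (f := fun j => φ (γ ^ j)) (by simp; omega)
    (fun j hj => key j (by simpa [Nat.lt_succ_iff] using hj))
  simp only [Finset.mem_range] at hx hy
  replace he : γ ^ x = γ ^ y := φ.injective he
  have aux : ∀ x y : ℕ, x < y → y < J + 1 → γ ^ x = γ ^ y →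
      ∃ t : ℕ, 0 < t ∧ t ≤ J ∧ γ ^ t = 1 := by
    intro x y hxy hy he
    refine ⟨y - x, by omega, by omega, ?_⟩
    have h7 : γ ^ x * γ ^ (y - x) = γ ^ x * 1 := by
      rw [← pow_add, Nat.add_sub_cancel' hxy.le, mul_one, he]
    exact mul_left_cancel₀ (pow_ne_zero _ hγ) h7
  rcases lt_or_gt_of_ne hxy with h8 | h8
  · exact aux x y h8 hy he
  · exact aux y x h8 hx he.symm

/-- Dirichlet's simultaneous approximation of the vector `k / N`, exact in the coordinate `i₀`. -/
theorem exists_simultaneous_approx {n : ℕ} (k : Fin n → ℤ) (i₀ : Fin n) {N Q : ℕ} (hN : 0 < N)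
    (hk₀ : (k i₀).natAbs = N) (hQ : 0 < Q) :
    ∃ q : ℕ, 0 < q ∧ q ≤ Q ^ (n - 1) ∧ ∃ b : Fin n → ℤ, ∀ i, |N * b i - q * k i| * Q ≤ N := by
  classical
  have hN' : (0 : ℤ) < N := by exact_mod_cast hN
  have hQ' : (0 : ℤ) < Q := by exact_mod_cast hQ
  let g : ℕ → ({i // i ≠ i₀} → ℤ) := fun x i => (Q * ((x * k i) % N)) / N
  have hg : ∀ x ∈ Finset.range (Q ^ (n - 1) + 1),
      g x ∈ Fintype.piFinset (fun _ : {i // i ≠ i₀} => Finset.Ico (0 : ℤ) Q) := by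
    intro x _
    rw [Fintype.mem_piFinset]
    intro i
    have h1 := Int.emod_nonneg (x * k i) hN'.ne'
    have h2 := Int.emod_lt_of_pos (x * k i) hN'
    rw [Finset.mem_Ico]
    refine ⟨Int.ediv_nonneg (by positivity) hN'.le, Int.ediv_lt_of_lt_mul hN' ?_⟩
    nlinarith
  obtain ⟨x, hx, y, hy, hxy, he⟩ := Finset.exists_ne_map_eq_of_card_lt_of_maps_to
    (by simp [Fintype.card_subtype_compl]) hg
  have aux : ∀ x y : ℕ, x < y → y < Q ^ (n - 1) + 1 → g x = g y →
      ∃ q : ℕ, 0 < q ∧ q ≤ Q ^ (n - 1) ∧ ∃ b : Fin n → ℤ, ∀ i, |N * b i - q * k i| * Q ≤ N := by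
    intro x y hxy hy he
    refine ⟨y - x, by omega, by omega,
      fun i => if i = i₀ then (y - x) * (k i₀).sign else (y * k i) / N - (x * k i) / N, fun i => ?_⟩
    rw [Nat.cast_sub hxy.le]
    by_cases hi : i = i₀
    · subst hi
      have : (N : ℤ) * (k i).sign = k i := by
        rw [← hk₀, mul_comm]; exact Int.sign_mul_natAbs _
      have h3 : (N : ℤ) * ((y - x) * (k i).sign) - (y - x) * k i = 0 := by
        linear_combination ((y : ℤ) - x) * this
      simp [h3]
    · have h4 : (Q * ((x * k i) % N)) / N = (Q * ((y * k i) % N)) / (N : ℤ) := congrFun he ⟨i, hi⟩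
      simp only [hi, if_false]
      have hx1 := Int.emod_add_mul_ediv (x * k i) N
      have hy1 := Int.emod_add_mul_ediv (y * k i) N
      have h5 : (N : ℤ) * ((y * k i) / N - (x * k i) / N) - (y - x) * k i =
          (x * k i) % N - (y * k i) % N := by linear_combination hy1 - hx1
      rw [h5]
      have hx2 := Int.emod_add_mul_ediv (Q * ((x * k i) % N)) N
      have hy2 := Int.emod_add_mul_ediv (Q * ((y * k i) % N)) N
      have hx3 := Int.emod_nonneg (Q * ((x * k i) % N)) hN'.ne'
      have hx4 := Int.emod_lt_of_pos (Q * ((x * k i) % N)) hN'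
      have hy3 := Int.emod_nonneg (Q * ((y * k i) % N)) hN'.ne'
      have hy4 := Int.emod_lt_of_pos (Q * ((y * k i) % N)) hN'
      rw [h4] at hx2
      rw [← abs_of_pos hQ', ← abs_mul, abs_le]
      constructor <;> nlinarith
  simp only [Finset.mem_range] at hx hy
  rcases lt_or_gt_of_ne hxy with h8 | h8
  · exact aux x y h8 hy he
  · exact aux y x h8 hx he.symm

theorem norm_zpow_le_pow_natAbs {z : ℂ} {B : ℝ} (h : ‖z‖ ≤ B) (h' : ‖z‖⁻¹ ≤ B) (e : ℤ) :
    ‖z ^ e‖ ≤ B ^ e.natAbs := by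
  rw [norm_zpow]
  rcases Int.natAbs_eq e with he | he
  · conv_lhs => rw [he, zpow_natCast]
    exact pow_le_pow_left₀ (norm_nonneg _) h _
  · conv_lhs => rw [he, zpow_neg, zpow_natCast, ← inv_pow]
    exact pow_le_pow_left₀ (inv_nonneg.2 (norm_nonneg _)) h' _

open NumberField in
/-- Multiplicatively dependent algebraic integers satisfy a relation with small exponents. -/
theorem exists_small_relation (D : ℕ) : ∃ J : ℕ, 0 < J ∧
    ∀ (K : Type) [Field K] [NumberField K], Module.finrank ℚ K ≤ D →
      ∀ (n : ℕ) (a : Fin n → 𝓞 K) (B : ℝ) (k : Fin n → ℤ) (Q : ℕ), (∀ i, a i ≠ 0) → 1 ≤ B →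
        (∀ (ψ : K →+* ℂ) i, ‖ψ (algebraMap (𝓞 K) K (a i))‖ ≤ B) →
        (∀ (ψ : K →+* ℂ) i, ‖ψ (algebraMap (𝓞 K) K (a i))‖⁻¹ ≤ B) →
        k ≠ 0 → ∏ i, algebraMap (𝓞 K) K (a i) ^ k i = 1 → 2 ≤ Q → B ^ (n * J * D) ≤ 2 ^ Q →
        ∃ b : Fin n → ℤ, b ≠ 0 ∧ (∀ i, |b i| ≤ J * (Q ^ (n - 1) + 1)) ∧
          ∏ i, algebraMap (𝓞 K) K (a i) ^ b i = 1 := by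
  obtain ⟨J, hJ, hgap⟩ := exists_forall_pow_eq_one D
  refine ⟨J, hJ, ?_⟩
  intro K _ _ hD n a B k Q ha hB haB haB' hk hrel hQ hBQ
  obtain ⟨j, hj⟩ : ∃ j, k j ≠ 0 := Function.ne_iff.1 hk
  obtain ⟨i₀, -, hmax⟩ := Finset.exists_max_image Finset.univ (fun i => (k i).natAbs) ⟨j, by simp⟩
  set N := (k i₀).natAbs with hNdef
  have hN : 0 < N := (Int.natAbs_pos.2 hj).trans_le (hmax j (by simp))
  obtain ⟨q, hq0, hqQ, b, hb⟩ := exists_simultaneous_approx k i₀ hN rfl (by omega : 0 < Q)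
  set x : Fin n → K := fun i => algebraMap (𝓞 K) K (a i) with hx
  have hx0 : ∀ i, x i ≠ 0 := fun i => by simpa [hx] using ha i
  set e : Fin n → ℤ := fun i => N * b i - q * k i with he
  set γ : K := ∏ i, x i ^ b i with hγ
  set U : 𝓞 K := ∏ i, a i ^ (e i).toNat with hU
  set V : 𝓞 K := ∏ i, a i ^ (-e i).toNat with hV
  set E := N / Q with hE
  have heE : ∀ i, (e i).natAbs ≤ E := by
    intro i
    rw [hE, Nat.le_div_iff_mul_le (by omega)]
    have := hb i
    rw [Int.abs_eq_natAbs] at this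
    exact_mod_cast this
  have hγe : γ ^ N = ∏ i, x i ^ e i := by
    have h1 : ∏ i, x i ^ e i = (∏ i, (x i ^ b i) ^ N) * ((∏ i, x i ^ k i) ^ q)⁻¹ := by
      rw [← Finset.prod_pow, ← Finset.prod_inv_distrib, ← Finset.prod_mul_distrib]
      refine Finset.prod_congr rfl fun i _ => ?_
      rw [he, zpow_sub₀ (hx0 i), div_eq_mul_inv, mul_comm (N : ℤ), mul_comm (q : ℤ), zpow_mul,
        zpow_mul, zpow_natCast, zpow_natCast]
    rw [h1, hrel, hγ, Finset.prod_pow]; simp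
  have hUV : γ ^ N * algebraMap (𝓞 K) K V = algebraMap (𝓞 K) K U := by
    rw [hγe, hU, hV, map_prod, map_prod, ← Finset.prod_mul_distrib]
    refine Finset.prod_congr rfl fun i _ => ?_
    rw [map_pow, map_pow, ← zpow_natCast, ← zpow_natCast, ← zpow_add₀ (hx0 i)]
    congr 1
    omega
  have hnorm : ∀ (ψ : K →+* ℂ) (c : Fin n → ℤ), (∀ i, (c i).natAbs ≤ E) →
      ‖ψ (∏ i, x i ^ c i)‖ ≤ B ^ (n * E) := by
    intro ψ c hc
    rw [map_prod, norm_prod]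
    calc _ ≤ ∏ _i : Fin n, B ^ E := by
          refine Finset.prod_le_prod (fun _ _ => norm_nonneg _) fun i _ => ?_
          rw [map_zpow₀]
          exact (norm_zpow_le_pow_natAbs (haB ψ i) (haB' ψ i) _).trans
            (pow_le_pow_right₀ hB (hc i))
      _ = _ := by rw [Finset.prod_const, Finset.card_univ, Fintype.card_fin, ← pow_mul, mul_comm]
  obtain ⟨t, ht0, htJ, ht⟩ := hgap K hD γ N U V (B ^ (n * E))
    (Finset.prod_ne_zero_iff.2 fun i _ => zpow_ne_zero _ (hx0 i)) hN.ne'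
    (Finset.prod_ne_zero_iff.2 fun i _ => pow_ne_zero _ (ha i)) hUV (one_le_pow₀ hB)
    (fun ψ => by
      have h2 := hnorm ψ (fun i => ((-e i).toNat : ℤ)) (fun i => by have := heE i; omega)
      simp only [zpow_natCast] at h2
      simpa [hV, hx] using h2)
    (fun ψ => by rw [← norm_pow, ← map_pow, hγe]; exact hnorm ψ e heE)
    (by
      rw [← pow_mul, show n * E * (J * D) = n * J * D * E by ring, pow_mul]
      refine (pow_le_pow_left₀ (by positivity) hBQ E).trans ?_
      rw [← pow_mul]
      exact pow_le_pow_right₀ one_le_two (Nat.mul_div_le N Q))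
  have hN' : (0 : ℤ) < N := by exact_mod_cast hN
  have hQ' : (2 : ℤ) ≤ Q := by exact_mod_cast hQ
  refine ⟨fun i => t * b i, ?_, ?_, ?_⟩
  · intro h0
    have h3 : b i₀ = 0 := by
      have := congrFun h0 i₀
      simpa [ht0.ne'] using this
    have h4 := hb i₀
    rw [h3, mul_zero, zero_sub, abs_neg, abs_mul, Int.abs_eq_natAbs (k i₀), ← hNdef,
      Nat.abs_cast] at h4
    have h5 : (1 : ℤ) ≤ q := by exact_mod_cast hq0
    nlinarith [mul_le_mul h5 hQ' (by norm_num) (by omega)]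
  · intro i
    have h6 : |b i| ≤ Q ^ (n - 1) + 1 := by
      have h7 : |k i| ≤ N := by
        rw [Int.abs_eq_natAbs]; exact_mod_cast hmax i (by simp)
      have h8 : |N * b i - q * k i| ≤ N := by
        refine le_trans ?_ (hb i)
        exact le_mul_of_one_le_right (abs_nonneg _) (by omega)
      have h9 : N * |b i| ≤ N * (q + 1) := by
        calc (N : ℤ) * |b i| = |(N * b i - q * k i) + q * k i| := by
              rw [sub_add_cancel, abs_mul, Nat.abs_cast]
          _ ≤ N + q * N := (abs_add_le _ _).trans (add_le_add h8 (by
              rw [abs_mul, Nat.abs_cast]; gcongr))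
          _ = _ := by ring
      have h10 := le_of_mul_le_mul_left h9 hN'
      have h11 : (q : ℤ) ≤ Q ^ (n - 1) := by exact_mod_cast hqQ
      linarith
    rw [abs_mul, Nat.abs_cast]
    exact mul_le_mul (by exact_mod_cast htJ) h6 (abs_nonneg _) (by positivity)
  · rw [← ht, hγ, ← Finset.prod_pow]
    refine Finset.prod_congr rfl fun i _ => ?_
    change x i ^ ((t : ℤ) * b i) = _
    rw [mul_comm, zpow_mul, zpow_natCast]

theorem norm_root_le_and_inv_le {f : ℤ[X]} {n : ℕ} {H : ℤ} (hf : f.Monic) (hdeg : f.natDegree = n)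
    (hn : 0 < n) (hH : HeightLe f H) (h0 : f.coeff 0 ≠ 0) {z : ℂ}
    (hz : f.eval₂ (Int.castRingHom ℂ) z = 0) : ‖z‖ ≤ n * H ∧ ‖z‖⁻¹ ≤ n * H := by
  have hH1 : 1 ≤ H := by
    have := hH n
    rw [← hdeg, coeff_natDegree, hf.leadingCoeff] at this
    simpa using this
  have hHR : (1 : ℝ) ≤ H := by exact_mod_cast hH1
  have hnR : (1 : ℝ) ≤ n := by exact_mod_cast hn
  have hnH : 1 ≤ (n : ℝ) * H := one_le_mul_of_one_le_of_one_le hnR hHR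
  have hc : ∀ i, ‖(f.coeff i : ℂ)‖ ≤ H := fun i => by
    rw [Complex.norm_intCast]; exact_mod_cast hH i
  rw [eval₂_eq_sum_range, hdeg] at hz
  simp only [eq_intCast] at hz
  constructor
  · rcases le_total ‖z‖ 1 with h1 | h1
    · exact h1.trans hnH
    rw [Finset.sum_range_succ, ← hdeg, coeff_natDegree, hf.leadingCoeff, hdeg] at hz
    have h2 : z ^ n = -∑ i ∈ Finset.range n, (f.coeff i : ℂ) * z ^ i := by
      rw [eq_neg_iff_add_eq_zero, add_comm]; simpa using hz
    have h3 : ‖z‖ ^ n ≤ n * H * ‖z‖ ^ (n - 1) := by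
      rw [← norm_pow, h2, norm_neg]
      refine (norm_sum_le _ _).trans ?_
      calc _ ≤ ∑ i ∈ Finset.range n, (H : ℝ) * ‖z‖ ^ (n - 1) := by
            refine Finset.sum_le_sum fun i hi => ?_
            rw [norm_mul, norm_pow]
            have : i ≤ n - 1 := by have := Finset.mem_range.1 hi; omega
            exact mul_le_mul (hc i) (pow_le_pow_right₀ h1 this) (by positivity) (by linarith)
        _ = _ := by simp [mul_assoc]
    obtain ⟨m, rfl⟩ : ∃ m, n = m + 1 := ⟨n - 1, by omega⟩
    rw [pow_succ', Nat.add_sub_cancel] at h3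
    exact le_of_mul_le_mul_right h3 (by positivity)
  · have hz0 : z ≠ 0 := by
      rintro rfl
      rw [Finset.sum_range_succ'] at hz
      simp at hz
      exact h0 hz
    have hzp : 0 < ‖z‖ := norm_pos_iff.2 hz0
    rcases le_total 1 ‖z‖ with h1 | h1
    · exact (inv_le_one_of_one_le₀ h1).trans hnH
    rw [Finset.sum_range_succ'] at hz
    have h2 : (f.coeff 0 : ℂ) = -∑ i ∈ Finset.range n, (f.coeff (i + 1) : ℂ) * z ^ (i + 1) := by
      rw [eq_neg_iff_add_eq_zero, add_comm]; simpa using hz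
    have h3 : (1 : ℝ) ≤ ‖(f.coeff 0 : ℂ)‖ := by
      rw [Complex.norm_intCast]; exact_mod_cast Int.one_le_abs h0
    have h4 : (1 : ℝ) ≤ n * H * ‖z‖ := by
      refine h3.trans ?_
      rw [h2, norm_neg]
      refine (norm_sum_le _ _).trans ?_
      calc _ ≤ ∑ i ∈ Finset.range n, (H : ℝ) * ‖z‖ := by
            refine Finset.sum_le_sum fun i hi => ?_
            rw [norm_mul, norm_pow]
            exact mul_le_mul (hc _) (pow_le_of_le_one (norm_nonneg _) h1 (by omega))
              (by positivity) (by linarith)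
        _ = _ := by simp [mul_assoc]
    rwa [inv_le_iff_one_le_mul₀ hzp]

/-- Multiplicatively dependent roots of a monic integer polynomial of height at most `H` satisfy a
relation with exponents of size `O((log H) ^ (n - 1))`. -/
theorem exists_log_bounded_relation (n : ℕ) (hn : 0 < n) : ∃ A : ℕ, 0 < A ∧ ∀ H : ℤ, 3 ≤ H →
    ∀ f : ℤ[X], f.Monic → f.natDegree = n → HeightLe f H → ∀ α : Fin n → ℂ,
      f.map (Int.castRingHom ℂ) = ∏ i, (X - C (α i)) → (∀ i, α i ≠ 0) →
      (∃ k : Fin n → ℤ, k ≠ 0 ∧ ∏ i, α i ^ k i = 1) →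
      ∃ b : Fin n → ℤ, b ≠ 0 ∧ (∀ i, (|b i| : ℝ) ≤ A * Real.log H ^ (n - 1)) ∧
        ∏ i, α i ^ b i = 1 := by
  obtain ⟨J, hJ, hrel⟩ := exists_small_relation (n ^ n)
  set C₁ : ℕ := 2 * (n * J * n ^ n) * n + 3 with hC₁
  refine ⟨J * (C₁ ^ (n - 1) + 1), by positivity, ?_⟩
  intro H hH f hf hdeg hfH α hα hα0 ⟨k, hk, hαk⟩
  have hroot : ∀ z : ℂ, f.eval₂ (Int.castRingHom ℂ) z = 0 ↔ ∃ i, z = α i := by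
    intro z
    rw [← eval_map, hα, eval_prod, Finset.prod_eq_zero_iff]
    simp [sub_eq_zero]
  have h0 : f.coeff 0 ≠ 0 := by
    intro h
    have : f.eval₂ (Int.castRingHom ℂ) 0 = 0 := by rw [eval₂_at_zero, h, map_zero]
    obtain ⟨i, hi⟩ := (hroot 0).1 this
    exact hα0 i hi.symm
  have hαint : ∀ i, IsIntegral ℤ (α i) := fun i => ⟨f, hf, (hroot _).2 ⟨i, rfl⟩⟩
  let K := IntermediateField.adjoin ℚ (Set.range α)
  have hfd : FiniteDimensional ℚ K :=
    IntermediateField.finiteDimensional_adjoin (by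
      rintro _ ⟨i, rfl⟩
      exact (hαint i).tower_top)
  have : NumberField K := ⟨⟩
  let x : Fin n → K := fun i => ⟨α i, IntermediateField.subset_adjoin _ _ ⟨i, rfl⟩⟩
  have hxint : ∀ i, IsIntegral ℤ (x i) := fun i =>
    (isIntegral_algHom_iff (K.val.restrictScalars ℤ) Subtype.val_injective).1 (hαint i)
  choose a ha using fun i =>
    (IsIntegralClosure.isIntegral_iff (A := NumberField.RingOfIntegers K)).1 (hxint i)
  have hψroot : ∀ (ψ : K →+* ℂ) i, f.eval₂ (Int.castRingHom ℂ) (ψ (x i)) = 0 := by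
    intro ψ i
    have h1 : f.eval₂ (Int.castRingHom K) (x i) = 0 := by
      apply Subtype.val_injective
      have := hom_eval₂ f (Int.castRingHom K) K.val.toRingHom (x i)
      refine this.trans ?_
      rw [RingHom.ext_int (K.val.toRingHom.comp (Int.castRingHom K)) (Int.castRingHom ℂ)]
      exact (hroot _).2 ⟨i, rfl⟩
    have h2 := congrArg ψ h1
    rwa [hom_eval₂, map_zero, RingHom.ext_int (ψ.comp (Int.castRingHom K)) (Int.castRingHom ℂ)]
      at h2
  have hfin : Module.finrank ℚ K ≤ n ^ n := by
    rw [← AlgHom.card ℚ K ℂ]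
    choose τ hτ using fun (σ : K →ₐ[ℚ] ℂ) i => (hroot _).1 (hψroot σ.toRingHom i)
    have hinj : Function.Injective τ := by
      intro σ σ' h
      refine IntermediateField.adjoin_algHom_ext ℚ ?_
      rintro _ ⟨i, rfl⟩
      exact (hτ σ i).trans ((congrArg α (congrFun h i)).trans (hτ σ' i).symm)
    simpa using Fintype.card_le_of_injective τ hinj
  have hHR : (3 : ℝ) ≤ H := by exact_mod_cast hH
  have hlog : 1 ≤ Real.log H := by
    rw [Real.le_log_iff_exp_le (by linarith)]
    linarith [Real.exp_one_lt_d9]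
  have hnR : (1 : ℝ) ≤ n := by exact_mod_cast hn
  set B : ℝ := n * H with hB
  have hB1 : 1 ≤ B := one_le_mul_of_one_le_of_one_le hnR (by linarith)
  have hlogB : Real.log B ≤ n * Real.log H := by
    rw [← Real.log_pow]
    refine Real.log_le_log (by linarith) ?_
    have h3 : n ≤ 2 ^ (n - 1) := by
      have := Nat.lt_two_pow_self (n := n - 1); omega
    have h4 : (n : ℝ) ≤ H ^ (n - 1) := by
      calc (n : ℝ) ≤ 2 ^ (n - 1) := by exact_mod_cast h3
        _ ≤ _ := pow_le_pow_left₀ (by norm_num) (by linarith) _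
    calc B ≤ H ^ (n - 1) * H := mul_le_mul_of_nonneg_right h4 (by linarith)
      _ = H ^ n := by rw [← pow_succ, Nat.sub_add_cancel hn]
  set M : ℕ := n * J * n ^ n with hM
  set Q : ℕ := ⌈2 * M * Real.log B⌉₊ + 2 with hQ
  have hBQ : B ^ M ≤ 2 ^ Q := by
    rw [← Real.log_le_log_iff (by positivity) (by positivity), Real.log_pow, Real.log_pow]
    have h5 : 2 * M * Real.log B ≤ Q := by
      rw [hQ]; push_cast; linarith [Nat.le_ceil (2 * M * Real.log B)]
    have h6 : (1 / 2 : ℝ) ≤ Real.log 2 := by linarith [Real.log_two_gt_d9]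
    have h7 : (Q : ℝ) * (1 / 2) ≤ Q * Real.log 2 := by gcongr
    linarith
  have hQC : (Q : ℝ) ≤ C₁ * Real.log H := by
    have h8 := Nat.ceil_lt_add_one (a := 2 * M * Real.log B)
      (mul_nonneg (by positivity) (Real.log_nonneg hB1))
    have h9 : 2 * M * Real.log B ≤ 2 * M * (n * Real.log H) := by gcongr
    rw [hQ, hC₁]; push_cast at *
    nlinarith
  obtain ⟨b, hb0, hb, hbrel⟩ := hrel K hfin n a B k Q
    (fun i h => by
      have := ha i
      rw [h, map_zero] at this
      exact hα0 i (congrArg Subtype.val this).symm) hB1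
    (fun ψ i => by
      rw [ha]; exact (norm_root_le_and_inv_le hf hdeg hn hfH h0 (hψroot ψ i)).1)
    (fun ψ i => by
      rw [ha]; exact (norm_root_le_and_inv_le hf hdeg hn hfH h0 (hψroot ψ i)).2)
    hk (by
      simp only [ha]
      apply Subtype.val_injective
      have := map_prod K.val (fun i => x i ^ k i) Finset.univ
      refine this.trans ?_
      simpa [x] using hαk) (by omega) hBQ
  refine ⟨b, hb0, fun i => ?_, ?_⟩
  · have h10 : (|b i| : ℝ) ≤ J * (Q ^ (n - 1) + 1) := by exact_mod_cast hb i
    refine h10.trans ?_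
    have h11 : (Q : ℝ) ^ (n - 1) ≤ C₁ ^ (n - 1) * Real.log H ^ (n - 1) := by
      rw [← mul_pow]; gcongr
    have h12 : 1 ≤ Real.log H ^ (n - 1) := one_le_pow₀ hlog
    push_cast
    rw [mul_assoc]
    gcongr
    linarith
  · simp only [ha] at hbrel
    have h13 := congrArg K.val hbrel
    rw [map_prod] at h13
    simpa [x] using h13

theorem MvPolynomial.isHomogeneous_esymm (σ R : Type*) [Fintype σ] [CommSemiring R] (m : ℕ) :
    (esymm σ R m).IsHomogeneous m := by
  refine IsHomogeneous.sum _ _ _ fun t ht => ?_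
  have := IsHomogeneous.prod t (fun i => (X i : MvPolynomial σ R)) (fun _ => 1)
    (fun i _ => isHomogeneous_X R i)
  simpa [(Finset.mem_powersetCard.1 ht).2] using this

open MvPolynomial in
theorem homogeneousComponent_aeval_esymm {n : ℕ} (d : ℕ) (P : MvPolynomial (Fin n) ℤ) :
    homogeneousComponent d (aeval (fun i : Fin n => esymm (Fin n) ℤ (i + 1)) P) =
      aeval (fun i : Fin n => esymm (Fin n) ℤ (i + 1))
        (weightedHomogeneousComponent (fun i : Fin n => (i : ℕ) + 1) d P) := by
  classical
  induction P using MvPolynomial.induction_on' with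
  | add p q hp hq => simp only [map_add, hp, hq]
  | monomial s r =>
    have h1 : (aeval (fun i : Fin n => esymm (Fin n) ℤ (i + 1))
        (monomial s r)).IsHomogeneous (Finsupp.weight (fun i : Fin n => (i : ℕ) + 1) s) := by
      rw [MvPolynomial.aeval_monomial, Finsupp.weight_apply, Finsupp.prod, Finsupp.sum]
      have h2 : ((algebraMap ℤ (MvPolynomial (Fin n) ℤ)) r).IsHomogeneous 0 := isHomogeneous_C _ r
      have h3 := h2.mul (IsHomogeneous.prod s.support
        (fun i => esymm (Fin n) ℤ ((i : ℕ) + 1) ^ s i) (fun i => ((i : ℕ) + 1) * s i)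
        (fun i _ => (isHomogeneous_esymm (Fin n) ℤ _).pow _))
      simpa [mul_comm] using h3
    have h4 := isWeightedHomogeneous_monomial (fun i : Fin n => (i : ℕ) + 1) s r rfl
    rw [homogeneousComponent_of_mem ((mem_homogeneousSubmodule _ _).2 h1),
      weightedHomogeneousComponent_of_mem ((mem_weightedHomogeneousSubmodule _ _ _ _).2 h4)]
    split_ifs <;> simp

open MvPolynomial in
theorem totalDegree_le_totalDegree_aeval_esymm {n : ℕ} (P : MvPolynomial (Fin n) ℤ) :
    P.totalDegree ≤ (aeval (fun i : Fin n => esymm (Fin n) ℤ (i + 1)) P).totalDegree := by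
  classical
  refine Finset.sup_le fun s hs => ?_
  set w : Fin n → ℕ := fun i => (i : ℕ) + 1 with hw
  have h1 : s.sum (fun _ e => e) ≤ Finsupp.weight w s := by
    rw [Finsupp.weight_apply]
    refine Finset.sum_le_sum fun i _ => ?_
    simp only [hw, smul_eq_mul]
    nlinarith [Nat.zero_le (i : ℕ), Nat.zero_le (s i)]
  refine h1.trans ?_
  by_contra! hlt
  have h2 := homogeneousComponent_aeval_esymm (Finsupp.weight w s) P
  rw [homogeneousComponent_eq_zero _ _ hlt] at h2
  have h3 : weightedHomogeneousComponent w (Finsupp.weight w s) P = 0 := by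
    refine esymmAlgHom_injective (σ := Fin n) (R := ℤ) (n := n) (by simp) ?_
    rw [map_zero]
    refine Subtype.val_injective ?_
    rw [esymmAlgHom_apply, ← h2]
    rfl
  have h4 := congrArg (MvPolynomial.coeff s) h3
  rw [coeff_weightedHomogeneousComponent, if_pos rfl, MvPolynomial.coeff_zero] at h4
  exact MvPolynomial.mem_support_iff.1 hs h4

open MvPolynomial in
/-- A multiplicative relation between the roots forces a polynomial relation of bounded degree
between their elementary symmetric functions. -/
theorem exists_mvPolynomial_of_relation {n : ℕ} (k : Fin n → ℤ) (hk : k ≠ 0) {T : ℕ}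
    (hT : ∀ i, |k i| ≤ T) : ∃ P : MvPolynomial (Fin n) ℤ, P ≠ 0 ∧
      P.totalDegree ≤ n.factorial * (n * T) ∧ ∀ α : Fin n → ℂ, (∀ i, α i ≠ 0) →
        ∏ i, α i ^ k i = 1 →
        aeval (fun i : Fin n => aeval α (esymm (Fin n) ℤ (i + 1))) P = 0 := by
  classical
  let s : (Fin n → ℤ) → Fin n →₀ ℕ := fun k => Finsupp.equivFunOnFinite.symm fun i => (k i).toNat
  let m : MvPolynomial (Fin n) ℤ := monomial (s k) 1 - monomial (s (-k)) 1
  have hm0 : m ≠ 0 := by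
    intro h
    rw [sub_eq_zero, MvPolynomial.monomial_eq_monomial_iff] at h
    simp only [one_ne_zero, and_self, or_false, and_true] at h
    refine hk (funext fun i => ?_)
    have h1 := DFunLike.congr_fun h i
    simp only [s, Finsupp.equivFunOnFinite_symm_apply_apply, Pi.neg_apply] at h1
    simp only [Pi.zero_apply]
    omega
  have hsdeg : ∀ k : Fin n → ℤ, (∀ i, |k i| ≤ T) →
      (monomial (s k) (1 : ℤ)).totalDegree ≤ n * T := by
    intro k hk
    rw [totalDegree_monomial _ one_ne_zero, Finsupp.sum_fintype _ _ (fun _ => rfl)]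
    calc _ ≤ ∑ _i : Fin n, T := Finset.sum_le_sum fun i _ => by
          have := (le_abs_self _).trans (hk i)
          simp only [s, Finsupp.equivFunOnFinite_symm_apply_apply]
          omega
      _ = n * T := by simp
  have hmdeg : m.totalDegree ≤ n * T :=
    (totalDegree_sub _ _).trans (max_le (hsdeg k hT) (hsdeg (-k) (by simpa using hT)))
  let S : MvPolynomial (Fin n) ℤ := ∏ σ : Equiv.Perm (Fin n), rename σ m
  have hS0 : S ≠ 0 := Finset.prod_ne_zero_iff.2 fun σ _ h =>
    hm0 (rename_injective σ σ.injective (by simpa using h))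
  have hSdeg : S.totalDegree ≤ n.factorial * (n * T) := by
    refine (totalDegree_finsetProd _ _).trans ?_
    calc _ ≤ ∑ _σ : Equiv.Perm (Fin n), n * T :=
          Finset.sum_le_sum fun σ _ => (totalDegree_rename_le _ _).trans hmdeg
      _ = _ := by simp [Fintype.card_perm]
  have hSsymm : S.IsSymmetric := by
    intro τ
    simp only [S, map_prod, rename_rename]
    exact Fintype.prod_equiv (Equiv.mulLeft τ) _ _ fun σ => rfl
  obtain ⟨P, hP⟩ := esymmAlgHom_surjective (σ := Fin n) ℤ (n := n) (by simp) ⟨S, hSsymm⟩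
  have hP' : aeval (fun i : Fin n => esymm (Fin n) ℤ (i + 1)) P = S := by
    rw [← esymmAlgHom_apply, hP]
  refine ⟨P, ?_, ?_, ?_⟩
  · rintro rfl
    rw [map_zero] at hP'
    exact hS0 hP'.symm
  · exact (totalDegree_le_totalDegree_aeval_esymm P).trans (hP' ▸ hSdeg)
  · intro α hα hrel
    rw [← MvPolynomial.comp_aeval_apply, hP']
    simp only [S, map_prod]
    refine Finset.prod_eq_zero (Finset.mem_univ 1) ?_
    have h2 : ∀ k : Fin n → ℤ, aeval α (monomial (s k) (1 : ℤ)) = ∏ i, α i ^ (k i).toNat := by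
      intro k
      rw [MvPolynomial.aeval_monomial, map_one, one_mul,
        Finsupp.prod_fintype _ _ (fun _ => pow_zero _)]
      simp [s]
    have h3 : ∏ i, α i ^ (k i).toNat = (∏ i, α i ^ k i) * ∏ i, α i ^ ((-k) i).toNat := by
      rw [← Finset.prod_mul_distrib]
      refine Finset.prod_congr rfl fun i _ => ?_
      rw [← zpow_natCast, ← zpow_natCast, ← zpow_add₀ (hα i)]
      congr 1
      rw [Pi.neg_apply]
      omega
    rw [Equiv.Perm.coe_one, rename_id_apply, map_sub, h2, h2, h3, hrel, one_mul, sub_self]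

/-- For a fixed relation, the monic polynomials of bounded height whose roots satisfy it are few,
by the Schwartz–Zippel bound applied to the symmetrized relation. -/
theorem exists_finset_of_relation {n : ℕ} (hn : 0 < n) (k : Fin n → ℤ) (hk : k ≠ 0) {T : ℕ}
    (hT : ∀ i, |k i| ≤ T) {H : ℤ} (hH : 0 ≤ H) : ∃ F : Finset ℤ[X],
      (F.card : ℝ) ≤ n.factorial * (n * T) * (2 * H + 1) ^ (n - 1) ∧
      ∀ f : ℤ[X], f.Monic → f.natDegree = n → HeightLe f H → ∀ α : Fin n → ℂ,
        f.map (Int.castRingHom ℂ) = ∏ i, (X - C (α i)) → (∀ i, α i ≠ 0) →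
        ∏ i, α i ^ k i = 1 → f ∈ F := by
  classical
  obtain ⟨P, hP0, hPdeg, hP⟩ := exists_mvPolynomial_of_relation k hk hT
  let S : Finset ℤ := Finset.Icc (-H) H
  have hS : (S.card : ℤ) = 2 * H + 1 := by
    rw [Int.card_Icc, Int.toNat_of_nonneg (by omega)]; ring
  let Z := {y ∈ Fintype.piFinset fun _ : Fin n => S | MvPolynomial.eval y P = 0}
  let Φ : (Fin n → ℤ) → ℤ[X] := fun y =>
    X ^ n + ∑ j : Fin n, C ((-1) ^ (n - (j : ℕ)) * y j.rev) * X ^ (j : ℕ)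
  refine ⟨Z.image Φ, ?_, ?_⟩
  · have hS0 : (0 : ℝ) < S.card := by
      have : (0 : ℤ) < S.card := by omega
      exact_mod_cast this
    have hS' : (S.card : ℝ) = 2 * H + 1 := by exact_mod_cast hS
    have h1 : (Z.card : ℝ) / (S.card : ℝ) ^ n ≤ P.totalDegree / S.card := by
      have := MvPolynomial.schwartz_zippel_totalDegree hP0 S
      have h2 := (NNRat.cast_le (K := ℝ)).2 this
      push_cast at h2
      exact h2
    have h3 : (Z.card : ℝ) ≤ P.totalDegree * (S.card : ℝ) ^ (n - 1) := by
      rw [div_le_div_iff₀ (by positivity) hS0] at h1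
      obtain ⟨m, rfl⟩ : ∃ m, n = m + 1 := ⟨n - 1, by omega⟩
      rw [pow_succ, ← mul_assoc] at h1
      exact le_of_mul_le_mul_right h1 hS0
    rw [← hS']
    calc ((Z.image Φ).card : ℝ) ≤ Z.card := by exact_mod_cast Finset.card_image_le
      _ ≤ P.totalDegree * (S.card : ℝ) ^ (n - 1) := h3
      _ ≤ _ := by gcongr; exact_mod_cast hPdeg
  · intro f hf hdeg hfH α hα hα0 hrel
    refine Finset.mem_image.2 ⟨fun i => (-1) ^ ((i : ℕ) + 1) * f.coeff i.rev, ?_, ?_⟩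
    · refine Finset.mem_filter.2 ⟨?_, ?_⟩
      · rw [Fintype.mem_piFinset]
        intro i
        rw [Finset.mem_Icc, ← abs_le, abs_mul, abs_pow, abs_neg, abs_one, one_pow, one_mul]
        exact hfH _
      · have h4 := hP α hα0 hrel
        have h5 : (fun i : Fin n => MvPolynomial.aeval α (MvPolynomial.esymm (Fin n) ℤ (i + 1))) =
            algebraMap ℤ ℂ ∘ fun i : Fin n => (-1) ^ ((i : ℕ) + 1) * f.coeff i.rev := by
          funext i
          rw [Function.comp_apply]
          have h6 : (f.map (Int.castRingHom ℂ)).coeff i.rev =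
              (-1) ^ ((i : ℕ) + 1) * (Finset.univ.val.map α).esymm (i + 1) := by
            have h7 := Multiset.prod_X_sub_C_coeff (Finset.univ.val.map α) (k := i.rev)
              (by simp)
            rw [Multiset.map_map] at h7
            rw [hα]
            refine h7.trans ?_
            have h8 : n - (n - ((i : ℕ) + 1)) = i + 1 := by omega
            simp [h8]
          rw [coeff_map] at h6
          rw [MvPolynomial.aeval_esymm_eq_multiset_esymm, map_mul]
          simp only [algebraMap_int_eq] at h6 ⊢
          rw [h6, ← mul_assoc, map_pow, map_neg, map_one, ← mul_pow]
          simp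
        rw [h5, MvPolynomial.aeval_algebraMap_apply] at h4
        have h9 := (algebraMap ℤ ℂ).injective_int (h4.trans (map_zero _).symm)
        rwa [MvPolynomial.aeval_eq_eval] at h9
    · conv_rhs => rw [hf.as_sum, hdeg,
        ← Fin.sum_univ_eq_sum_range (fun i => C (f.coeff i) * X ^ i) n]
      simp only [Φ]
      congr 1
      refine Finset.sum_congr rfl fun j _ => ?_
      have h10 : (j.rev : ℕ) + 1 = n - j := by rw [Fin.val_rev]; omega
      rw [Fin.rev_rev, ← mul_assoc, h10, ← mul_pow]
      simp

theorem exists_injective_roots {f : ℤ[X]} {n : ℕ} (hf : f.Monic) (hdeg : f.natDegree = n)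
    (hn : 2 ≤ n) (hirr : Irreducible f) : ∃ α : Fin n → ℂ, Function.Injective α ∧
      (∀ i, α i ≠ 0) ∧ f.map (Int.castRingHom ℂ) = ∏ i, (X - C (α i)) ∧
      nzRoots f = Finset.univ.image α := by
  classical
  have hirrQ : Irreducible (f.map (algebraMap ℤ ℚ)) :=
    (hf.irreducible_iff_irreducible_map_fraction_map).1 hirr
  have hmap : (f.map (algebraMap ℤ ℚ)).map (algebraMap ℚ ℂ) = f.map (Int.castRingHom ℂ) := by
    rw [map_map]; congr 1
  have hsep : (f.map (Int.castRingHom ℂ)).Separable := by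
    rw [← hmap]; exact hirrQ.separable.map
  have hnodup := nodup_roots hsep
  have hfm := hf.map (Int.castRingHom ℂ)
  have hsplit := IsAlgClosed.splits (f.map (Int.castRingHom ℂ))
  have hcard : (f.map (Int.castRingHom ℂ)).roots.toFinset.card = n := by
    rw [Multiset.toFinset_card_of_nodup hnodup, ← hsplit.natDegree_eq_card_roots,
      hf.natDegree_map, hdeg]
  set R := (f.map (Int.castRingHom ℂ)).roots.toFinset with hR
  let e := (R.equivFinOfCardEq hcard).symm
  have himage : Finset.univ.image (fun i => (e i : ℂ)) = R := by
    ext z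
    simp only [Finset.mem_image, Finset.mem_univ, true_and]
    exact ⟨fun ⟨i, hi⟩ => hi ▸ (e i).2, fun hz => ⟨e.symm ⟨z, hz⟩, by simp⟩⟩
  have h0 : ∀ i, (e i : ℂ) ≠ 0 := by
    intro i hi
    have h1 := (e i).2
    rw [hi, hR, Multiset.mem_toFinset, mem_roots hfm.ne_zero, IsRoot, ← coeff_zero_eq_eval_zero,
      coeff_map, eq_intCast, Int.cast_eq_zero] at h1
    have h2 : X ∣ f := X_dvd_iff.2 h1
    have h3 := natDegree_eq_of_degree_eq (degree_eq_degree_of_associated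
      ((irreducible_X.dvd_irreducible_iff_associated hirr).1 h2))
    rw [natDegree_X] at h3
    omega
  refine ⟨fun i => e i, Subtype.val_injective.comp e.injective, h0, ?_, ?_⟩
  · rw [← Finset.prod_image (s := Finset.univ) (g := fun i => (e i : ℂ)) (f := fun z => X - C z)
      ((Subtype.val_injective.comp e.injective).injOn), himage, hR, Finset.prod,
      Multiset.toFinset_val, Multiset.dedup_eq_self.2 hnodup]
    exact hsplit.eq_prod_roots_of_monic hfm
  · rw [himage, nzRoots, Finset.filter_eq_self]
    intro z hz
    rw [← hR, ← himage, Finset.mem_image] at hz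
    obtain ⟨i, -, rfl⟩ := hz
    exact h0 i

theorem mulDep_image_iff {n : ℕ} {α : Fin n → ℂ} (hα : Function.Injective α) :
    MulDep (Finset.univ.image α) ↔ ∃ k : Fin n → ℤ, k ≠ 0 ∧ ∏ i, α i ^ k i = 1 := by
  classical
  constructor
  · rintro ⟨k, ⟨z, hz, hkz⟩, hk⟩
    obtain ⟨i, -, rfl⟩ := Finset.mem_image.1 hz
    refine ⟨k ∘ α, fun h => hkz (congrFun h i), ?_⟩
    rwa [Finset.prod_image hα.injOn] at hk
  · rintro ⟨k, hk0, hk⟩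
    obtain ⟨i, hi⟩ := Function.ne_iff.1 hk0
    refine ⟨Function.extend α k 0, ⟨α i, by simp, by rwa [hα.extend_apply]⟩, ?_⟩
    rw [Finset.prod_image hα.injOn, ← hk]
    simp [hα.extend_apply]

theorem exists_finite_Iset_and_ncard_le (n : ℕ) (hn : 2 ≤ n) : ∃ c : ℝ, 0 < c ∧
    ∀ H : ℤ, 3 ≤ H → (Iset n H).Finite ∧
      ((Iset n H).ncard : ℝ) ≤ c * (H : ℝ) ^ (n - 1) * Real.log H ^ (2 * n ^ 2 - n - 1) := by
  classical
  obtain ⟨A, hA, hlogrel⟩ := exists_log_bounded_relation n (by omega)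
  refine ⟨(3 * A) ^ n * (n.factorial * (n * A)) * 3 ^ (n - 1), by positivity, fun H hH => ?_⟩
  have hHR : (3 : ℝ) ≤ H := by exact_mod_cast hH
  have hlog : 1 ≤ Real.log H := by
    rw [Real.le_log_iff_exp_le (by linarith)]
    linarith [Real.exp_one_lt_d9]
  set L := Real.log H with hL
  set T := ⌊A * L ^ (n - 1)⌋₊ with hT
  have hTle : (T : ℝ) ≤ A * L ^ (n - 1) := Nat.floor_le (by positivity)
  have hAL : 1 ≤ A * L ^ (n - 1) :=
    one_le_mul_of_one_le_of_one_le (by exact_mod_cast hA) (one_le_pow₀ hlog)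
  have hbox : ∀ k : {k : Fin n → ℤ // k ≠ 0 ∧ ∀ i, |k i| ≤ (T : ℤ)}, _ := fun k =>
    exists_finset_of_relation (by omega) k.1 k.2.1 k.2.2 (by omega : 0 ≤ H)
  choose F hFcard hF using hbox
  let G : (Fin n → ℤ) → Finset ℤ[X] := fun k =>
    if h : k ≠ 0 ∧ ∀ i, |k i| ≤ (T : ℤ) then F ⟨k, h⟩ else ∅
  let box := Fintype.piFinset fun _ : Fin n => Finset.Icc (-T : ℤ) T
  have hsub : Iset n H ⊆ (box.biUnion G : Finset ℤ[X]) := by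
    rintro f ⟨hf, hdeg, hfH, hirr, -, hgen⟩
    obtain ⟨α, hα, hα0, hfα, hnz⟩ := exists_injective_roots hf hdeg hn hirr
    rw [hnz, mulDep_image_iff hα] at hgen
    obtain ⟨b, hb0, hb, hbrel⟩ := hlogrel H hH f hf hdeg hfH α hfα hα0 hgen
    have hbT : ∀ i, |b i| ≤ (T : ℤ) := by
      intro i
      have h1 : (b i).natAbs ≤ T := by
        refine Nat.le_floor ?_
        rw [Nat.cast_natAbs, Int.cast_abs]
        exact hb i
      rw [Int.abs_eq_natAbs]
      exact_mod_cast h1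
    rw [Finset.mem_coe, Finset.mem_biUnion]
    refine ⟨b, Fintype.mem_piFinset.2 fun i => Finset.mem_Icc.2 (abs_le.1 (hbT i)), ?_⟩
    simp only [G, dif_pos (And.intro hb0 hbT)]
    exact hF _ f hf hdeg hfH α hfα hα0 hbrel
  refine ⟨(Finset.finite_toSet _).subset hsub, ?_⟩
  have hbound : (0 : ℝ) ≤ n.factorial * (n * T) * (2 * H + 1) ^ (n - 1) := by positivity
  have hbox_card : (box.card : ℝ) = (2 * T + 1) ^ n := by
    have h2 : (Finset.Icc (-T : ℤ) T).card = 2 * T + 1 := by rw [Int.card_Icc]; omega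
    rw [Fintype.card_piFinset]
    simp [h2]
  calc ((Iset n H).ncard : ℝ) ≤ (box.biUnion G).card := by
        have := Set.ncard_le_ncard hsub (Finset.finite_toSet _)
        rw [Set.ncard_coe_finset] at this
        exact_mod_cast this
    _ ≤ ∑ k ∈ box, ((G k).card : ℝ) := by exact_mod_cast Finset.card_biUnion_le
    _ ≤ ∑ _k ∈ box, (n.factorial * (n * T) * (2 * H + 1) ^ (n - 1) : ℝ) := by
        refine Finset.sum_le_sum fun k _ => ?_
        simp only [G]
        split_ifs with h
        · exact hFcard _
        · simpa using hbound
    _ = (2 * T + 1) ^ n * (n.factorial * (n * T) * (2 * H + 1) ^ (n - 1)) := by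
        rw [Finset.sum_const, nsmul_eq_mul, hbox_card]
    _ ≤ (3 * (A * L ^ (n - 1))) ^ n *
          (n.factorial * (n * (A * L ^ (n - 1))) * (3 * H) ^ (n - 1)) := by
        gcongr <;> linarith
    _ = (3 * A) ^ n * (n.factorial * (n * A)) * 3 ^ (n - 1) * (H : ℝ) ^ (n - 1) *
          (L ^ (n - 1) * (L ^ (n - 1)) ^ n) := by
        simp only [mul_pow]; ring
    _ ≤ _ := by
        gcongr
        rw [← pow_mul, ← pow_add]
        refine pow_le_pow_right₀ hlog ?_
        obtain ⟨m, rfl⟩ : ∃ m, n = m + 2 := ⟨n - 2, by omega⟩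
        have : m + 2 - 1 = m + 1 := by omega
        rw [this, Nat.sub_sub]
        refine Nat.le_sub_of_add_le ?_
        nlinarith

theorem exists_monic_irreducible_natDegree (p : ℕ) [Fact p.Prime] {n : ℕ} (hn : n ≠ 0) :
    ∃ g : (ZMod p)[X], g.Monic ∧ Irreducible g ∧ g.natDegree = n := by
  obtain ⟨a, ha⟩ := Field.exists_primitive_element (ZMod p) (GaloisField p n)
  have hint := Algebra.IsIntegral.isIntegral (R := ZMod p) a
  refine ⟨minpoly (ZMod p) a, minpoly.monic hint, minpoly.irreducible hint, ?_⟩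
  rw [(Field.primitive_element_iff_minpoly_natDegree_eq (ZMod p) a).1 ha, GaloisField.finrank p hn]

theorem genDeg_of_natAbs_coeff_zero_eq_one {f : ℤ[X]} (hf : f.Monic) (hdeg : 2 ≤ f.natDegree)
    (hirr : Irreducible f) (h0 : (f.coeff 0).natAbs = 1) : GenDeg f := by
  classical
  obtain ⟨α, hα, -, hfα, hnz⟩ := exists_injective_roots hf rfl hdeg hirr
  refine ⟨hdeg, ?_⟩
  rw [hnz, mulDep_image_iff hα]
  refine ⟨fun _ => 2, fun h => by simpa using congrFun h ⟨0, by omega⟩, ?_⟩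
  have h1 := congrArg (coeff · 0) hfα
  simp only [coeff_map, coeff_zero_prod, coeff_sub, coeff_X_zero, coeff_C_zero, zero_sub] at h1
  have h2 : (f.coeff 0) ^ 2 = 1 := by
    rw [← Int.natAbs_sq, h0]; norm_num
  calc ∏ i, α i ^ (2 : ℤ) = (∏ i, -α i) ^ 2 := by
        rw [← Finset.prod_pow]
        exact Finset.prod_congr rfl fun i _ => by rw [neg_sq]; norm_cast
    _ = 1 := by
        rw [← h1, eq_intCast]
        exact_mod_cast h2

/-- Lower bound by monic polynomials with constant term `1` that reduce to a fixed irreducible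
polynomial modulo `2`. -/
theorem le_ncard_Iset {n : ℕ} (hn : 2 ≤ n) {H : ℤ} (hH : 1 ≤ H) (hfin : (Iset n H).Finite) :
    (1 / 2 : ℝ) ^ (n - 1) * (H : ℝ) ^ (n - 1) ≤ ((Iset n H).ncard : ℝ) := by
  classical
  obtain ⟨g, hg, hgirr, hgdeg⟩ := exists_monic_irreducible_natDegree 2 (by omega : n ≠ 0)
  set r : ℕ → ℤ := fun i => ((g.coeff i).val : ℤ) with hr
  have hrcast : ∀ i, ((r i : ℤ) : ZMod 2) = g.coeff i := fun i => by simp [hr]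
  have hr01 : ∀ i, 0 ≤ r i ∧ r i ≤ 1 := fun i => by
    have := ZMod.val_lt (g.coeff i)
    simp only [hr]; omega
  have hg0 : g.coeff 0 = 1 := by
    have h1 : g.coeff 0 ≠ 0 := by
      intro h
      have h3 := natDegree_eq_of_degree_eq (degree_eq_degree_of_associated
        ((irreducible_X.dvd_irreducible_iff_associated hgirr).1 (X_dvd_iff.2 h)))
      rw [natDegree_X] at h3
      omega
    generalize g.coeff 0 = c at h1 ⊢
    revert c; decide
  obtain ⟨m, rfl⟩ : ∃ m, n = m + 1 := ⟨n - 1, by omega⟩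
  set M : ℕ := ((H + 1) / 2).toNat with hM
  let c : (Fin m → Fin M) → ℕ → ℤ := fun y i =>
    if h : 0 < i ∧ i - 1 < m then r i + 2 * (y ⟨i - 1, h.2⟩ : ℕ) else r i
  let Φ : (Fin m → Fin M) → ℤ[X] := fun y =>
    X ^ (m + 1) + ∑ i ∈ Finset.range (m + 1), C (c y i) * X ^ i
  have hdlt : ∀ y, (∑ i ∈ Finset.range (m + 1), C (c y i) * X ^ i).degree <
      ((m + 1 : ℕ) : WithBot ℕ) :=
    fun _ => (degree_sum_le _ _).trans_lt ((Finset.sup_lt_iff (by simp)).2 fun i hi =>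
      (degree_C_mul_X_pow_le _ _).trans_lt (by exact_mod_cast Finset.mem_range.1 hi))
  have hmonic : ∀ y, (Φ y).Monic := fun y => monic_X_pow_add (hdlt y)
  have hdeg : ∀ y, (Φ y).natDegree = m + 1 := fun y => natDegree_eq_of_degree_eq_some
    ((degree_add_eq_left_of_degree_lt (by rw [degree_X_pow]; exact hdlt y)).trans (degree_X_pow _))
  have hcoeff : ∀ y i, i < m + 1 → (Φ y).coeff i = c y i := by
    intro y i hi
    simp [Φ, coeff_X_pow, hi.ne, Finset.sum_ite_eq, hi]
  have hccast : ∀ y i, ((c y i : ℤ) : ZMod 2) = g.coeff i := by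
    intro y i
    have h2 : (2 : ZMod 2) = 0 := rfl
    simp only [c]
    split_ifs <;> simp [hrcast, h2]
  have hc : ∀ y i, |c y i| ≤ H := by
    intro y i
    have h4 := hr01 i
    simp only [c]
    split_ifs with h
    · have h5 := (y ⟨i - 1, h.2⟩).2
      rw [abs_le]; omega
    · rw [abs_le]; omega
  have hmapg : ∀ y, (Φ y).map (Int.castRingHom (ZMod 2)) = g := by
    intro y
    ext i
    rw [coeff_map, eq_intCast]
    rcases lt_trichotomy i (m + 1) with h | rfl | h
    · rw [hcoeff y i h, hccast]
    · have h6 := (hmonic y).coeff_natDegree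
      have h7 := hg.coeff_natDegree
      rw [hdeg] at h6
      rw [hgdeg] at h7
      rw [h6, h7, Int.cast_one]
    · rw [coeff_eq_zero_of_natDegree_lt (by rw [hdeg]; exact h),
        coeff_eq_zero_of_natDegree_lt (by rw [hgdeg]; exact h), Int.cast_zero]
  have hmem : ∀ y, Φ y ∈ Iset (m + 1) H := by
    intro y
    have hirr : Irreducible (Φ y) :=
      (hmonic y).irreducible_of_irreducible_map (Int.castRingHom (ZMod 2)) _
        ((hmapg y).symm ▸ hgirr)
    refine ⟨hmonic y, hdeg y, fun i => ?_, hirr,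
      genDeg_of_natAbs_coeff_zero_eq_one (hmonic y) (by rw [hdeg]; exact hn) hirr ?_⟩
    · rcases lt_trichotomy i (m + 1) with h | rfl | h
      · rw [hcoeff y i h]; exact hc y i
      · have h6 := (hmonic y).coeff_natDegree
        rw [hdeg] at h6
        rw [h6, abs_one]; exact hH
      · rw [coeff_eq_zero_of_natDegree_lt (by rw [hdeg]; exact h), abs_zero]; omega
    · rw [hcoeff y 0 (by omega)]
      simp only [c, hr, hg0, lt_irrefl, false_and, dite_false]
      rfl
  have hinj : Function.Injective Φ := by
    intro y y' h
    ext i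
    have h8 : c y (i + 1) = c y' (i + 1) := by
      rw [← hcoeff y (i + 1) (by omega), ← hcoeff y' (i + 1) (by omega), h]
    simp only [c, Nat.add_sub_cancel, i.2, Nat.succ_pos, and_self, dif_pos, Fin.eta] at h8
    omega
  have hcard : M ^ m ≤ (Iset (m + 1) H).ncard := by
    have h9 := Set.ncard_le_ncard (Set.range_subset_iff.2 hmem) hfin
    rw [← Set.image_univ, Set.ncard_image_of_injective _ hinj, Set.ncard_univ] at h9
    simpa using h9
  have hMH : (H : ℝ) ≤ 2 * M := by
    have : H ≤ 2 * M := by omega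
    exact_mod_cast this
  have hH0 : (0 : ℝ) ≤ H := by
    have : (0 : ℤ) ≤ H := by omega
    exact_mod_cast this
  calc (1 / 2 : ℝ) ^ m * (H : ℝ) ^ m = (H / 2) ^ m := by rw [← mul_pow]; ring
    _ ≤ (M : ℝ) ^ m := pow_le_pow_left₀ (by positivity) (by linarith) m
    _ ≤ _ := by exact_mod_cast hcard

theorem stmt_0 (n : ℕ) (hn : 2 ≤ n) :
    ∃ c1 c2 : ℝ, 0 < c1 ∧ 0 < c2 ∧ ∀ H : ℤ, 3 ≤ H →
      c1 * (H : ℝ) ^ (n - 1) ≤ ((Iset n H).ncard : ℝ) ∧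
      ((Iset n H).ncard : ℝ) ≤ c2 * (H : ℝ) ^ (n - 1) * (Real.log H) ^ (2 * n ^ 2 - n - 1) := by
  obtain ⟨c2, hc2, h⟩ := exists_finite_Iset_and_ncard_le n hn
  exact ⟨(1 / 2) ^ (n - 1), c2, by positivity, hc2, fun H hH =>
    ⟨le_ncard_Iset hn (by omega) (h H hH).1, (h H hH).2⟩⟩
end

section
/- For every odd prime p there exists a constant C > 0, depending only on p, such that for every integer H ≥ 3, |#I_p(H) − 2^p·H^(p−1)| ≤ C·H^(p−2), where #I_p(H) is the number of generalized degenerate monic integer polynomials of degree p and height at most H that are irreducible over ℤ. -/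
open Polynomial MeasureTheory

theorem succ_pow_le (x q : ℕ) : (x + 1) ^ (q + 1) ≤ x ^ (q + 1) + (q + 1) * (x + 1) ^ q := by
  induction q with
  | zero => simp
  | succ q ih =>
    have h : x ^ (q + 1) ≤ (x + 1) ^ (q + 1) := Nat.pow_le_pow_left (Nat.le_succ x) _
    calc (x + 1) ^ (q + 1 + 1) = (x + 1) ^ (q + 1) * (x + 1) := pow_succ _ _
      _ ≤ (x ^ (q + 1) + (q + 1) * (x + 1) ^ q) * (x + 1) := by gcongr
      _ = x ^ (q + 1 + 1) + x ^ (q + 1) + (q + 1) * (x + 1) ^ (q + 1) := by ring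
      _ ≤ _ := by linarith

/-- Monic integer polynomials of degree `n`, height at most `H` and constant term `±1`. -/
def unitConstSet (n H : ℕ) : Set ℤ[X] :=
  {f | f.Monic ∧ f.natDegree = n ∧ HeightLe f H ∧ |f.coeff 0| = 1}

theorem unitConstSet_bijOn (m : ℕ) {H : ℕ} (hH : 1 ≤ H) :
    Set.BijOn (fun (f : ℤ[X]) (i : Fin (m + 1)) => f.coeff i) (unitConstSet (m + 1) H)
      (Fintype.piFinset fun i : Fin (m + 1) =>
        if i = 0 then ({1, -1} : Finset ℤ) else Finset.Icc (-(H : ℤ)) H) := by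
  refine ⟨?_, ?_, ?_⟩
  · rintro f ⟨-, -, h, h0⟩
    rw [Finset.mem_coe, Fintype.mem_piFinset]
    intro i
    split_ifs with hi
    · subst hi
      simpa using (abs_eq zero_le_one).1 h0
    · simpa [abs_le] using h i
  · rintro f ⟨hf, hfd, -, -⟩ g ⟨hg, hgd, -, -⟩ hfg
    ext i
    rcases lt_trichotomy i (m + 1) with hi | rfl | hi
    · exact congrFun hfg ⟨i, hi⟩
    · have h1 := hf.coeff_natDegree
      have h2 := hg.coeff_natDegree
      rw [hfd] at h1
      rw [hgd] at h2
      rw [h1, h2]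
    · rw [coeff_eq_zero_of_natDegree_lt (hfd ▸ hi), coeff_eq_zero_of_natDegree_lt (hgd ▸ hi)]
  · intro c hc
    rw [Finset.mem_coe, Fintype.mem_piFinset] at hc
    have hdeg : (∑ i : Fin (m + 1), C (c i) * X ^ (i : ℕ)).degree < ((m + 1 : ℕ) : WithBot ℕ) :=
      degree_sum_fin_lt c
    have hcoeff : ∀ j, (X ^ (m + 1) + ∑ i : Fin (m + 1), C (c i) * X ^ (i : ℕ)).coeff j =
        if h : j < m + 1 then c ⟨j, h⟩ else if j = m + 1 then 1 else 0 := by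
      intro j
      rw [coeff_add, coeff_X_pow, finsetSum_coeff]
      simp only [coeff_C_mul, coeff_X_pow]
      split_ifs with h1 h2 h2
      · omega
      · subst h1
        simp only [mul_ite, mul_one, mul_zero, add_eq_left]
        exact Finset.sum_eq_zero fun i _ => if_neg (by omega)
      · rw [zero_add, Finset.sum_eq_single ⟨j, h2⟩]
        · simp
        · intro b _ hb
          rw [if_neg, mul_zero]
          rintro rfl
          exact hb rfl
        · simp
      · rw [zero_add]
        exact Finset.sum_eq_zero fun i _ => by rw [if_neg (by omega), mul_zero]
    refine ⟨X ^ (m + 1) + ∑ i : Fin (m + 1), C (c i) * X ^ (i : ℕ),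
      ⟨monic_X_pow_add hdeg, natDegree_eq_of_degree_eq_some ?_, ?_, ?_⟩, ?_⟩
    · rw [degree_add_eq_left_of_degree_lt (by rwa [degree_X_pow]), degree_X_pow]
    · intro j
      rw [hcoeff]
      split_ifs with h h'
      · have := hc ⟨j, h⟩
        split_ifs at this
        · simp only [Finset.mem_insert, Finset.mem_singleton] at this
          rcases this with h | h <;> rw [h] <;> simpa using hH
        · rwa [Finset.mem_Icc, ← abs_le] at this
      · simpa using hH
      · simp
    · have := hc 0
      rw [hcoeff, dif_pos (Nat.succ_pos m)]
      simpa [abs_eq] using this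
    · funext i
      exact (hcoeff i).trans (dif_pos i.2)

theorem unitConstSet_finite_succ (m : ℕ) {H : ℕ} (hH : 1 ≤ H) :
    (unitConstSet (m + 1) H).Finite :=
  (unitConstSet_bijOn m hH).finite_iff_finite.2 (Finset.finite_toSet _)

theorem ncard_unitConstSet_succ (m : ℕ) {H : ℕ} (hH : 1 ≤ H) :
    (unitConstSet (m + 1) H).ncard = 2 * (2 * H + 1) ^ m := by
  have h := unitConstSet_bijOn m hH
  rw [← h.injOn.ncard_image, h.image_eq, Set.ncard_coe_finset,
    Fintype.card_piFinset, Fin.prod_univ_succ]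
  have : ((H : ℤ) + 1 + H).toNat = 2 * H + 1 := by omega
  simp [Fin.succ_ne_zero, this]

theorem ncard_unitConstSet_le {n H : ℕ} (hn : 1 ≤ n) (hH : 1 ≤ H) :
    (unitConstSet n H).ncard ≤ 2 * (3 * H) ^ (n - 1) := by
  obtain ⟨m, rfl⟩ := Nat.exists_eq_succ_of_ne_zero (Nat.one_le_iff_ne_zero.1 hn)
  rw [Nat.succ_eq_add_one, ncard_unitConstSet_succ m hH, Nat.add_sub_cancel]
  gcongr
  omega

theorem unitConstSet_finite {n H : ℕ} (hn : 1 ≤ n) (hH : 1 ≤ H) :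
    (unitConstSet n H).Finite := by
  obtain ⟨m, rfl⟩ := Nat.exists_eq_succ_of_ne_zero (Nat.one_le_iff_ne_zero.1 hn)
  exact unitConstSet_finite_succ m hH

theorem isometry_intCast_complex : Isometry (Int.castRingHom ℂ) :=
  Isometry.of_dist_eq fun a b => by
    simp [dist_eq_norm, ← Int.cast_sub, Int.norm_eq_abs]

/-- The product of the heights of two integer polynomials is bounded by a constant times the height
of the product. -/
theorem natAbs_coeff_mul_natAbs_coeff_le {g h : ℤ[X]} {H : ℕ} (hH : HeightLe (g * h) H) (i j : ℕ) :
    (g.coeff i).natAbs * (h.coeff j).natAbs ≤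
      2 ^ g.natDegree * 2 ^ h.natDegree * (((g * h).natDegree + 1) * H) := by
  have hv := isometry_intCast_complex
  have h1 := norm_coeff_le_choose_mul_mapMahlerMeasure _ hv i g
  have h2 := norm_coeff_le_choose_mul_mapMahlerMeasure _ hv j h
  have h3 := mapMahlerMeasure_le_sum_norm_coeff (g * h) _ hv
  have c1 : ((g.natDegree.choose i : ℕ) : ℝ) ≤ 2 ^ g.natDegree := by
    exact_mod_cast Nat.choose_le_two_pow _ _
  have c2 : ((h.natDegree.choose j : ℕ) : ℝ) ≤ 2 ^ h.natDegree := by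
    exact_mod_cast Nat.choose_le_two_pow _ _
  have h4 : ((g * h).sum fun _ a => ‖a‖) ≤ ((g * h).natDegree + 1) * H := by
    rw [sum_over_range _ (fun _ => norm_zero)]
    refine (Finset.sum_le_card_nsmul _ _ (H : ℝ) fun k _ => ?_).trans_eq (by simp)
    rw [Int.norm_eq_abs]
    exact_mod_cast hH k
  rw [mapMahlerMeasure_mul] at h3
  have n1 := mapMahlerMeasure_nonneg g (Int.castRingHom ℂ)
  have n2 := mapMahlerMeasure_nonneg h (Int.castRingHom ℂ)
  have key : ‖g.coeff i‖ * ‖h.coeff j‖ ≤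
      2 ^ g.natDegree * 2 ^ h.natDegree * (((g * h).natDegree + 1) * H) :=
    calc ‖g.coeff i‖ * ‖h.coeff j‖
      _ ≤ (2 ^ g.natDegree * g.mapMahlerMeasure (Int.castRingHom ℂ)) *
          (2 ^ h.natDegree * h.mapMahlerMeasure (Int.castRingHom ℂ)) := by
        gcongr
        · exact h1.trans (by gcongr)
        · exact h2.trans (by gcongr)
      _ = 2 ^ g.natDegree * 2 ^ h.natDegree * (g.mapMahlerMeasure (Int.castRingHom ℂ) *
          h.mapMahlerMeasure (Int.castRingHom ℂ)) := by ring
      _ ≤ _ := mul_le_mul_of_nonneg_left (h3.trans h4) (by positivity)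
  rw [Int.norm_eq_abs, Int.norm_eq_abs] at key
  have e : ∀ a : ℤ, ((a.natAbs : ℕ) : ℝ) = |(a : ℝ)| := fun a => by
    rw [Nat.cast_natAbs, Int.cast_abs]
  rw [← e, ← e] at key
  exact_mod_cast key

theorem Polynomial.Monic.exists_natAbs_coeff_max {g : ℤ[X]} (hg : g.Monic) :
    ∃ A : ℕ, 1 ≤ A ∧ HeightLe g A ∧ ∃ i, (g.coeff i).natAbs = A := by
  have hne : g.support.Nonempty := support_nonempty.2 hg.ne_zero
  obtain ⟨i, -, hi⟩ := Finset.exists_max_image g.support (fun i => (g.coeff i).natAbs) hne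
  have hle : ∀ j, (g.coeff j).natAbs ≤ (g.coeff i).natAbs := fun j => by
    by_cases hj : j ∈ g.support
    · exact hi j hj
    · rw [notMem_support_iff.1 hj]
      exact Nat.zero_le _
  refine ⟨_, ?_, fun j => ?_, i, rfl⟩
  · simpa [hg.coeff_natDegree] using hle g.natDegree
  · rw [Int.abs_eq_natAbs]
    exact_mod_cast hle j

/-- A reducible element of `unitConstSet n H` is a product of two elements of such sets. -/
theorem exists_factors_of_not_irreducible {n H : ℕ} (hn : n ≠ 0) {f : ℤ[X]}
    (hf : f ∈ unitConstSet n H) (hirr : ¬ Irreducible f) :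
    ∃ d A B, 1 ≤ d ∧ 2 * d ≤ n ∧ 1 ≤ A ∧ 1 ≤ B ∧ A * B ≤ 2 ^ n * (n + 1) * H ∧
      (d = 1 → A = 1) ∧
      ∃ g ∈ unitConstSet d A, ∃ h ∈ unitConstSet (n - d) B, g * h = f := by
  obtain ⟨hmon, hdeg, hht, h0⟩ := hf
  rw [hmon.irreducible_iff_natDegree'] at hirr
  push Not at hirr
  have hf1 : f ≠ 1 := by
    rintro rfl
    exact hn (by simpa using hdeg.symm)
  obtain ⟨h, g, hh, hg, rfl, hmem⟩ := hirr hf1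
  rw [Finset.mem_Ioc, hdeg] at hmem
  rw [mul_comm] at hdeg hht h0
  have hdeg' : g.natDegree + h.natDegree = n := by rw [← hdeg, hg.natDegree_mul hh]
  rw [mul_coeff_zero, ← Int.isUnit_iff_abs_eq, IsUnit.mul_iff, Int.isUnit_iff_abs_eq,
    Int.isUnit_iff_abs_eq] at h0
  obtain ⟨A, hA1, hA, i, hi⟩ := hg.exists_natAbs_coeff_max
  obtain ⟨B, hB1, hB, j, hj⟩ := hh.exists_natAbs_coeff_max
  have hAB := natAbs_coeff_mul_natAbs_coeff_le hht i j
  rw [hi, hj, ← pow_add, hdeg', hdeg, ← mul_assoc] at hAB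
  refine ⟨g.natDegree, A, B, hmem.1, by omega, hA1, hB1, hAB, fun hd => ?_,
    g, ⟨hg, rfl, hA, h0.1⟩, h, ⟨hh, by omega, hB, h0.2⟩, mul_comm g h⟩
  refine le_antisymm ?_ hA1
  rw [← hi]
  match i with
  | 0 => have := h0.1; rw [Int.abs_eq_natAbs] at this; omega
  | 1 =>
    have := hg.coeff_natDegree
    rw [hd] at this
    simp [this]
  | i + 2 => simp [coeff_eq_zero_of_natDegree_lt (show g.natDegree < i + 2 by omega)]

/-- The products of an element of `unitConstSet d A` and one of `unitConstSet e B`. -/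
def unitConstMul (d e A B : ℕ) : Set ℤ[X] :=
  (fun q : ℤ[X] × ℤ[X] => q.1 * q.2) '' (unitConstSet d A ×ˢ unitConstSet e B)

theorem unitConstMul_finite {d e A B : ℕ} (hd : 1 ≤ d) (he : 1 ≤ e) (hA : 1 ≤ A) (hB : 1 ≤ B) :
    (unitConstMul d e A B).Finite :=
  ((unitConstSet_finite hd hA).prod (unitConstSet_finite he hB)).image _

theorem ncard_unitConstMul_le {d e A B : ℕ} (hd : 1 ≤ d) (he : 1 ≤ e) (hA : 1 ≤ A) (hB : 1 ≤ B) :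
    (unitConstMul d e A B).ncard ≤ 2 * (3 * A) ^ (d - 1) * (2 * (3 * B) ^ (e - 1)) := by
  refine (Set.ncard_image_le
    ((unitConstSet_finite hd hA).prod (unitConstSet_finite he hB))).trans ?_
  rw [Set.ncard_prod]
  exact Nat.mul_le_mul (ncard_unitConstSet_le hd hA) (ncard_unitConstSet_le he hB)

theorem unitConstSet_reducible_subset {n H : ℕ} (hn : n ≠ 0) :
    {f ∈ unitConstSet n H | ¬ Irreducible f} ⊆
      unitConstMul 1 (n - 1) 1 (2 ^ n * (n + 1) * H) ∪
      ⋃ d ∈ Finset.Icc 2 (n / 2), ⋃ A ∈ Finset.Icc 1 (2 ^ n * (n + 1) * H),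
        unitConstMul d (n - d) A (2 ^ n * (n + 1) * H / A) := by
  rintro f ⟨hf, hirr⟩
  obtain ⟨d, A, B, hd, hdn, hA, hB, hAB, hdA, g, hg, h, hh, rfl⟩ :=
    exists_factors_of_not_irreducible hn hf hirr
  have mono : ∀ {m N N' : ℕ} {q : ℤ[X]}, N ≤ N' → q ∈ unitConstSet m N → q ∈ unitConstSet m N' :=
    fun hNN hq => ⟨hq.1, hq.2.1, fun i => (hq.2.2.1 i).trans (by exact_mod_cast hNN), hq.2.2.2⟩
  rcases hd.eq_or_lt with rfl | hd
  · obtain rfl := hdA rfl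
    rw [one_mul] at hAB
    exact Or.inl ⟨(g, h), ⟨hg, mono hAB hh⟩, rfl⟩
  · right
    simp only [Set.mem_iUnion]
    exact ⟨d, Finset.mem_Icc.2 ⟨hd, by omega⟩, A,
      Finset.mem_Icc.2 ⟨hA, (Nat.le_mul_of_pos_right A hB).trans hAB⟩, (g, h),
      ⟨hg, mono ((Nat.le_div_iff_mul_le hA).2 (by rwa [mul_comm])) hh⟩, rfl⟩

theorem ncard_unitConstSet_reducible_le {n H : ℕ} (hn : 2 ≤ n) (hH : 1 ≤ H) :
    {f ∈ unitConstSet n H | ¬ Irreducible f}.ncard ≤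
      4 * (n + 1) * 3 ^ n * (2 ^ n * (n + 1)) ^ (n - 2) * H ^ (n - 2) := by
  have hsub := unitConstSet_reducible_subset (n := n) (H := H) (by omega)
  set K := 2 ^ n * (n + 1) * H with hK
  have hK1 : 1 ≤ K := Nat.succ_le_of_lt (by positivity)
  have hdiv : ∀ {A}, A ∈ Finset.Icc 1 K → 1 ≤ A ∧ 1 ≤ K / A := fun hA => by
    rw [Finset.mem_Icc] at hA
    exact ⟨hA.1, Nat.div_pos hA.2 hA.1⟩
  have hfin : (unitConstMul 1 (n - 1) 1 K ∪ ⋃ d ∈ Finset.Icc 2 (n / 2), ⋃ A ∈ Finset.Icc 1 K,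
      unitConstMul d (n - d) A (K / A)).Finite := by
    refine (unitConstMul_finite le_rfl (by omega) le_rfl hK1).union ?_
    refine (Finset.finite_toSet _).biUnion fun d hd => (Finset.finite_toSet _).biUnion fun A hA => ?_
    rw [Finset.mem_coe, Finset.mem_Icc] at hd
    exact unitConstMul_finite (by omega) (by omega) (hdiv hA).1 (hdiv hA).2
  have hlin : (unitConstMul 1 (n - 1) 1 K).ncard ≤ 4 * 3 ^ n * K ^ (n - 2) := by
    refine (ncard_unitConstMul_le le_rfl (by omega) le_rfl hK1).trans ?_
    rw [show n - 1 - 1 = n - 2 by omega, mul_pow 3 K, Nat.sub_self, pow_zero]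
    have : 3 ^ (n - 2) ≤ 3 ^ n := Nat.pow_le_pow_right (by norm_num) (by omega)
    calc _ = 4 * 3 ^ (n - 2) * K ^ (n - 2) := by ring
      _ ≤ _ := by gcongr
  have hbig : ∀ d ∈ Finset.Icc 2 (n / 2), ∀ A ∈ Finset.Icc 1 K,
      (unitConstMul d (n - d) A (K / A)).ncard ≤ 4 * 3 ^ n * K ^ (n - 3) := by
    intro d hd A hA
    rw [Finset.mem_Icc] at hd
    obtain ⟨hA1, hB1⟩ := hdiv hA
    refine (ncard_unitConstMul_le (by omega) (by omega) hA1 hB1).trans ?_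
    calc 2 * (3 * A) ^ (d - 1) * (2 * (3 * (K / A)) ^ (n - d - 1))
      _ = 4 * 3 ^ (d - 1 + (n - d - 1)) * (A ^ (d - 1) * (K / A) ^ (n - d - 1)) := by
        rw [mul_pow, mul_pow, pow_add]; ring
      _ ≤ 4 * 3 ^ n * (A ^ (n - d - 1) * (K / A) ^ (n - d - 1)) := by
        gcongr <;> omega
      _ = 4 * 3 ^ n * (A * (K / A)) ^ (n - d - 1) := by rw [mul_pow]
      _ ≤ 4 * 3 ^ n * K ^ (n - d - 1) := by
        gcongr
        exact Nat.mul_div_le K A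
      _ ≤ 4 * 3 ^ n * K ^ (n - 3) := by
        exact Nat.mul_le_mul_left _ (Nat.pow_le_pow_right hK1 (by omega))
  have hsum : (⋃ d ∈ Finset.Icc 2 (n / 2), ⋃ A ∈ Finset.Icc 1 K,
      unitConstMul d (n - d) A (K / A)).ncard ≤ n * (4 * 3 ^ n * K ^ (n - 2)) := by
    refine (Finset.set_ncard_biUnion_le _ _).trans ?_
    refine (Finset.sum_le_card_nsmul _ _ (4 * 3 ^ n * K ^ (n - 2)) fun d hd => ?_).trans ?_
    · refine (Finset.set_ncard_biUnion_le _ _).trans ?_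
      refine (Finset.sum_le_card_nsmul _ _ _ (hbig d hd)).trans ?_
      rw [Finset.mem_Icc] at hd
      rw [Nat.card_Icc, Nat.add_sub_cancel, smul_eq_mul, show n - 2 = n - 3 + 1 by omega, pow_succ]
      exact le_of_eq (by ring)
    · rw [smul_eq_mul, Nat.card_Icc]
      gcongr
      omega
  calc _ ≤ _ := Set.ncard_le_ncard hsub hfin
    _ ≤ _ := Set.ncard_union_le _ _
    _ ≤ 4 * 3 ^ n * K ^ (n - 2) + n * (4 * 3 ^ n * K ^ (n - 2)) := Nat.add_le_add hlin hsum
    _ = _ := by rw [hK, mul_pow (2 ^ n * (n + 1))]; ring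

theorem exists_int_bezout {P Q : ℤ[X]}
    (h : IsCoprime (P.map (algebraMap ℤ ℚ)) (Q.map (algebraMap ℤ ℚ))) :
    ∃ (U V : ℤ[X]) (N : ℤ), N ≠ 0 ∧ U * P + V * Q = C N := by
  obtain ⟨u, v, huv⟩ := h
  obtain ⟨b, hb, hU⟩ := IsLocalization.integerNormalization_spec (nonZeroDivisors ℤ) u
  obtain ⟨c, hc, hV⟩ := IsLocalization.integerNormalization_spec (nonZeroDivisors ℤ) v
  refine ⟨C c * IsLocalization.integerNormalization (nonZeroDivisors ℤ) u,
    C b * IsLocalization.integerNormalization (nonZeroDivisors ℤ) v, b * c,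
    mul_ne_zero (nonZeroDivisors.ne_zero hb) (nonZeroDivisors.ne_zero hc), ?_⟩
  apply map_injective (algebraMap ℤ ℚ) (algebraMap ℤ ℚ).injective_int
  simp only [Polynomial.map_add, Polynomial.map_mul, hU, hV, map_C, zsmul_eq_mul]
  simp only [map_mul, eq_intCast, map_intCast]
  linear_combination (b : ℚ[X]) * c * huv

/-- A nontrivial integer relation among the points of a cyclic orbit of prime length `p` in an
abelian group forces `φ a - a` or the sum of the orbit to be torsion. -/
theorem torsion_of_relation_of_cyclic {M : Type*} [AddCommGroup M] {p : ℕ} (hp : p.Prime)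
    (φ : Module.End ℤ M) {a : M} (hφ : (φ ^ p) a = a) {k : ℕ → ℤ}
    (hk : ∃ i ∈ Finset.range p, k i ≠ 0) (hrel : ∑ i ∈ Finset.range p, k i • (φ ^ i) a = 0) :
    (∃ N : ℤ, N ≠ 0 ∧ N • φ a = N • a) ∨
      ∃ N : ℤ, N ≠ 0 ∧ ∑ i ∈ Finset.range p, N • (φ ^ i) a = 0 := by
  have := Fact.mk hp
  set P : ℤ[X] := ∑ i ∈ Finset.range p, C (k i) * X ^ i with hP
  have hcoeff : ∀ i ∈ Finset.range p, P.coeff i = k i := fun i hi => by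
    simp only [hP, finsetSum_coeff, coeff_C_mul, coeff_X_pow, mul_ite, mul_one, mul_zero]
    rw [Finset.sum_ite_eq, if_pos hi]
  have hP0 : P ≠ 0 := by
    obtain ⟨i, hi, hki⟩ := hk
    intro h
    rw [← hcoeff i hi, h, coeff_zero] at hki
    exact hki rfl
  have hPdeg : P.natDegree < p := by
    rw [natDegree_lt_iff_degree_lt hP0, degree_lt_iff_coeff_zero]
    intro m hm
    simp only [hP, finsetSum_coeff, coeff_C_mul, coeff_X_pow, mul_ite, mul_one, mul_zero]
    rw [Finset.sum_ite_eq, if_neg (by simpa using hm)]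
  have hPa : aeval φ P a = 0 := by
    rw [← hrel]
    simp [hP, LinearMap.sum_apply]
  by_cases hdvd : cyclotomic p ℤ ∣ P
  · right
    obtain ⟨Q, hQ⟩ := hdvd
    have hQ0 : Q ≠ 0 := by
      rintro rfl
      exact hP0 (by simpa using hQ)
    have hQdeg : Q.natDegree = 0 := by
      rw [hQ, natDegree_mul (cyclotomic_ne_zero p ℤ) hQ0, natDegree_cyclotomic,
        Nat.totient_prime hp] at hPdeg
      omega
    obtain ⟨c, rfl⟩ := natDegree_eq_zero.1 hQdeg
    refine ⟨c, by rintro rfl; simp at hQ0, ?_⟩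
    rw [← hPa, hQ, cyclotomic_prime, mul_comm]
    simp [LinearMap.sum_apply]
  · left
    have hcop : IsCoprime (P.map (algebraMap ℤ ℚ)) ((cyclotomic p ℤ).map (algebraMap ℤ ℚ)) := by
      rw [isCoprime_comm]
      refine (Irreducible.coprime_iff_not_dvd ?_).2 fun h => hdvd ?_
      · rw [map_cyclotomic]
        exact cyclotomic.irreducible_rat hp.pos
      · exact (map_dvd_map _ (algebraMap ℤ ℚ).injective_int (cyclotomic.monic p ℤ)).1 h
    obtain ⟨U, V, N, hN, hUV⟩ := exists_int_bezout hcop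
    refine ⟨N, hN, ?_⟩
    have h1 : C N * (X - 1) = (X - 1) * U * P + V * (X ^ p - 1) := by
      rw [← cyclotomic_prime_mul_X_sub_one ℤ p, ← hUV]
      ring
    have h2 := congrArg (fun R => aeval φ R a) h1
    have h3 : aeval φ (X ^ p - 1 : ℤ[X]) a = 0 := by
      simpa [sub_eq_zero] using hφ
    simp only [map_add, map_mul, LinearMap.add_apply, Module.End.mul_apply, hPa, h3,
      map_zero, add_zero] at h2
    simpa [smul_sub, sub_eq_zero] using h2

/-- Over a field of characteristic zero, the roots of an irreducible polynomial of prime degree are cyclically permuted by some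
element of the Galois group. -/
theorem exists_cyclic_orbit_eq_rootSet {K : Type*} [Field K] [CharZero K] {F : K[X]}
    (hF : Irreducible F) (hp : F.natDegree.Prime) :
    ∃ (σ : F.SplittingField ≃ₐ[K] F.SplittingField) (α : F.SplittingField),
      (σ ^ F.natDegree) α = α ∧
      Set.BijOn (fun i : ℕ => (σ ^ i) α) (Finset.range F.natDegree) (F.rootSet F.SplittingField) := by
  classical
  have : Normal K F.SplittingField := Normal.of_isSplittingField F
  have := Fact.mk hp
  have : Fact (F.map (algebraMap K F.SplittingField)).Splits := ⟨SplittingField.splits F⟩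
  have hcard : Fintype.card (F.rootSet F.SplittingField) = F.natDegree :=
    card_rootSet_eq_natDegree hF.separable (SplittingField.splits F)
  obtain ⟨τ, hτ⟩ := exists_prime_orderOf_dvd_card' F.natDegree (Gal.prime_degree_dvd_card hF hp)
  obtain ⟨σ, hσ⟩ := Gal.restrict_surjective F F.SplittingField τ
  set π := Gal.galActionHom F F.SplittingField τ with hπ
  have hord : orderOf π = Fintype.card (F.rootSet F.SplittingField) := by
    rw [hπ, orderOf_injective _ (Gal.galActionHom_injective F F.SplittingField), hτ, hcard]
  have hcyc : π.IsCycle := Equiv.Perm.isCycle_of_prime_order'' (hcard ▸ hp) hord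
  have hsupp : π.support = Finset.univ :=
    Finset.eq_univ_of_card _ (hcyc.orderOf.symm.trans hord)
  obtain ⟨x, hx, -⟩ := id hcyc
  have hpow : ∀ i : ℕ, ((π ^ i) x : F.SplittingField) = (σ ^ i) x := fun i => by
    rw [hπ, ← hσ, ← map_pow, ← map_pow, Gal.galActionHom_restrict]
  have hsurj : ∀ y, ∃ i < F.natDegree, (π ^ i) x = y := fun y => by
    rw [← hcard, ← hord]
    exact (hcyc.sameCycle hx
      (Equiv.Perm.mem_support.1 (hsupp ▸ Finset.mem_univ y))).exists_pow_eq'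
  have himg : Finset.image (fun i => (π ^ i) x) (Finset.range F.natDegree) = Finset.univ := by
    ext y
    simpa using hsurj y
  refine ⟨σ, x, ?_, fun i _ => ?_, ?_, fun y hy => ?_⟩
  · rw [← hpow, ← hcard, ← hord, pow_orderOf_eq_one, Equiv.Perm.one_apply]
  · dsimp only
    rw [← hpow]
    exact Subtype.coe_prop _
  · have hinj : Set.InjOn (fun i => (π ^ i) x) (Finset.range F.natDegree) := by
      rw [← Finset.card_image_iff, himg, Finset.card_univ, hcard, Finset.card_range]
    intro i hi j hj hij
    dsimp only at hij
    rw [← hpow, ← hpow] at hij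
    exact hinj hi hj (Subtype.ext hij)
  · obtain ⟨i, hi, h⟩ := hsurj ⟨y, hy⟩
    refine ⟨i, by simpa using hi, ?_⟩
    dsimp only
    rw [← hpow, h]

theorem roots_relation_of_prime_degree {K Ω : Type*} [Field K] [CharZero K] [Field Ω] [Algebra K Ω]
    {F : K[X]} (hF : Irreducible F) (hp : F.natDegree.Prime)
    (hs : (F.map (algebraMap K Ω)).Splits) (hF0 : F.coeff 0 ≠ 0)
    {S : Finset Ω} (hS : (S : Set Ω) = F.rootSet Ω) {k : Ω → ℤ} (hk : ∃ z ∈ S, k z ≠ 0)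
    (hrel : ∏ z ∈ S, z ^ k z = 1) :
    (∃ N : ℤ, N ≠ 0 ∧ ∀ z ∈ S, ∀ w ∈ S, z ^ N = w ^ N) ∨
      ∃ N : ℤ, N ≠ 0 ∧ (∏ z ∈ S, z) ^ N = 1 := by
  classical
  obtain ⟨σ, α, hσ, hbij⟩ := exists_cyclic_orbit_eq_rootSet hF hp
  have hp0 := hp.pos
  set p := F.natDegree with hpdef
  set ι : F.SplittingField →ₐ[K] Ω := SplittingField.lift F hs
  have hα : α ≠ 0 := by
    have h := hbij.mapsTo (show 0 ∈ ((Finset.range p : Finset ℕ) : Set ℕ) by simpa using hp0)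
    rintro rfl
    have := (mem_rootSet.1 h).2
    rw [pow_zero, AlgEquiv.one_apply, ← coeff_zero_eq_aeval_zero'] at this
    exact hF0 ((map_eq_zero _).1 this)
  have himg : S = (Finset.range p).image (fun i => ι ((σ ^ i) α)) := by
    apply Finset.coe_injective
    rw [hS, Finset.coe_image, ← Set.image_image (fun x => ι x), hbij.image_eq,
      (SplittingField.splits F).image_rootSet ι]
  have hinj : Set.InjOn (fun i => ι ((σ ^ i) α)) (Finset.range p) :=
    ι.injective.comp_injOn hbij.injOn
  set u : F.SplittingFieldˣ := Units.mk0 α hα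
  let φ : Module.End ℤ (Additive F.SplittingFieldˣ) :=
    (MonoidHom.toAdditive (Units.map (σ : F.SplittingField →* F.SplittingField))).toIntLinearMap
  have hφ : ∀ i : ℕ, (((φ ^ i) (Additive.ofMul u)).toMul : F.SplittingField) = (σ ^ i) α := by
    intro i
    induction i with
    | zero => rfl
    | succ i ih =>
      rw [pow_succ', pow_succ', AlgEquiv.mul_apply, ← ih]
      rfl
  have hinv : (φ ^ p) (Additive.ofMul u) = Additive.ofMul u :=
    Additive.toMul.injective (Units.ext ((hφ p).trans hσ))
  have hsum : ∀ c : ℕ → ℤ, ι ((∑ i ∈ Finset.range p,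
      c i • (φ ^ i) (Additive.ofMul u)).toMul : F.SplittingFieldˣ) =
      ∏ i ∈ Finset.range p, (ι ((σ ^ i) α)) ^ c i := fun c => by
    simp only [toMul_sum, toMul_zsmul, Units.coe_prod, Units.val_zpow_eq_zpow_val, hφ, map_prod,
      map_zpow₀]
  obtain ⟨z, hz, hkz⟩ := hk
  rw [himg, Finset.mem_image] at hz
  obtain ⟨i, hi, rfl⟩ := hz
  rw [himg, Finset.prod_image hinj, ← hsum (fun i => k (ι ((σ ^ i) α)))] at hrel
  have hrel' : ∑ i ∈ Finset.range p, k (ι ((σ ^ i) α)) • (φ ^ i) (Additive.ofMul u) = 0 :=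
    Additive.toMul.injective (Units.ext (ι.injective (hrel.trans (map_one ι).symm)))
  rcases torsion_of_relation_of_cyclic hp φ hinv ⟨i, hi, hkz⟩ hrel' with ⟨N, hN, h⟩ | ⟨N, hN, h⟩
  · left
    have hconst : ∀ i : ℕ, N • (φ ^ i) (Additive.ofMul u) = N • Additive.ofMul u := by
      intro i
      induction i with
      | zero => simp
      | succ i ih => rw [pow_succ', Module.End.mul_apply, ← map_zsmul, ih, map_zsmul, h]
    have hpow : ∀ z ∈ S, z ^ N = ι α ^ N := by
      intro z hz
      rw [himg, Finset.mem_image] at hz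
      obtain ⟨i, -, rfl⟩ := hz
      have := congrArg (fun x => ι (x.toMul : F.SplittingFieldˣ)) (hconst i)
      simpa only [toMul_zsmul, Units.val_zpow_eq_zpow_val, hφ, map_zpow₀] using! this
    exact ⟨N, hN, fun z hz w hw => (hpow z hz).trans (hpow w hw).symm⟩
  · right
    refine ⟨N, hN, ?_⟩
    rw [himg, Finset.prod_image hinj, ← Finset.prod_zpow, ← hsum (fun _ => N), h]
    simp

theorem Polynomial.exists_isRoot_of_odd_natDegree_real {f : ℝ[X]} (hf : Odd f.natDegree) :
    ∃ x, f.IsRoot x := by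
  wlog hlc : 0 ≤ f.leadingCoeff generalizing f
  · obtain ⟨x, hx⟩ := this (f := -f) (by rwa [natDegree_neg]) (by
      rw [leadingCoeff_neg]; linarith)
    exact ⟨x, by simpa using hx⟩
  have hdeg : 0 < f.degree := natDegree_pos_iff_degree_pos.1 hf.pos
  have hcd : (f.comp (-X)).natDegree = f.natDegree := by simp [natDegree_comp]
  obtain ⟨x, hx⟩ := ((tendsto_atTop_of_leadingCoeff_nonneg f hdeg hlc).eventually_ge_atTop 0).exists
  obtain ⟨y, hy⟩ := ((tendsto_atTop_of_leadingCoeff_nonneg (-(f.comp (-X)))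
    (natDegree_pos_iff_degree_pos.1 (by rw [natDegree_neg, hcd]; exact hf.pos))
    (by rw [leadingCoeff_neg, leadingCoeff_comp (by simp)]; simpa [hf.neg_one_pow] using hlc)
    ).eventually_ge_atTop 0).exists
  rw [eval_neg, eval_comp, eval_neg, eval_X, neg_nonneg] at hy
  exact mem_range_of_exists_le_of_exists_ge f.continuous ⟨_, hy⟩ ⟨_, hx⟩

theorem prod_toFinset_roots_zpow_rootMultiplicity (f : ℂ[X]) (c : ℤ) :
    ∏ z ∈ f.roots.toFinset, z ^ (c * f.roots.count z : ℤ) = f.roots.prod ^ c := by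
  rw [Finset.prod_multiset_count, ← Finset.prod_zpow]
  refine Finset.prod_congr rfl fun z _ => ?_
  rw [mul_comm, zpow_mul, zpow_natCast]

theorem nzRoots_eq_of_coeff_zero_ne_zero {f : ℤ[X]} (h0 : f.coeff 0 ≠ 0) :
    nzRoots f = (f.map (Int.castRingHom ℂ)).roots.toFinset := by
  refine Finset.filter_true_of_mem fun z hz => ?_
  rintro rfl
  have := isRoot_of_mem_roots (Multiset.mem_toFinset.1 hz)
  rw [IsRoot, ← coeff_zero_eq_eval_zero, coeff_map] at this
  exact h0 (by simpa using this)

theorem Polynomial.Monic.coeff_zero_map_eq {f : ℤ[X]} (hf : f.Monic) :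
    (f.coeff 0 : ℂ) = (-1) ^ f.natDegree * (f.map (Int.castRingHom ℂ)).roots.prod := by
  have := (IsAlgClosed.splits (f.map (Int.castRingHom ℂ))).coeff_zero_eq_prod_roots_of_monic
    (hf.map _)
  rwa [hf.natDegree_map, coeff_map, eq_intCast] at this

theorem genDeg_of_abs_coeff_zero_eq_one {f : ℤ[X]} (hf : f.Monic) (hdeg : 2 ≤ f.natDegree)
    (h0 : |f.coeff 0| = 1) : GenDeg f := by
  have hprod := hf.coeff_zero_map_eq
  refine ⟨hdeg, fun z => 2 * (f.map (Int.castRingHom ℂ)).roots.count z, ?_, ?_⟩ <;>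
    rw [nzRoots_eq_of_coeff_zero_ne_zero (fun h => by simp [h] at h0)]
  · obtain ⟨z, hz⟩ : ∃ z, z ∈ (f.map (Int.castRingHom ℂ)).roots := by
      obtain ⟨z, hz⟩ := IsAlgClosed.exists_root (f.map (Int.castRingHom ℂ)) (by
        rw [hf.degree_map]
        exact (natDegree_pos_iff_degree_pos.1 (by omega)).ne')
      exact ⟨z, (mem_roots (hf.map _).ne_zero).2 hz⟩
    refine ⟨z, Multiset.mem_toFinset.2 hz, ?_⟩
    have := Multiset.count_pos.2 hz
    positivity
  · rw [prod_toFinset_roots_zpow_rootMultiplicity]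
    have h1 : ((f.coeff 0 : ℤ) : ℂ) ^ 2 = 1 := by
      exact_mod_cast (by rw [← sq_abs, h0]; norm_num : f.coeff 0 ^ 2 = 1)
    rw [hprod, mul_pow, ← pow_mul, mul_comm _ 2, pow_mul, neg_one_sq, one_pow, one_mul] at h1
    exact_mod_cast h1

/-- A generalized degenerate irreducible monic integer polynomial of odd prime degree either has
constant term `±1` or is a binomial. -/
theorem abs_coeff_zero_eq_one_or_eq_binomial {f : ℤ[X]} (hf : f.Monic) (hirr : Irreducible f)
    (hp : f.natDegree.Prime) (hodd : Odd f.natDegree) (hdep : MulDep (nzRoots f)) :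
    |f.coeff 0| = 1 ∨ ∃ a, f = X ^ f.natDegree + C a := by
  have h0 : f.coeff 0 ≠ 0 := fun h => by
    have hX : X ∣ f := X_dvd_iff.2 h
    have := natDegree_eq_of_degree_eq (degree_eq_degree_of_associated
      ((irreducible_X.dvd_irreducible_iff_associated hirr).1 hX))
    rw [natDegree_X] at this
    exact hp.one_lt.ne this
  set F : ℚ[X] := f.map (algebraMap ℤ ℚ) with hFdef
  have hFirr : Irreducible F := (hf.irreducible_iff_irreducible_map_fraction_map).1 hirr
  have hFmon : F.Monic := hf.map _
  have hFdeg : F.natDegree = f.natDegree := hf.natDegree_map _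
  have hFC : F.map (algebraMap ℚ ℂ) = f.map (Int.castRingHom ℂ) := by
    rw [hFdef, Polynomial.map_map]
    congr 1
  have hnodup : (f.map (Int.castRingHom ℂ)).roots.Nodup := by
    rw [← hFC]
    exact nodup_roots hFirr.separable.map
  obtain ⟨k, hk, hrel⟩ := hdep
  rw [nzRoots_eq_of_coeff_zero_ne_zero h0] at hk hrel
  have hprod := hf.coeff_zero_map_eq
  have hval : ∏ z ∈ (f.map (Int.castRingHom ℂ)).roots.toFinset, z =
      (f.map (Int.castRingHom ℂ)).roots.prod := by
    rw [Finset.prod, Multiset.toFinset_val, hnodup.dedup, Multiset.map_id']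
  have hnorm : |(f.coeff 0 : ℝ)| = ‖∏ z ∈ (f.map (Int.castRingHom ℂ)).roots.toFinset, z‖ := by
    rw [hval, ← Complex.norm_intCast, hprod]
    simp
  rcases roots_relation_of_prime_degree hFirr (by rwa [hFdeg])
    (IsAlgClosed.splits (F.map (algebraMap ℚ ℂ))) (by simpa [hFdef] using h0)
    (S := (f.map (Int.castRingHom ℂ)).roots.toFinset)
    (by ext z; simp [rootSet, aroots, hFC]) hk hrel with ⟨N, hN, h⟩ | ⟨N, hN, h⟩
  · right
    obtain ⟨r, hr⟩ := exists_isRoot_of_odd_natDegree_real (f := f.map (Int.castRingHom ℝ))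
      (by rwa [hf.natDegree_map])
    have hrmem : (r : ℂ) ∈ (f.map (Int.castRingHom ℂ)).roots.toFinset := by
      rw [Multiset.mem_toFinset, mem_roots (hf.map _).ne_zero, IsRoot]
      have h1 : f.map (Int.castRingHom ℂ) = (f.map (Int.castRingHom ℝ)).map Complex.ofRealHom := by
        rw [Polynomial.map_map]
        congr 1
      rw [h1, ← Complex.ofRealHom_eq_coe, eval_map_apply, hr.eq_zero, map_zero]
    have hcard : (f.map (Int.castRingHom ℂ)).roots.toFinset.card = f.natDegree := by
      rw [Multiset.toFinset_card_of_nodup hnodup, IsAlgClosed.card_roots_eq_natDegree,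
        hf.natDegree_map]
    have hall : ∀ z ∈ (f.map (Int.castRingHom ℂ)).roots.toFinset, ‖z‖ = |r| := fun z hz => by
      have := congrArg norm (h z hz r hrmem)
      rw [norm_zpow, norm_zpow, zpow_left_inj₀ (norm_nonneg _) (norm_nonneg _) hN] at this
      simpa using this
    rw [norm_prod, Finset.prod_congr rfl hall, Finset.prod_const, hcard, ← abs_pow] at hnorm
    obtain ⟨a, ha⟩ : ∃ a : ℤ, r ^ f.natDegree + a = 0 := by
      rcases abs_eq_abs.1 hnorm with h | h
      · exact ⟨-f.coeff 0, by push_cast; linarith⟩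
      · exact ⟨f.coeff 0, by linarith⟩
    refine ⟨a, ?_⟩
    apply map_injective (algebraMap ℤ ℚ) (algebraMap ℤ ℚ).injective_int
    have hFr : aeval r F = 0 := by
      rw [aeval_def, eval₂_eq_eval_map, hFdef, Polynomial.map_map]
      convert hr.eq_zero using 3
      exact RingHom.ext_int _ _
    have hG : aeval r ((X ^ f.natDegree + C a : ℤ[X]).map (algebraMap ℤ ℚ)) = 0 := by
      simpa using ha
    have hdvd := minpoly.dvd ℚ r hG
    rw [← minpoly.eq_of_irreducible_of_monic hFirr hFr hFmon] at hdvd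
    have hGmon : (X ^ f.natDegree + C a : ℤ[X]).Monic := monic_X_pow_add_C a hp.ne_zero
    refine (eq_of_monic_of_dvd_of_natDegree_le hFmon (hGmon.map _) hdvd ?_).symm
    rw [hGmon.natDegree_map, hFdeg, natDegree_X_pow_add_C]
  · left
    have := congrArg norm h
    rw [norm_zpow, norm_one, ← hnorm, ← one_zpow N,
      zpow_left_inj₀ (abs_nonneg _) zero_le_one hN] at this
    exact_mod_cast this

theorem Iset_subset_union {p : ℕ} (hp : p.Prime) (hodd : Odd p) (H : ℕ) :
    Iset p H ⊆ unitConstSet p H ∪ (fun a : ℤ => (X ^ p + C a : ℤ[X])) '' Set.Icc (-H) H := by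
  rintro f ⟨hf, rfl, hH, hirr, -, hdep⟩
  rcases abs_coeff_zero_eq_one_or_eq_binomial hf hirr hp hodd hdep with h | ⟨a, ha⟩
  · exact Or.inl ⟨hf, rfl, hH, h⟩
  · refine Or.inr ⟨a, ?_, ha.symm⟩
    have := hH 0
    rw [ha] at this
    simpa [hp.ne_zero.symm, ← abs_le] using this

theorem unitConstSet_sdiff_subset_Iset {p : ℕ} (hp : 2 ≤ p) (H : ℕ) :
    unitConstSet p H \ {f ∈ unitConstSet p H | ¬ Irreducible f} ⊆ Iset p H := by
  rintro f ⟨hf, hirr⟩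
  exact ⟨hf.1, hf.2.1, hf.2.2.1, by_contra fun h => hirr ⟨hf, h⟩,
    genDeg_of_abs_coeff_zero_eq_one hf.1 (hf.2.1 ▸ hp) hf.2.2.2⟩

theorem stmt_1 (p : ℕ) (hp : p.Prime) (hodd : Odd p) :
    ∃ C : ℝ, 0 < C ∧ ∀ H : ℤ, 3 ≤ H →
      |((Iset p H).ncard : ℝ) - 2 ^ p * (H : ℝ) ^ (p - 1)| ≤ C * (H : ℝ) ^ (p - 2) := by
  have hp3 : 3 ≤ p := by
    have := hp.two_le
    have : p ≠ 2 := by rintro rfl; exact absurd hodd (by decide)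
    omega
  obtain ⟨q, rfl⟩ : ∃ q, p = q + 3 := ⟨p - 3, by omega⟩
  set R : ℕ := 4 * (q + 3 + 1) * 3 ^ (q + 3) * (2 ^ (q + 3) * (q + 3 + 1)) ^ (q + 1) with hR
  refine ⟨((R + 2 * (q + 2) * 3 ^ (q + 1) + 3 : ℕ) : ℝ), by positivity, fun H hH => ?_⟩
  lift H to ℕ using by omega
  have hH1 : 1 ≤ H := by omega
  have hfin := unitConstSet_finite (n := q + 3) (by omega) hH1
  have hred := ncard_unitConstSet_reducible_le (n := q + 3) (by omega) hH1
  have hbfin : ((fun a : ℤ => (X ^ (q + 3) + C a : ℤ[X])) '' Set.Icc (-H) H).Finite :=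
    (Set.finite_Icc _ _).image _
  have hb : ((fun a : ℤ => (X ^ (q + 3) + C a : ℤ[X])) '' Set.Icc (-H) H).ncard ≤ 2 * H + 1 := by
    refine (Set.ncard_image_le (Set.finite_Icc _ _)).trans ?_
    rw [← Finset.coe_Icc, Set.ncard_coe_finset, Int.card_Icc]
    omega
  have hIfin : (Iset (q + 3) H).Finite := (hfin.union hbfin).subset (Iset_subset_union hp hodd H)
  have hup : (Iset (q + 3) H).ncard ≤ 2 * (2 * H + 1) ^ (q + 2) + (2 * H + 1) := by
    rw [← ncard_unitConstSet_succ (q + 2) hH1]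
    exact ((Set.ncard_le_ncard (Iset_subset_union hp hodd H) (hfin.union hbfin)).trans
      (Set.ncard_union_le _ _)).trans (Nat.add_le_add_left hb _)
  have hlow : 2 * (2 * H + 1) ^ (q + 2) ≤ (Iset (q + 3) H).ncard + R * H ^ (q + 1) := by
    rw [← ncard_unitConstSet_succ (q + 2) hH1]
    refine (Set.ncard_le_ncard_sdiff_add_ncard _ _ (hfin.subset (Set.sep_subset _ _))).trans
      (Nat.add_le_add (Set.ncard_le_ncard (unitConstSet_sdiff_subset_Iset (by omega) H) hIfin) hred)
  have hpow : (2 * H + 1) ^ (q + 2) ≤ (2 * H) ^ (q + 2) + (q + 2) * (3 ^ (q + 1) * H ^ (q + 1)) := by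
    rw [← mul_pow]
    refine (succ_pow_le (2 * H) (q + 1)).trans ?_
    gcongr
    omega
  have hpow' : (2 * H) ^ (q + 2) ≤ (2 * H + 1) ^ (q + 2) := Nat.pow_le_pow_left (by omega) _
  have hmain : 2 * (2 * H) ^ (q + 2) = 2 ^ (q + 3) * H ^ (q + 2) := by rw [mul_pow]; ring
  have hHle : 2 * H + 1 ≤ 3 * H ^ (q + 1) := by
    have : H ≤ H ^ (q + 1) := Nat.le_self_pow (by omega) H
    omega
  have h1 : (Iset (q + 3) H).ncard ≤ 2 ^ (q + 3) * H ^ (q + 2) +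
      (R + 2 * (q + 2) * 3 ^ (q + 1) + 3) * H ^ (q + 1) := by
    nlinarith [Nat.zero_le (R * H ^ (q + 1))]
  have h2 : 2 ^ (q + 3) * H ^ (q + 2) ≤ (Iset (q + 3) H).ncard +
      (R + 2 * (q + 2) * 3 ^ (q + 1) + 3) * H ^ (q + 1) := by
    nlinarith [Nat.zero_le ((2 * (q + 2) * 3 ^ (q + 1) + 3) * H ^ (q + 1))]
  rw [show q + 3 - 1 = q + 2 by omega, show q + 3 - 2 = q + 1 by omega, abs_le]
  have h1' : ((Iset (q + 3) H).ncard : ℝ) ≤ 2 ^ (q + 3) * (H : ℝ) ^ (q + 2) +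
      ((R + 2 * (q + 2) * 3 ^ (q + 1) + 3 : ℕ) : ℝ) * (H : ℝ) ^ (q + 1) := by exact_mod_cast h1
  have h2' : 2 ^ (q + 3) * (H : ℝ) ^ (q + 2) ≤ ((Iset (q + 3) H).ncard : ℝ) +
      ((R + 2 * (q + 2) * 3 ^ (q + 1) + 3 : ℕ) : ℝ) * (H : ℝ) ^ (q + 1) := by exact_mod_cast h2
  rw [Int.cast_natCast]
  constructor <;> linarith
end

section
/- There exists a constant C > 0 such that for every integer H ≥ 3, |#I_2(H) − 6H| ≤ C·H^(1/2), where #I_2(H) is the number of generalized degenerate monic integer polynomials of degree 2 and height at most H that are irreducible over ℤ. -/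
open Polynomial MeasureTheory

/-- The monic quadratic `X² + aX + b`. -/
noncomputable def monicQuadratic (p : ℤ × ℤ) : ℤ[X] := X ^ 2 + C p.1 * X + C p.2

lemma monicQuadratic_eq (p : ℤ × ℤ) :
    monicQuadratic p = C 1 * X ^ 2 + C p.1 * X + C p.2 := by
  simp [monicQuadratic]

lemma natDegree_monicQuadratic (p : ℤ × ℤ) : (monicQuadratic p).natDegree = 2 := by
  rw [monicQuadratic_eq]
  exact natDegree_quadratic one_ne_zero

lemma monic_monicQuadratic (p : ℤ × ℤ) : (monicQuadratic p).Monic := by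
  rw [Monic, monicQuadratic_eq]
  exact leadingCoeff_quadratic one_ne_zero

lemma coeff_zero_monicQuadratic (p : ℤ × ℤ) : (monicQuadratic p).coeff 0 = p.2 := by
  simp [monicQuadratic]

lemma coeff_one_monicQuadratic (p : ℤ × ℤ) : (monicQuadratic p).coeff 1 = p.1 := by
  rw [monicQuadratic, coeff_add, coeff_add, coeff_X_pow, coeff_C_mul_X, coeff_C]
  norm_num

lemma monicQuadratic_injective : Function.Injective monicQuadratic := by
  intro p q h
  ext
  · rw [← coeff_one_monicQuadratic, h, coeff_one_monicQuadratic]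
  · rw [← coeff_zero_monicQuadratic, h, coeff_zero_monicQuadratic]

lemma eq_monicQuadratic {f : ℤ[X]} (hf : f.Monic) (hd : f.natDegree = 2) :
    f = monicQuadratic (f.coeff 1, f.coeff 0) := by
  conv_lhs => rw [hf.as_sum, hd]
  simp [Finset.sum_range_succ, monicQuadratic]
  ring

lemma heightLe_monicQuadratic {p : ℤ × ℤ} {H : ℤ} (hH : 1 ≤ H) :
    HeightLe (monicQuadratic p) H ↔ |p.1| ≤ H ∧ |p.2| ≤ H := by
  constructor
  · intro h
    have h0 := h 0
    have h1 := h 1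
    rw [coeff_zero_monicQuadratic] at h0
    rw [coeff_one_monicQuadratic] at h1
    exact ⟨h1, h0⟩
  · rintro ⟨h1, h0⟩ i
    match i with
    | 0 => rwa [coeff_zero_monicQuadratic]
    | 1 => rwa [coeff_one_monicQuadratic]
    | 2 =>
      have h := monic_monicQuadratic p
      rw [Monic, leadingCoeff, natDegree_monicQuadratic] at h
      rw [h]
      simpa using hH
    | n + 3 =>
      rw [coeff_eq_zero_of_natDegree_lt (by rw [natDegree_monicQuadratic]; omega)]
      simp; omega

/-- Coefficient pairs of the irreducible quadratics of height at most `H` with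
multiplicatively dependent roots. -/
def depPairs (H : ℤ) : Set (ℤ × ℤ) :=
  {p | (|p.1| ≤ H ∧ |p.2| ≤ H) ∧ Irreducible (monicQuadratic p) ∧
    MulDep (nzRoots (monicQuadratic p))}

lemma Iset_two_eq_image {H : ℤ} (hH : 1 ≤ H) : Iset 2 H = monicQuadratic '' depPairs H := by
  ext f
  constructor
  · rintro ⟨hm, hd, hh, hi, hg⟩
    have e := eq_monicQuadratic hm hd
    refine ⟨_, ⟨(heightLe_monicQuadratic hH).1 (e ▸ hh), e ▸ hi, e ▸ hg.2⟩, e.symm⟩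
  · rintro ⟨p, ⟨hh, hi, hg⟩, rfl⟩
    exact ⟨monic_monicQuadratic p, natDegree_monicQuadratic p,
      (heightLe_monicQuadratic hH).2 hh, hi, (natDegree_monicQuadratic p).ge, hg⟩

lemma ncard_Iset_two {H : ℤ} (hH : 1 ≤ H) : (Iset 2 H).ncard = (depPairs H).ncard := by
  rw [Iset_two_eq_image hH, Set.ncard_image_of_injective _ monicQuadratic_injective]

lemma irreducible_monicQuadratic_iff (p : ℤ × ℤ) :
    Irreducible (monicQuadratic p) ↔ ∀ x : ℤ, x ^ 2 + p.1 * x + p.2 ≠ 0 := by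
  have hm := monic_monicQuadratic p
  rw [hm.irreducible_iff_roots_eq_zero_of_degree_le_three
    (natDegree_monicQuadratic p).ge (by rw [natDegree_monicQuadratic]; norm_num),
    Multiset.eq_zero_iff_forall_notMem]
  refine forall_congr' fun x => ?_
  rw [mem_roots hm.ne_zero]
  simp [monicQuadratic]

lemma exists_vieta (p : ℤ × ℤ) : ∃ α β : ℂ, α + β = -p.1 ∧ α * β = p.2 := by
  obtain ⟨s, hs⟩ := IsAlgClosed.exists_pow_nat_eq ((p.1 : ℂ) ^ 2 - 4 * p.2) (n := 2) (by norm_num)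
  refine ⟨(-p.1 + s) / 2, (-p.1 - s) / 2, by ring, ?_⟩
  linear_combination -hs / 4

lemma nzRoots_monicQuadratic {p : ℤ × ℤ} {α β : ℂ} (hs : α + β = -p.1) (hp : α * β = p.2)
    (hb : p.2 ≠ 0) : nzRoots (monicQuadratic p) = {α, β} := by
  have e : (monicQuadratic p).map (Int.castRingHom ℂ) = (X - C α) * (X - C β) := by
    have h1 : (C (p.1 : ℂ) : ℂ[X]) = - (C α + C β) := by
      rw [← C_add, ← C_neg, hs, neg_neg]
    have h2 : (C (p.2 : ℂ) : ℂ[X]) = C α * C β := by rw [← C_mul, hp]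
    simp only [monicQuadratic, Polynomial.map_add, Polynomial.map_mul, Polynomial.map_pow, map_X,
      map_C, eq_intCast (Int.castRingHom ℂ), h1, h2]
    ring
  have h0 : α * β ≠ 0 := by rw [hp]; exact_mod_cast hb
  have hα := left_ne_zero_of_mul h0
  have hβ := right_ne_zero_of_mul h0
  ext z
  rw [nzRoots, e, roots_mul (mul_ne_zero (X_sub_C_ne_zero α) (X_sub_C_ne_zero β))]
  simp only [roots_X_sub_C, Finset.mem_filter, Multiset.mem_toFinset, Multiset.mem_add,
    Multiset.mem_singleton, Finset.mem_insert, Finset.mem_singleton]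
  constructor
  · exact fun h => h.1
  · rintro (rfl | rfl) <;> simp [hα, hβ]

/-- Conjugation exchanges the two roots in a multiplicative relation. -/
lemma zpow_mul_zpow_swap {p : ℤ × ℤ} (hi : Irreducible (monicQuadratic p)) {α β : ℂ}
    (hs : α + β = -p.1) (hp : α * β = p.2) {k l : ℤ} (h : α ^ k * β ^ l = 1) :
    β ^ k * α ^ l = 1 := by
  have hi' : Irreducible ((monicQuadratic p).map (algebraMap ℤ ℚ)) :=
    ((monic_monicQuadratic p).irreducible_iff_irreducible_map_fraction_map).1 hi
  have : Fact (Irreducible ((monicQuadratic p).map (algebraMap ℤ ℚ))) := ⟨hi'⟩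
  have key : ∀ γ δ : ℂ, γ + δ = -p.1 → γ * δ = p.2 →
      ∃ φ : AdjoinRoot ((monicQuadratic p).map (algebraMap ℤ ℚ)) →+* ℂ,
        φ (AdjoinRoot.root _) = γ ∧ φ (-(p.1 : AdjoinRoot _) - AdjoinRoot.root _) = δ := by
    intro γ δ h1 h2
    have h0 : ((monicQuadratic p).map (algebraMap ℤ ℚ)).eval₂ (algebraMap ℚ ℂ) γ = 0 := by
      rw [eval₂_map]
      simp only [monicQuadratic, eval₂_add, eval₂_mul, eval₂_pow, eval₂_X, eval₂_C]
      simp only [eq_intCast]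
      linear_combination γ * h1 - h2
    refine ⟨AdjoinRoot.lift (algebraMap ℚ ℂ) γ h0, AdjoinRoot.lift_root h0, ?_⟩
    rw [map_sub, map_neg, map_intCast, AdjoinRoot.lift_root h0, ← h1]
    ring
  obtain ⟨φ, hφ1, hφ2⟩ := key α β hs hp
  obtain ⟨ψ, hψ1, hψ2⟩ := key β α (by rw [add_comm, hs]) (by rw [mul_comm, hp])
  rw [← hφ1, ← hφ2, ← map_zpow₀, ← map_zpow₀, ← map_mul, map_eq_one_iff φ φ.injective] at h
  rw [← hψ1, ← hψ2, ← map_zpow₀, ← map_zpow₀, ← map_mul, h, map_one]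

lemma Int.abs_eq_one_of_cast_zpow_eq_one {b n : ℤ} (hn : n ≠ 0) (h : (b : ℂ) ^ n = 1) :
    |b| = 1 := by
  have h1 : ‖(b : ℂ)‖ ^ n = 1 := by rw [← norm_zpow, h, norm_one]
  have h2 : ‖(b : ℂ)‖ = 1 := by
    by_contra hb
    exact hn ((zpow_eq_one_iff_right₀ (norm_nonneg _) hb).1 h1)
  rw [Complex.norm_intCast] at h2
  exact_mod_cast h2

/-- A rational value of `ζ + ζ⁻¹` at a root of unity is an integer in `[-2, 2]`. -/
lemma exists_int_of_add_inv_eq_rat {ζ : ℂ} {n : ℕ} (hn : n ≠ 0) (hζ : ζ ^ n = 1) {q : ℚ}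
    (hq : ζ + ζ⁻¹ = q) : ∃ m : ℤ, |m| ≤ 2 ∧ ζ + ζ⁻¹ = m := by
  have int_of : ∀ w : ℂ, w ^ n = 1 → IsIntegral ℤ w := fun w hw =>
    IsIntegral.of_pow (Nat.pos_of_ne_zero hn) (hw ▸ isIntegral_one)
  have hi : IsIntegral ℤ (ζ + ζ⁻¹) :=
    (int_of ζ hζ).add (int_of _ (by rw [inv_pow, hζ, inv_one]))
  have hq' : IsIntegral ℤ q := by
    rw [hq] at hi
    exact (isIntegral_algebraMap_iff (A := ℚ) (B := ℂ) (algebraMap ℚ ℂ).injective).1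
      (by simpa using hi)
  obtain ⟨m, hm⟩ := IsIntegrallyClosed.isIntegral_iff.1 hq'
  have hm' : ζ + ζ⁻¹ = m := by rw [hq, ← hm]; simp
  refine ⟨m, ?_, hm'⟩
  have h1 : ‖ζ‖ = 1 := Complex.norm_eq_one_of_pow_eq_one hζ hn
  have h2 : ‖(m : ℂ)‖ ≤ 2 := by
    rw [← hm']
    refine (norm_add_le _ _).trans ?_
    rw [norm_inv, h1]
    norm_num
  rw [Complex.norm_intCast] at h2
  exact_mod_cast h2

lemma snd_ne_zero_of_irreducible {p : ℤ × ℤ} (hi : Irreducible (monicQuadratic p)) : p.2 ≠ 0 := by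
  intro h
  exact (irreducible_monicQuadratic_iff p).1 hi 0 (by simp [h])

lemma coeff_relation_of_mulDep {p : ℤ × ℤ} (hi : Irreducible (monicQuadratic p))
    (hd : MulDep (nzRoots (monicQuadratic p))) :
    p.1 = 0 ∨ |p.2| = 1 ∨ ∃ j : ℤ, 1 ≤ j ∧ j ≤ 4 ∧ p.1 ^ 2 = j * p.2 := by
  obtain ⟨α, β, hs, hp⟩ := exists_vieta p
  have hb := snd_ne_zero_of_irreducible hi
  have h0 : α * β ≠ 0 := by rw [hp]; exact_mod_cast hb
  have hα := left_ne_zero_of_mul h0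
  have hβ := right_ne_zero_of_mul h0
  rw [nzRoots_monicQuadratic hs hp hb] at hd
  by_cases hαβ : α = β
  · right; right
    refine ⟨4, by norm_num, by norm_num, ?_⟩
    subst hαβ
    have : (p.1 : ℂ) ^ 2 = 4 * p.2 := by
      linear_combination (p.1 - 2 * α) * hs + 4 * hp
    exact_mod_cast this
  obtain ⟨e, hne, hprod⟩ := hd
  rw [Finset.prod_pair hαβ] at hprod
  simp only [Finset.mem_insert, Finset.mem_singleton, exists_eq_or_imp, exists_eq_left] at hne
  generalize e α = k at hne hprod
  generalize e β = l at hne hprod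
  have hswap := zpow_mul_zpow_swap hi hs hp hprod
  by_cases hkl : k + l = 0
  · obtain rfl : l = -k := by omega
    have hk : k ≠ 0 := by omega
    have hζ : (α / β) ^ k = 1 := by
      rw [div_zpow, div_eq_mul_inv, ← zpow_neg, hprod]
    have hζ' : (α / β) ^ k.natAbs = 1 := by
      rcases Int.natAbs_eq k with h | h
      · rw [h, zpow_natCast] at hζ; exact hζ
      · rw [h, zpow_neg, inv_eq_one, zpow_natCast] at hζ; exact hζ
    have hbC : (p.2 : ℂ) ≠ 0 := by exact_mod_cast hb
    have hsum : (α / β + (α / β)⁻¹) * p.2 = p.1 ^ 2 - 2 * p.2 := by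
      rw [← hp]
      field_simp
      linear_combination (α + β - p.1) * hs
    obtain ⟨m, hm2, hm⟩ := exists_int_of_add_inv_eq_rat (Int.natAbs_ne_zero.2 hk) hζ'
      (q := ((p.1 : ℚ) ^ 2 - 2 * p.2) / p.2) (by
        push_cast
        rw [eq_div_iff hbC, hsum])
    rw [hm] at hsum
    have hm' : p.1 ^ 2 = (m + 2) * p.2 := by
      have : m * p.2 = p.1 ^ 2 - 2 * p.2 := by exact_mod_cast hsum
      linear_combination -this
    rw [abs_le] at hm2
    by_cases hm0 : m + 2 = 0
    · left
      rw [hm0, zero_mul] at hm'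
      exact pow_eq_zero_iff two_ne_zero |>.1 hm'
    · exact Or.inr (Or.inr ⟨m + 2, by omega, by omega, hm'⟩)
  · right; left
    refine Int.abs_eq_one_of_cast_zpow_eq_one hkl ?_
    rw [← hp, mul_zpow, zpow_add₀ hα, zpow_add₀ hβ]
    linear_combination (α ^ k * β ^ l) * hswap + hprod

lemma mulDep_of_coeff {p : ℤ × ℤ} (hb : p.2 ≠ 0) (hdisc : p.1 ^ 2 - 4 * p.2 ≠ 0)
    (h : p.1 = 0 ∨ |p.2| = 1) : MulDep (nzRoots (monicQuadratic p)) := by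
  obtain ⟨α, β, hs, hp⟩ := exists_vieta p
  have h0 : α * β ≠ 0 := by rw [hp]; exact_mod_cast hb
  have hα := left_ne_zero_of_mul h0
  have hβ := right_ne_zero_of_mul h0
  have hαβ : α ≠ β := by
    rintro rfl
    apply hdisc
    have : (p.1 : ℂ) ^ 2 - 4 * p.2 = 0 := by linear_combination (p.1 - 2 * α) * hs + 4 * hp
    exact_mod_cast this
  rw [nzRoots_monicQuadratic hs hp hb]
  rcases h with h | h
  · refine ⟨fun z => if z = α then 2 else -2, ⟨α, by simp, by simp⟩, ?_⟩
    rw [Finset.prod_pair hαβ]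
    have hneg : α = -β := by
      rw [h, Int.cast_zero, neg_zero] at hs
      linear_combination hs
    simp only [if_true, if_neg (Ne.symm hαβ)]
    rw [hneg, zpow_neg, even_two.neg_zpow, mul_inv_cancel₀ (zpow_ne_zero _ hβ)]
  · refine ⟨fun _ => 2, ⟨α, by simp, by simp⟩, ?_⟩
    rw [Finset.prod_pair hαβ, ← mul_zpow, hp]
    have : p.2 ^ 2 = 1 := by rw [← sq_abs, h, one_pow]
    simp only [zpow_ofNat]
    exact_mod_cast this

/-- The pairs `(a, b)` in the box of size `H` with `b = ±1` or `a = 0`. -/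
noncomputable def axisPairs (H : ℤ) : Finset (ℤ × ℤ) :=
  Finset.Icc (-H) H ×ˢ {1, -1} ∪ {0} ×ˢ Finset.Icc (-H) H

/-- The pairs `(a, b)` with `a² = jb`, `1 ≤ j ≤ 4` and `|a| ≤ √(4H)`. -/
noncomputable def sporadicPairs (H : ℤ) : Finset (ℤ × ℤ) :=
  (Finset.Icc (-Int.sqrt (4 * H)) (Int.sqrt (4 * H)) ×ˢ Finset.Icc (1 : ℤ) 4).image
    fun q => (q.1, q.1 ^ 2 / q.2)

/-- Pairs that cover the reducible quadratics among `axisPairs`. -/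
noncomputable def reduciblePairs (H : ℤ) : Finset (ℤ × ℤ) :=
  {(2, 1), (-2, 1), (0, -1)} ∪ (Finset.Icc 0 (Int.sqrt H)).image fun x => (0, -x ^ 2)

lemma abs_le_sqrt_of_sq_le {x n : ℤ} (h : x ^ 2 ≤ n) : |x| ≤ Int.sqrt n := by
  rw [Int.sqrt, Int.abs_eq_natAbs, Int.ofNat_le, Nat.le_sqrt']
  zify
  rw [sq_abs]
  exact h.trans (Int.self_le_toNat n)

lemma depPairs_subset {H : ℤ} :
    depPairs H ⊆ ↑(axisPairs H ∪ sporadicPairs H) := by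
  rintro ⟨a, b⟩ ⟨⟨ha, hb⟩, hi, hd⟩
  simp only at ha hb
  have hb0 := snd_ne_zero_of_irreducible hi
  rw [Finset.mem_coe, Finset.mem_union]
  rcases coeff_relation_of_mulDep hi hd with h | h | ⟨j, h1, h4, h⟩
  · left
    simp only at h
    simp [axisPairs, h, abs_le.1 hb]
  · left
    simp only at h
    rw [abs_eq zero_le_one] at h
    simp [axisPairs, abs_le.1 ha, h]
  · right
    simp only at h
    have h2 : a ^ 2 ≤ 4 * H := by
      have := (abs_le.1 hb).2
      have := abs_nonneg b
      nlinarith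
    have h3 := abs_le.1 (abs_le_sqrt_of_sq_le h2)
    rw [sporadicPairs, Finset.mem_image]
    refine ⟨(a, j), by simp [h1, h4, h3], ?_⟩
    simp only [h]
    rw [Int.mul_ediv_cancel_left _ (by omega)]

lemma subset_depPairs {H : ℤ} (hH : 1 ≤ H) :
    ↑(axisPairs H \ reduciblePairs H) ⊆ depPairs H := by
  rintro ⟨a, b⟩ h
  rw [Finset.mem_coe, Finset.mem_sdiff] at h
  obtain ⟨h1, h2⟩ := h
  simp only [axisPairs, reduciblePairs, Finset.mem_union, Finset.mem_product, Finset.mem_Icc,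
    Finset.mem_insert, Finset.mem_singleton, Finset.mem_image, Prod.mk.injEq, not_or,
    not_exists, not_and] at h1 h2
  obtain ⟨⟨n1, n2, n3⟩, n4⟩ := h2
  have hsq : a = 0 → ∀ x : ℤ, x ^ 2 + b ≠ 0 := by
    rintro ha x hx
    have hbH : x ^ 2 ≤ H := by
      rcases h1 with h1 | h1
      · rcases h1.2 with h | h <;> nlinarith
      · linarith [h1.2.1]
    refine n4 |x| ⟨abs_nonneg x, abs_le_sqrt_of_sq_le hbH⟩ ha.symm ?_
    rw [sq_abs]; linarith
  have hirr : ∀ x : ℤ, x ^ 2 + a * x + b ≠ 0 := by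
    intro x hx
    rcases h1 with ⟨-, rfl | rfl⟩ | ⟨rfl, -⟩
    · have : x ∣ 1 := ⟨-(x + a), by linarith⟩
      rcases Int.isUnit_iff.1 (isUnit_of_dvd_one this) with rfl | rfl
      · exact n2 (by linarith) rfl
      · exact n1 (by linarith) rfl
    · have : x ∣ 1 := ⟨x + a, by linarith⟩
      rcases Int.isUnit_iff.1 (isUnit_of_dvd_one this) with rfl | rfl
      · exact n3 (by linarith) rfl
      · exact n3 (by linarith) rfl
    · exact hsq rfl x (by linarith)
  have hb0 : b ≠ 0 := fun h => hirr 0 (by simp [h])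
  refine ⟨?_, (irreducible_monicQuadratic_iff _).2 hirr, mulDep_of_coeff hb0 ?_ ?_⟩
  · simp only [abs_le]
    rcases h1 with ⟨h, rfl | rfl⟩ | ⟨rfl, h⟩ <;> omega
  · simp only
    intro h
    have hev : Even a := by
      have : Even (a ^ 2) := ⟨2 * b, by linarith⟩
      exact (Int.even_pow.1 this).1
    obtain ⟨c, rfl⟩ := hev
    exact hirr (-c) (by nlinarith)
  · simp only
    rcases h1 with ⟨-, rfl | rfl⟩ | ⟨rfl, -⟩ <;> simp

lemma card_axisPairs_le {H : ℤ} (hH : 1 ≤ H) : ((axisPairs H).card : ℤ) ≤ 6 * H + 3 := by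
  have h := Finset.card_union_le (Finset.Icc (-H) H ×ˢ ({1, -1} : Finset ℤ))
    ({0} ×ˢ Finset.Icc (-H) H)
  rw [← axisPairs, Finset.card_product, Finset.card_product, Int.card_Icc,
    Finset.card_pair (by norm_num), Finset.card_singleton] at h
  omega

lemma le_card_axisPairs {H : ℤ} (hH : 1 ≤ H) : 6 * H + 1 ≤ ((axisPairs H).card : ℤ) := by
  have h := Finset.card_union_add_card_inter (Finset.Icc (-H) H ×ˢ ({1, -1} : Finset ℤ))
    ({0} ×ˢ Finset.Icc (-H) H)
  have hinter : ((Finset.Icc (-H) H ×ˢ ({1, -1} : Finset ℤ)) ∩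
      ({0} ×ˢ Finset.Icc (-H) H)).card ≤ 2 := by
    have : (({0} : Finset ℤ) ×ˢ ({1, -1} : Finset ℤ)).card = 2 := rfl
    rw [← this, Finset.product_inter_product]
    exact Finset.card_le_card
      (Finset.product_subset_product Finset.inter_subset_right Finset.inter_subset_left)
  rw [← axisPairs, Finset.card_product, Finset.card_product, Int.card_Icc,
    Finset.card_pair (by norm_num), Finset.card_singleton] at h
  omega

lemma card_sporadicPairs_le (H : ℤ) :
    ((sporadicPairs H).card : ℤ) ≤ 4 * (2 * Int.sqrt (4 * H) + 1) := by
  have h := Finset.card_image_le (f := fun q : ℤ × ℤ => (q.1, q.1 ^ 2 / q.2))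
    (s := Finset.Icc (-Int.sqrt (4 * H)) (Int.sqrt (4 * H)) ×ˢ Finset.Icc (1 : ℤ) 4)
  rw [← sporadicPairs, Finset.card_product, Int.card_Icc, Int.card_Icc,
    show ((4 : ℤ) + 1 - 1).toNat = 4 from rfl] at h
  have := Int.sqrt_nonneg (4 * H)
  omega

lemma card_reduciblePairs_le (H : ℤ) : ((reduciblePairs H).card : ℤ) ≤ Int.sqrt H + 4 := by
  have h := Finset.card_union_le ({(2, 1), (-2, 1), (0, -1)} : Finset (ℤ × ℤ))
    ((Finset.Icc 0 (Int.sqrt H)).image fun x => (0, -x ^ 2))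
  have h' := Finset.card_image_le (f := fun x : ℤ => ((0 : ℤ), -x ^ 2))
    (s := Finset.Icc 0 (Int.sqrt H))
  have h3 : ({(2, 1), (-2, 1), (0, -1)} : Finset (ℤ × ℤ)).card = 3 := rfl
  rw [← reduciblePairs, h3] at h
  rw [Int.card_Icc] at h'
  have := Int.sqrt_nonneg H
  omega

lemma Int.cast_sqrt_le {n : ℤ} (hn : 0 ≤ n) : (Int.sqrt n : ℝ) ≤ Real.sqrt n := by
  lift n to ℕ using hn
  rw [Int.sqrt_natCast]
  exact_mod_cast Real.nat_sqrt_le_real_sqrt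

theorem stmt_2 :
    ∃ C : ℝ, 0 < C ∧ ∀ H : ℤ, 3 ≤ H →
      |((Iset 2 H).ncard : ℝ) - 6 * (H : ℝ)| ≤ C * Real.sqrt (H : ℝ) := by
  refine ⟨23, by norm_num, fun H hH => ?_⟩
  have hH1 : 1 ≤ H := by omega
  rw [ncard_Iset_two hH1]
  have hup : (depPairs H).ncard ≤ (axisPairs H).card + (sporadicPairs H).card := by
    refine le_trans ?_ (Finset.card_union_le _ _)
    rw [← Set.ncard_coe_finset]
    exact Set.ncard_le_ncard depPairs_subset (Finset.finite_toSet _)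
  have hlow : (axisPairs H).card - (reduciblePairs H).card ≤ (depPairs H).ncard := by
    refine (Finset.le_card_sdiff _ _).trans ?_
    rw [← Set.ncard_coe_finset]
    exact Set.ncard_le_ncard (subset_depPairs hH1)
      ((Finset.finite_toSet _).subset depPairs_subset)
  have e1 := card_axisPairs_le hH1
  have e2 := le_card_axisPairs hH1
  have e3 := card_sporadicPairs_le H
  have e4 := card_reduciblePairs_le H
  have u : ((depPairs H).ncard : ℤ) ≤ 6 * H + 8 * Int.sqrt (4 * H) + 7 := by omega
  have l : 6 * H - Int.sqrt H - 3 ≤ ((depPairs H).ncard : ℤ) := by omega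
  have u' : ((depPairs H).ncard : ℝ) ≤ 6 * H + 8 * (Int.sqrt (4 * H) : ℝ) + 7 := by
    exact_mod_cast u
  have l' : 6 * (H : ℝ) - (Int.sqrt H : ℝ) - 3 ≤ ((depPairs H).ncard : ℝ) := by
    exact_mod_cast l
  have s1 := Int.cast_sqrt_le (n := H) (by omega)
  have s2 := Int.cast_sqrt_le (n := 4 * H) (by omega)
  have s3 : Real.sqrt ((4 * H : ℤ) : ℝ) = 2 * Real.sqrt H := by
    push_cast
    rw [Real.sqrt_mul (by norm_num), show (4 : ℝ) = 2 ^ 2 by norm_num,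
      Real.sqrt_sq (by norm_num)]
  have s4 : 1 ≤ Real.sqrt (H : ℝ) := Real.one_le_sqrt.2 (by exact_mod_cast hH1)
  rw [s3] at s2
  rw [abs_le]
  constructor <;> linarith
end

section
/- There exist positive constants c1 and c2 such that for every integer H ≥ 3, c1·H^3 ≤ #I_4(H) ≤ c2·H^3, where #I_4(H) is the number of generalized degenerate monic integer polynomials of degree 4 and height at most H that are irreducible over ℤ. -/
open Polynomial MeasureTheory

theorem exists_fixedPointFree (a b c : Equiv.Perm (Fin 4)) (ha : a 0 = 1) (hb : b 0 = 2)
    (hc : c 0 = 3) :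
    ∃ h ∈ [a, b, c, a * b, a * c, b * c, a * b * c, a * b⁻¹, b * a, c * a, c * b],
      ∀ i, h i ≠ i := by
  revert a b c
  decide +kernel

theorem fixedPointFree_cases (h : Equiv.Perm (Fin 4)) (hh : ∀ i, h i ≠ i) :
    (∃ t, h = t * finRotate 4 * t⁻¹) ∨
    ∃ t, h = t * (Equiv.swap 0 1 * Equiv.swap 2 3) * t⁻¹ := by
  revert h
  decide +kernel

theorem conj_swaps_cases (h : Equiv.Perm (Fin 4)) (hh : h 0 = 2) :
    (∃ t, h = t * finRotate 4 * t⁻¹) ∨ h = Equiv.swap 0 2 * Equiv.swap 1 3 ∨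
    h * (Equiv.swap 0 1 * Equiv.swap 2 3) * h⁻¹ = Equiv.swap 0 2 * Equiv.swap 1 3 ∨
    h * (Equiv.swap 0 1 * Equiv.swap 2 3) * h⁻¹ = Equiv.swap 0 3 * Equiv.swap 1 2 := by
  revert h
  decide +kernel

/-- A transitive subgroup of `S₄` contains, up to renumbering, a four-cycle or the Klein
four-group. -/
theorem transitive_cases (G : Subgroup (Equiv.Perm (Fin 4))) (hG : ∀ i j, ∃ g ∈ G, g i = j) :
    ∃ t : Equiv.Perm (Fin 4), t * finRotate 4 * t⁻¹ ∈ G ∨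
      (t * (Equiv.swap 0 1 * Equiv.swap 2 3) * t⁻¹ ∈ G ∧
        t * (Equiv.swap 0 2 * Equiv.swap 1 3) * t⁻¹ ∈ G) := by
  obtain ⟨a, haG, ha⟩ := hG 0 1
  obtain ⟨b, hbG, hb⟩ := hG 0 2
  obtain ⟨c, hcG, hc⟩ := hG 0 3
  obtain ⟨h, hmem, hfix⟩ := exists_fixedPointFree a b c ha hb hc
  have hh : h ∈ G := by
    simp only [List.mem_cons, List.not_mem_nil, or_false] at hmem
    rcases hmem with rfl | rfl | rfl | rfl | rfl | rfl | rfl | rfl | rfl | rfl | rfl <;>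
      simp [haG, hbG, hcG, mul_mem]
  rcases fixedPointFree_cases h hfix with ⟨t, rfl⟩ | ⟨t, rfl⟩
  · exact ⟨t, .inl hh⟩
  obtain ⟨g, hgG, hg⟩ := hG (t 0) (t 2)
  have hu0 : (t⁻¹ * g * t) 0 = 2 := by simp [hg]
  have hconj : t * (t⁻¹ * g * t) * t⁻¹ ∈ G := by
    have : t * (t⁻¹ * g * t) * t⁻¹ = g := by group
    rwa [this]
  generalize t⁻¹ * g * t = u at hu0 hconj
  have hmul {x y} (hx : t * x * t⁻¹ ∈ G) (hy : t * y * t⁻¹ ∈ G) : t * (x * y) * t⁻¹ ∈ G := by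
    have : t * (x * y) * t⁻¹ = (t * x * t⁻¹) * (t * y * t⁻¹) := by group
    rw [this]; exact mul_mem hx hy
  have hinv {x} (hx : t * x * t⁻¹ ∈ G) : t * x⁻¹ * t⁻¹ ∈ G := by
    have : t * x⁻¹ * t⁻¹ = (t * x * t⁻¹)⁻¹ := by group
    rw [this]; exact inv_mem hx
  rcases conj_swaps_cases u hu0 with ⟨r, rfl⟩ | rfl | h1 | h1
  · refine ⟨t * r, .inl ?_⟩
    convert hconj using 1
    group
  · exact ⟨t, .inr ⟨hh, hconj⟩⟩
  · exact ⟨t, .inr ⟨hh, h1 ▸ hmul (hmul hconj hh) (hinv hconj)⟩⟩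
  · refine ⟨t, .inr ⟨hh, ?_⟩⟩
    have h2 : (Equiv.swap 0 2 * Equiv.swap 1 3 : Equiv.Perm (Fin 4)) =
        Equiv.swap 0 3 * Equiv.swap 1 2 * (Equiv.swap 0 1 * Equiv.swap 2 3) := by decide +kernel
    rw [h2]
    exact hmul (h1 ▸ hmul (hmul hconj hh) (hinv hconj)) hh

theorem exists_special_of_cycle (M : AddSubgroup (Fin 4 → ℤ))
    (hM : ∀ k ∈ M, k ∘ finRotate 4 ∈ M) (k : Fin 4 → ℤ) (hk : k ∈ M) (hk0 : k ≠ 0) :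
    ∃ n : ℤ, n ≠ 0 ∧ (![n, n, n, n] ∈ M ∨ ![n, -n, n, -n] ∈ M ∨
      (![n, 0, -n, 0] ∈ M ∧ ![0, -n, 0, n] ∈ M)) := by
  have rot (a b c d : ℤ) (h : ![a, b, c, d] ∈ M) : ![b, c, d, a] ∈ M := by
    convert hM _ h using 1
    ext i; fin_cases i <;> rfl
  have h0 : ![k 0, k 1, k 2, k 3] ∈ M := by
    convert hk using 1
    ext i; fin_cases i <;> rfl
  have h1 := rot _ _ _ _ h0
  have h2 := rot _ _ _ _ h1
  have h3 := rot _ _ _ _ h2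
  by_cases hs : k 0 + k 1 + k 2 + k 3 = 0
  · by_cases hd : k 0 - k 1 + k 2 - k 3 = 0
    · refine ⟨k 0 ^ 2 + k 1 ^ 2, ?_, .inr (.inr ?_)⟩
      · intro h
        have e0 : k 0 = 0 := by nlinarith [sq_nonneg (k 0), sq_nonneg (k 1)]
        have e1 : k 1 = 0 := by nlinarith [sq_nonneg (k 0), sq_nonneg (k 1)]
        apply hk0
        ext i
        fin_cases i <;> simp <;> omega
      · have e2 : k 2 = - k 0 := by omega
        have e3 : k 3 = - k 1 := by omega
        have key : ![k 0 ^ 2 + k 1 ^ 2, 0, -(k 0 ^ 2 + k 1 ^ 2), 0] ∈ M := by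
          convert sub_mem (M.zsmul_mem h0 (k 0)) (M.zsmul_mem h3 (k 1)) using 1
          ext i
          fin_cases i <;> simp [e2, e3] <;> ring
        refine ⟨key, ?_⟩
        simpa using rot _ _ _ _ key
    · refine ⟨_, hd, .inr (.inl ?_)⟩
      convert sub_mem (add_mem h0 h2) (add_mem h1 h3) using 1
      ext i
      fin_cases i <;> simp <;> ring
  · refine ⟨_, hs, .inl ?_⟩
    convert add_mem (add_mem h0 h2) (add_mem h1 h3) using 1
    ext i
    fin_cases i <;> simp <;> ring

theorem exists_special_of_klein (M : AddSubgroup (Fin 4 → ℤ))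
    (hM : ∀ k ∈ M, k ∘ (Equiv.swap 0 1 * Equiv.swap 2 3 : Equiv.Perm (Fin 4)) ∈ M)
    (hM' : ∀ k ∈ M, k ∘ (Equiv.swap 0 2 * Equiv.swap 1 3 : Equiv.Perm (Fin 4)) ∈ M)
    (k : Fin 4 → ℤ) (hk : k ∈ M) (hk0 : k ≠ 0) :
    ∃ n : ℤ, n ≠ 0 ∧ (![n, n, n, n] ∈ M ∨ ![n, n, -n, -n] ∈ M ∨
      ![n, -n, n, -n] ∈ M ∨ ![n, -n, -n, n] ∈ M) := by
  have h0 : ![k 0, k 1, k 2, k 3] ∈ M := by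
    convert hk using 1
    ext i; fin_cases i <;> rfl
  have swap_left (a b c d : ℤ) (h : ![a, b, c, d] ∈ M) : ![b, a, d, c] ∈ M := by
    convert hM _ h using 1
    ext i; fin_cases i <;> rfl
  have h1 := swap_left _ _ _ _ h0
  have h2 : ![k 2, k 3, k 0, k 1] ∈ M := by
    convert hM' _ h0 using 1
    ext i; fin_cases i <;> rfl
  have h3 := swap_left _ _ _ _ h2
  by_cases hs : k 0 + k 1 + k 2 + k 3 = 0
  · by_cases ha : k 0 + k 1 - k 2 - k 3 = 0
    · by_cases hb : k 0 - k 1 + k 2 - k 3 = 0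
      · refine ⟨k 0 - k 1 - k 2 + k 3, fun hc ↦ hk0 ?_, .inr (.inr (.inr ?_))⟩
        · ext i
          fin_cases i <;> simp <;> omega
        · convert sub_mem (add_mem h0 h3) (add_mem h1 h2) using 1
          ext i
          fin_cases i <;> simp <;> ring
      · refine ⟨_, hb, .inr (.inr (.inl ?_))⟩
        convert sub_mem (add_mem h0 h2) (add_mem h1 h3) using 1
        ext i
        fin_cases i <;> simp <;> ring
    · refine ⟨_, ha, .inr (.inl ?_)⟩
      convert sub_mem (add_mem h0 h1) (add_mem h2 h3) using 1
      ext i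
      fin_cases i <;> simp <;> ring
  · refine ⟨_, hs, .inl ?_⟩
    convert add_mem (add_mem h0 h2) (add_mem h1 h3) using 1
    ext i
    fin_cases i <;> simp <;> ring

/-- A nonzero lattice stable under a transitive group of permutations of the coordinates contains,
up to renumbering, one of three special shapes of vectors. -/
theorem exists_special_of_transitive (M : AddSubgroup (Fin 4 → ℤ))
    (G : Subgroup (Equiv.Perm (Fin 4))) (hG : ∀ i j, ∃ g ∈ G, g i = j)
    (hM : ∀ g ∈ G, ∀ k ∈ M, k ∘ g ∈ M) (k : Fin 4 → ℤ) (hk : k ∈ M) (hk0 : k ≠ 0) :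
    ∃ (n : ℤ) (t : Equiv.Perm (Fin 4)), n ≠ 0 ∧ (![n, n, n, n] ∘ t ∈ M ∨
      ![n, n, -n, -n] ∘ t ∈ M ∨ (![n, -n, 0, 0] ∘ t ∈ M ∧ ![0, 0, n, -n] ∘ t ∈ M)) := by
  obtain ⟨t, ht⟩ := transitive_cases G hG
  let N : AddSubgroup (Fin 4 → ℤ) :=
    M.comap (LinearMap.funLeft ℤ ℤ (t⁻¹ : Equiv.Perm (Fin 4))).toAddMonoidHom
  have hN (x : Fin 4 → ℤ) : x ∈ N ↔ x ∘ (t⁻¹ : Equiv.Perm (Fin 4)) ∈ M := Iff.rfl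
  have hkN : k ∘ t ∈ N := by
    rw [hN, Function.comp_assoc]
    convert hk using 1
    ext i; simp
  have hkN0 : k ∘ t ≠ 0 := by
    intro h
    apply hk0
    ext i
    simpa using congrFun h (t⁻¹ i)
  have hstab {s : Equiv.Perm (Fin 4)} (hs : t * s * t⁻¹ ∈ G) (x) (hx : x ∈ N) : x ∘ s ∈ N := by
    rw [hN] at hx ⊢
    convert hM _ hs _ hx using 1
    ext i; simp
  have transport (r : Equiv.Perm (Fin 4)) {x y : Fin 4 → ℤ} (hx : x ∈ N) (hxy : x = y ∘ r) :
      y ∘ (r * t⁻¹ : Equiv.Perm (Fin 4)) ∈ M := by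
    rw [hN, hxy] at hx
    exact hx
  rcases ht with ht | ⟨ht1, ht2⟩
  · obtain ⟨n, hn, h | h | ⟨h, h'⟩⟩ := exists_special_of_cycle N (hstab ht) _ hkN hkN0
    · exact ⟨n, 1 * t⁻¹, hn, .inl (transport 1 h (by ext i; rfl))⟩
    · exact ⟨n, Equiv.swap 1 2 * t⁻¹, hn, .inr (.inl (transport _ h
        (by ext i; fin_cases i <;> rfl)))⟩
    · refine ⟨n, Equiv.swap 1 2 * t⁻¹, hn, .inr (.inr ⟨transport _ h
        (by ext i; fin_cases i <;> rfl), ?_⟩)⟩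
      refine transport _ (N.neg_mem h') ?_
      ext i; fin_cases i <;> simp [Equiv.swap_apply_def]
  · obtain ⟨n, hn, h | h | h | h⟩ :=
      exists_special_of_klein N (hstab ht1) (hstab ht2) _ hkN hkN0
    · exact ⟨n, 1 * t⁻¹, hn, .inl (transport 1 h (by ext i; rfl))⟩
    · exact ⟨n, 1 * t⁻¹, hn, .inr (.inl (transport 1 h (by ext i; rfl)))⟩
    · exact ⟨n, Equiv.swap 1 2 * t⁻¹, hn, .inr (.inl (transport _ h
        (by ext i; fin_cases i <;> rfl)))⟩
    · exact ⟨n, Equiv.swap 1 3 * t⁻¹, hn, .inr (.inl (transport _ h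
        (by ext i; fin_cases i <;> rfl)))⟩

/-- The roots of unity of degree at most `24` over `ℚ`. -/
def smallRootsOfUnity : Set ℂ :=
  {z | IsOfFinOrder z ∧ (minpoly ℚ z).natDegree ≤ 24}

theorem finite_smallRootsOfUnity : smallRootsOfUnity.Finite := by
  classical
  have := bUnion_roots_finite (algebraMap ℤ ℂ) 24
    (Set.finite_Icc (-(Nat.choose 24 12 : ℤ)) (Nat.choose 24 12))
  refine this.subset fun z ⟨hz, hdeg⟩ ↦ ?_
  simp_rw [Set.mem_iUnion]
  obtain ⟨n, hn, hzn⟩ := hz.exists_pow_eq_one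
  have hint : IsIntegral ℤ z := IsIntegral.of_pow hn (hzn ▸ isIntegral_one)
  have hmin := minpoly.isIntegrallyClosed_eq_field_fractions' ℚ hint
  have hdeg' : (minpoly ℤ z).natDegree ≤ 24 := by
    rwa [hmin, (minpoly.monic hint).natDegree_map] at hdeg
  refine ⟨minpoly ℤ z, ⟨hdeg', fun i ↦ ?_⟩,
    mem_rootSet.2 ⟨minpoly.ne_zero hint, minpoly.aeval ℤ z⟩⟩
  have hb := coeff_bdd_of_roots_le (B := 1) (algebraMap ℤ ℂ) (minpoly.monic hint)
    (IsAlgClosed.splits _) hdeg' (fun w hw ↦ ?_) i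
  · rw [coeff_map] at hb
    simp only [algebraMap_int_eq, eq_intCast, Complex.norm_intCast, max_self, one_pow,
      one_mul] at hb
    rw [Set.mem_Icc, ← abs_le]
    exact_mod_cast hb
  · have hdvd : minpoly ℤ z ∣ X ^ n - 1 :=
      minpoly.isIntegrallyClosed_dvd hint (by simp [hzn])
    have hw0 := (mem_roots'.1 hw).2
    have h0 := Polynomial.map_dvd (algebraMap ℤ ℂ) hdvd
    have hroot := hw0.dvd h0
    have hwn : w ^ n = 1 := by simpa [sub_eq_zero] using hroot
    exact (Complex.norm_eq_one_of_pow_eq_one hwn hn.ne').le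

theorem AlgHom.map_mem_smallRootsOfUnity {K : Type*} [Field K] [Algebra ℚ K]
    [FiniteDimensional ℚ K] (hK : Module.finrank ℚ K ≤ 24) (φ : K →ₐ[ℚ] ℂ) {x : K}
    (hx : IsOfFinOrder x) : φ x ∈ smallRootsOfUnity := by
  refine ⟨MonoidHom.isOfFinOrder (φ : K →* ℂ) hx, ?_⟩
  rw [minpoly.algHom_eq φ φ.toRingHom.injective]
  exact (minpoly.natDegree_le x).trans hK

theorem exists_normal_splits_finrank_le.{u} {F : Type u} [Field F] (p : F[X]) (hp : p.Separable) :
    ∃ (K : Type u) (_ : Field K) (_ : Algebra F K) (_ : Normal F K) (_ : FiniteDimensional F K),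
      (p.map (algebraMap F K)).Splits ∧ Module.finrank F K ≤ p.natDegree.factorial := by
  classical
  refine ⟨p.SplittingField, inferInstance, inferInstance, Normal.of_isSplittingField p,
    inferInstance, SplittingField.splits p, ?_⟩
  have : Fact ((p.map (algebraMap F p.SplittingField)).Splits) := ⟨SplittingField.splits p⟩
  rw [← Gal.card_of_separable hp]
  refine (Nat.card_le_card_of_injective _
    (Gal.galActionHom_injective p p.SplittingField)).trans ?_
  rw [Nat.card_perm, ← card_rootSet_eq_natDegree hp (SplittingField.splits p),
    Nat.card_eq_fintype_card]

theorem exists_enum_roots {K : Type*} [Field K] [Algebra ℚ K] (p : ℚ[X]) (hp : Irreducible p)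
    (hmonic : p.Monic) (hdeg : p.natDegree = 4) (hs : (p.map (algebraMap ℚ K)).Splits) :
    ∃ x : Fin 4 → K, Function.Injective x ∧
      p.map (algebraMap ℚ K) = ∏ i, (X - C (x i)) := by
  classical
  set q := p.map (algebraMap ℚ K) with hq
  have hnd : q.roots.Nodup := nodup_roots hp.separable.map
  have hcard : q.roots.toFinset.card = 4 := by
    rw [Multiset.toFinset_card_of_nodup hnd, ← hs.natDegree_eq_card_roots, hq, natDegree_map, hdeg]
  let e := q.roots.toFinset.equivFinOfCardEq hcard
  refine ⟨fun i ↦ (e.symm i : K), fun i j h ↦ e.symm.injective (Subtype.ext h), ?_⟩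
  conv_lhs => rw [hs.eq_prod_roots_of_monic (hmonic.map _)]
  rw [e.symm.prod_comp (fun z ↦ X - C (z : K)), Finset.prod_coe_sort _ (fun z : K ↦ X - C z),
    Finset.prod, Multiset.toFinset_val, hnd.dedup]

/-- The lattice of exponents whose associated monomial in the units `u` is a root of unity. -/
def relationLattice {A ι : Type*} [CommGroup A] [Fintype ι] (u : ι → A) : AddSubgroup (ι → ℤ) where
  carrier := {k | IsOfFinOrder (∏ i, u i ^ k i)}
  zero_mem' := by simp [IsOfFinOrder.one]
  add_mem' := fun {a b} ha hb ↦ by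
    simpa [zpow_add, Finset.prod_mul_distrib] using IsOfFinOrder.mul ha hb
  neg_mem' := fun {a} ha ↦ by
    simpa [Finset.prod_inv_distrib] using IsOfFinOrder.inv ha

/-- Permutations of a finite family which are induced by field automorphisms. -/
def inducedPerms {K ι : Type*} [Field K] [Algebra ℚ K] (x : ι → K) :
    Subgroup (Equiv.Perm ι) where
  carrier := {g | ∃ σ : K ≃ₐ[ℚ] K, ∀ i, σ (x i) = x (g i)}
  one_mem' := ⟨1, fun _ ↦ rfl⟩
  mul_mem' := by
    rintro g h ⟨σ, hσ⟩ ⟨τ, hτ⟩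
    exact ⟨σ * τ, fun i ↦ by simp [hσ, hτ]⟩
  inv_mem' := by
    rintro g ⟨σ, hσ⟩
    refine ⟨σ⁻¹, fun i ↦ σ.injective ?_⟩
    rw [hσ]
    simp [AlgEquiv.aut_inv]

theorem inducedPerms_transitive {K ι : Type*} [Fintype ι] [Field K] [Algebra ℚ K] [Normal ℚ K]
    (p : ℚ[X]) (hp : Irreducible p) (hmonic : p.Monic) (x : ι → K) (hx : Function.Injective x)
    (hprod : p.map (algebraMap ℚ K) = ∏ i, (X - C (x i))) (i j : ι) :
    ∃ g ∈ inducedPerms x, g i = j := by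
  have hroot (z : K) : aeval z p = 0 ↔ ∃ l, x l = z := by
    rw [aeval_def, ← eval_map, hprod, eval_prod, Finset.prod_eq_zero_iff]
    simp [sub_eq_zero, eq_comm]
  have hmin (l : ι) : minpoly ℚ (x l) = p :=
    (minpoly.eq_of_irreducible_of_monic hp ((hroot _).2 ⟨l, rfl⟩) hmonic).symm
  obtain ⟨σ, hσ⟩ := minpoly.exists_algEquiv_of_root (K := ℚ) (x := x i) (y := x j)
    (Normal.isIntegral inferInstance _).isAlgebraic (by rw [hmin, hroot]; exact ⟨_, rfl⟩)
  have hex (l : ι) : ∃ m, x m = σ (x l) := by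
    rw [← hroot, ← AlgEquiv.coe_toAlgHom, aeval_algHom_apply, (hroot _).2 ⟨l, rfl⟩, map_zero]
  choose g hg using hex
  have hginj : Function.Injective g := fun a b hab ↦
    hx (σ.injective (by rw [← hg, ← hg, hab]))
  refine ⟨Equiv.ofBijective g (Finite.injective_iff_bijective.1 hginj),
    ⟨σ, fun l ↦ (hg l).symm⟩, hx ?_⟩
  rw [Equiv.ofBijective_apply, hg, hσ]

theorem comp_mem_relationLattice {K ι : Type*} [Fintype ι] [Field K] [Algebra ℚ K] (u : ι → Kˣ)
    {g : Equiv.Perm ι} (hg : g ∈ inducedPerms (fun i ↦ (u i : K))) {k : ι → ℤ}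
    (hk : k ∈ relationLattice u) : k ∘ g ∈ relationLattice u := by
  obtain ⟨σ, hσ⟩ := inv_mem hg
  have h := MonoidHom.isOfFinOrder (Units.map (σ : K →* K)) (show IsOfFinOrder _ from hk)
  have hu (i : ι) : Units.map (σ : K →* K) (u i) = u (g⁻¹ i) := Units.ext (hσ i)
  show IsOfFinOrder (∏ i, u i ^ k (g i))
  rw [← Equiv.prod_comp g⁻¹]
  simpa [map_prod, map_zpow, hu] using h

theorem relation_of_units {K : Type*} [Field K] [Algebra ℚ K] [Normal ℚ K] (p : ℚ[X])
    (hp : Irreducible p) (hmonic : p.Monic) (u : Fin 4 → Kˣ) (hu : Function.Injective u)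
    (hprod : p.map (algebraMap ℚ K) = ∏ i, (X - C (u i : K))) {k : Fin 4 → ℤ} (hk0 : k ≠ 0)
    (hk : k ∈ relationLattice u) :
    ∃ t : Equiv.Perm (Fin 4), IsOfFinOrder (∏ i, u (t i)) ∨
      IsOfFinOrder (u (t 0) * u (t 1) / (u (t 2) * u (t 3))) ∨
      (IsOfFinOrder (u (t 0) / u (t 1)) ∧ IsOfFinOrder (u (t 2) / u (t 3))) := by
  obtain ⟨n, t, hn, h⟩ := exists_special_of_transitive (relationLattice u)
    (inducedPerms fun i ↦ (u i : K))
    (inducedPerms_transitive p hp hmonic _ (Units.val_injective.comp hu) hprod)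
    (fun g hg k hk ↦ comp_mem_relationLattice u hg hk) k hk hk0
  have key {v : Fin 4 → ℤ} (hv : v ∘ t ∈ relationLattice u) :
      IsOfFinOrder (∏ i, u (t⁻¹ i) ^ v i) := by
    rw [← Equiv.prod_comp t]
    simpa [relationLattice] using hv
  have root {a : Kˣ} (ha : IsOfFinOrder (a ^ n)) : IsOfFinOrder a := by
    obtain ⟨m, hm, h1⟩ := isOfFinOrder_iff_zpow_eq_one.1 ha
    exact isOfFinOrder_iff_zpow_eq_one.2 ⟨n * m, mul_ne_zero hn hm, by rw [zpow_mul, h1]⟩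
  refine ⟨t⁻¹, ?_⟩
  rcases h with h | h | ⟨h, h'⟩
  · refine .inl (root ?_)
    simpa [Fin.prod_univ_four, mul_zpow] using key h
  · refine .inr (.inl (root ?_))
    convert key h using 1
    simp [Fin.prod_univ_four, mul_zpow, div_eq_mul_inv, mul_comm, mul_assoc]
  · refine .inr (.inr ⟨root ?_, root ?_⟩)
    · convert key h using 1
      simp [Fin.prod_univ_four, div_eq_mul_inv, mul_zpow]
    · convert key h' using 1
      simp [Fin.prod_univ_four, div_eq_mul_inv, mul_zpow]

theorem roots_of_splits_of_mulDep {K : Type*} [Field K] [Algebra ℚ K] [Normal ℚ K]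
    [FiniteDimensional ℚ K] (hfin : Module.finrank ℚ K ≤ 24) (f : ℤ[X]) (p : ℚ[X])
    (hpf : p = f.map (algebraMap ℤ ℚ)) (hp : Irreducible p) (hpm : p.Monic) (hpd : p.natDegree = 4)
    (hs : (p.map (algebraMap ℚ K)).Splits) (hdep : MulDep (nzRoots f)) :
    ∃ x : Fin 4 → ℂ, (∀ i, x i ≠ 0) ∧ f.map (Int.castRingHom ℂ) = ∏ i, (X - C (x i)) ∧
      (IsOfFinOrder (∏ i, x i) ∨ x 0 * x 1 / (x 2 * x 3) ∈ smallRootsOfUnity ∨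
        (x 0 / x 1 ∈ smallRootsOfUnity ∧ x 2 / x 3 ∈ smallRootsOfUnity)) := by
  classical
  obtain ⟨x, hxinj, hx⟩ := exists_enum_roots p hp hpm hpd hs
  have hx0 (i) : x i ≠ 0 := by
    intro h0
    have h1 : aeval (0 : K) p = 0 := by
      rw [aeval_def, ← eval_map, hx, eval_prod]
      exact Finset.prod_eq_zero (Finset.mem_univ i) (by simp [h0])
    have h2 : p.IsRoot 0 := by
      rw [← map_zero (algebraMap ℚ K), aeval_algebraMap_apply] at h1
      simpa using (algebraMap ℚ K).injective h1
    have h3 : p.natDegree = 1 :=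
      natDegree_eq_of_degree_eq_some (degree_eq_one_of_irreducible_of_root hp h2)
    omega
  let φ : K →ₐ[ℚ] ℂ := IsAlgClosed.lift
  have hφ : Function.Injective φ := φ.toRingHom.injective
  have hfx : f.map (Int.castRingHom ℂ) = ∏ i, (X - C (φ (x i))) := by
    have : (p.map (algebraMap ℚ K)).map (φ : K →+* ℂ) =
        f.map (Int.castRingHom ℂ) := by
      rw [hpf, map_map, map_map]
      exact congrArg (f.map ·) (RingHom.ext_int _ _)
    rw [← this, hx, Polynomial.map_prod]
    simp
  have hnz : nzRoots f = Finset.univ.image (fun i ↦ φ (x i)) := by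
    have hr : (f.map (Int.castRingHom ℂ)).roots =
        Finset.univ.val.map (fun i ↦ φ (x i)) := by
      have := roots_multiset_prod_X_sub_C (Finset.univ.val.map (fun i ↦ φ (x i)))
      rw [Multiset.map_map] at this
      rw [hfx]
      exact this
    ext z
    simp only [nzRoots, hr, Finset.mem_filter, Multiset.mem_toFinset, Multiset.mem_map,
      Finset.mem_image, Finset.mem_val]
    refine ⟨fun h ↦ h.1, fun h ↦ ⟨h, ?_⟩⟩
    obtain ⟨i, -, rfl⟩ := h
    exact (map_ne_zero φ).2 (hx0 i)
  let u : Fin 4 → Kˣ := fun i ↦ Units.mk0 (x i) (hx0 i)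
  have huinj : Function.Injective u := fun i j h ↦ hxinj (congrArg Units.val h)
  obtain ⟨k, ⟨z, hz, hkz⟩, hk⟩ := hdep
  rw [hnz] at hz hk
  rw [Finset.prod_image (fun i _ j _ h ↦ hxinj (hφ h))] at hk
  have hkmem : (fun i ↦ k (φ (x i))) ∈ relationLattice u := by
    have : ∏ i, u i ^ k (φ (x i)) = 1 := by
      apply Units.ext
      apply hφ
      simpa [u] using hk
    show IsOfFinOrder (∏ i, u i ^ k (φ (x i)))
    rw [this]
    exact IsOfFinOrder.one
  have hk0 : (fun i ↦ k (φ (x i))) ≠ 0 := by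
    obtain ⟨i, -, rfl⟩ := Finset.mem_image.1 hz
    exact fun h ↦ hkz (congrFun h i)
  obtain ⟨t, ht⟩ := relation_of_units p hp hpm u huinj hx hk0 hkmem
  have hval {a : Kˣ} (ha : IsOfFinOrder a) :
      IsOfFinOrder (a : K) := MonoidHom.isOfFinOrder (Units.coeHom _) ha
  have hsmall {a : Kˣ} (ha : IsOfFinOrder a) : φ a ∈ smallRootsOfUnity :=
    φ.map_mem_smallRootsOfUnity hfin (hval ha)
  refine ⟨fun i ↦ φ (x (t i)), fun i ↦ (map_ne_zero φ).2 (hx0 _), ?_, ?_⟩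
  · rw [hfx, ← Equiv.prod_comp t]
  · rcases ht with h | h | ⟨h, h'⟩
    · left
      simpa [u] using (hsmall h).1
    · right; left
      simpa [u] using hsmall h
    · right; right
      exact ⟨by simpa [u] using hsmall h, by simpa [u] using hsmall h'⟩

theorem roots_of_mulDep (f : ℤ[X]) (hmonic : f.Monic) (hdeg : f.natDegree = 4)
    (hirr : Irreducible f) (hdep : MulDep (nzRoots f)) :
    ∃ x : Fin 4 → ℂ, (∀ i, x i ≠ 0) ∧ f.map (Int.castRingHom ℂ) = ∏ i, (X - C (x i)) ∧
      (IsOfFinOrder (∏ i, x i) ∨ x 0 * x 1 / (x 2 * x 3) ∈ smallRootsOfUnity ∨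
        (x 0 / x 1 ∈ smallRootsOfUnity ∧ x 2 / x 3 ∈ smallRootsOfUnity)) := by
  obtain ⟨p, hpf⟩ : ∃ p : ℚ[X], p = f.map (algebraMap ℤ ℚ) := ⟨_, rfl⟩
  have hp : Irreducible p :=
    hpf ▸ (hmonic.irreducible_iff_irreducible_map_fraction_map (K := ℚ)).1 hirr
  have hpd : p.natDegree = 4 := by rw [hpf, hmonic.natDegree_map, hdeg]
  obtain ⟨K, _, _, _, _, hs, hfin⟩ := exists_normal_splits_finrank_le p hp.separable
  rw [hpd] at hfin
  exact roots_of_splits_of_mulDep hfin f p hpf hp (hpf ▸ hmonic.map _) hpd hs hdep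

theorem coeff_quartic {R : Type*} [CommRing R] (a b c d : R) :
    (X ^ 4 + C a * X ^ 3 + C b * X ^ 2 + C c * X + C d).coeff 3 = a ∧
    (X ^ 4 + C a * X ^ 3 + C b * X ^ 2 + C c * X + C d).coeff 2 = b ∧
    (X ^ 4 + C a * X ^ 3 + C b * X ^ 2 + C c * X + C d).coeff 1 = c ∧
    (X ^ 4 + C a * X ^ 3 + C b * X ^ 2 + C c * X + C d).coeff 0 = d := by
  simp [coeff_X, coeff_C, coeff_X_pow]

theorem coeff_prod_four {R : Type*} [CommRing R] (x : Fin 4 → R) :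
    (∏ i, (X - C (x i))).coeff 3 = -(x 0 + x 1 + x 2 + x 3) ∧
    (∏ i, (X - C (x i))).coeff 2 =
      x 0 * x 1 + x 2 * x 3 + (x 0 + x 1) * (x 2 + x 3) ∧
    (∏ i, (X - C (x i))).coeff 1 = -(x 0 * x 1 * (x 2 + x 3) + x 2 * x 3 * (x 0 + x 1)) ∧
    (∏ i, (X - C (x i))).coeff 0 = ∏ i, x i := by
  have h : ∏ i, (X - C (x i)) = X ^ 4 + C (-(x 0 + x 1 + x 2 + x 3)) * X ^ 3 +
      C (x 0 * x 1 + x 2 * x 3 + (x 0 + x 1) * (x 2 + x 3)) * X ^ 2 +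
      C (-(x 0 * x 1 * (x 2 + x 3) + x 2 * x 3 * (x 0 + x 1))) * X + C (∏ i, x i) := by
    simp only [Fin.prod_univ_four, map_add, map_mul, map_neg]
    ring
  rw [h]
  exact coeff_quartic _ _ _ _

/-- The possible values of `y ^ 2 / d` or `(b - y) ^ 2 / d`, where `y = x₀ x₁ + x₂ x₃` and
`X ^ 4 + a X ^ 3 + b X ^ 2 + c X + d` has dependent roots `x₀, x₁, x₂, x₃`. -/
def resolventRatios : Set ℂ :=
  (fun r ↦ (1 + r) ^ 2 / r) '' smallRootsOfUnity ∪
    Set.image2 (fun r s ↦ (1 + r) ^ 2 / r * ((1 + s) ^ 2 / s)) smallRootsOfUnity smallRootsOfUnity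

theorem finite_resolventRatios : resolventRatios.Finite :=
  (finite_smallRootsOfUnity.image _).union
    (finite_smallRootsOfUnity.image2 _ finite_smallRootsOfUnity)

theorem coeff_relations_of_mulDep (f : ℤ[X]) (hmonic : f.Monic) (hdeg : f.natDegree = 4)
    (hirr : Irreducible f) (hdep : MulDep (nzRoots f)) :
    |f.coeff 0| = 1 ∨ ∃ κ ∈ resolventRatios, ∃ y : ℂ,
      (y ^ 2 = κ * f.coeff 0 ∨ (f.coeff 2 - y) ^ 2 = κ * f.coeff 0) ∧
      (2 * f.coeff 1 - f.coeff 3 * y) ^ 2 =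
        (y ^ 2 - 4 * f.coeff 0) * (4 * (y - f.coeff 2) + (f.coeff 3 : ℂ) ^ 2) := by
  obtain ⟨x, hx0, hx, h⟩ := roots_of_mulDep f hmonic hdeg hirr hdep
  obtain ⟨h3, h2, h1, h0⟩ := coeff_prod_four x
  rw [← hx, coeff_map, eq_intCast] at h0 h1 h2 h3
  have hy : (2 * (f.coeff 1 : ℂ) - f.coeff 3 * (x 0 * x 1 + x 2 * x 3)) ^ 2 =
      ((x 0 * x 1 + x 2 * x 3) ^ 2 - 4 * f.coeff 0) *
        (4 * (x 0 * x 1 + x 2 * x 3 - f.coeff 2) + (f.coeff 3 : ℂ) ^ 2) := by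
    rw [h0, h1, h2, h3, Fin.prod_univ_four]
    ring
  have hx0' := hx0 0
  have hx1' := hx0 1
  have hx2' := hx0 2
  have hx3' := hx0 3
  rcases h with h | h | ⟨h, h'⟩
  · left
    have := h.norm_eq_one
    rw [← h0, Complex.norm_intCast] at this
    exact_mod_cast this
  · refine .inr ⟨_, .inl ⟨_, h, rfl⟩, _, .inl ?_, hy⟩
    rw [h0, Fin.prod_univ_four]
    field_simp
    ring
  · refine .inr ⟨_, .inr ⟨_, h, _, h', rfl⟩, _, .inr ?_, hy⟩
    rw [h0, h2, Fin.prod_univ_four]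
    field_simp
    ring

theorem eq_mul_of_sq_eq {a b c : ℂ} (h : a ^ 2 = c) (hb : b ^ 2 = c) :
    ∃ ε ∈ ({1, -1} : Finset ℂ), a = ε * b := by
  rcases sq_eq_sq_iff_eq_or_eq_neg.1 (h.trans hb.symm) with h | h <;> simp [h]

theorem exists_card_le_of_mulDep :
    ∃ N : ℕ, ∀ a b d : ℤ, ∃ S : Finset ℂ, S.card ≤ N ∧
      ∀ f : ℤ[X], f.Monic → f.natDegree = 4 → Irreducible f → MulDep (nzRoots f) →
        f.coeff 3 = a → f.coeff 2 = b → f.coeff 0 = d → |d| ≠ 1 → (f.coeff 1 : ℂ) ∈ S := by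
  classical
  choose s hs using fun z : ℂ ↦ IsAlgClosed.exists_pow_nat_eq z (n := 2) two_pos
  let F := finite_resolventRatios.toFinset
  let E : Finset ℂ := {1, -1}
  refine ⟨((F ×ˢ E) ×ˢ E ×ˢ (Finset.univ : Finset Bool)).card, fun a b d ↦ ?_⟩
  let Y : ℂ × ℂ → Bool → ℂ := fun p j ↦ bif j then p.2 * s (p.1 * d) else b - p.2 * s (p.1 * d)
  let Φ : (ℂ × ℂ) × ℂ × Bool → ℂ := fun q ↦
    (a * Y q.1 q.2.2 + q.2.1 * s ((Y q.1 q.2.2 ^ 2 - 4 * d) * (4 * (Y q.1 q.2.2 - b) + (a : ℂ) ^ 2)))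
      / 2
  refine ⟨_, Finset.card_image_le (f := Φ), ?_⟩
  rintro f hmonic hdeg hirr hdep rfl rfl rfl hd
  obtain ⟨κ, hκ, y, hy, hy'⟩ := (coeff_relations_of_mulDep f hmonic hdeg hirr hdep).resolve_left hd
  obtain ⟨ε, hε, j, hj⟩ : ∃ ε ∈ E, ∃ j, y = Y (κ, ε) j := by
    rcases hy with hy | hy
    · obtain ⟨ε, hε, h⟩ := eq_mul_of_sq_eq hy (hs _)
      exact ⟨ε, hε, true, h⟩
    · obtain ⟨ε, hε, h⟩ := eq_mul_of_sq_eq hy (hs _)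
      exact ⟨ε, hε, false, by simp [Y, ← h]⟩
  obtain ⟨δ, hδ, h⟩ := eq_mul_of_sq_eq hy' (hs _)
  refine Finset.mem_image.2 ⟨((κ, ε), δ, j), by simp [F, hκ, hε, show δ ∈ E from hδ], ?_⟩
  simp only [Φ, ← hj, ← h]
  ring

theorem ncard_Iset_four_le :
    ∃ C : ℕ, ∀ H : ℤ, 1 ≤ H → (Iset 4 H).Finite ∧ ((Iset 4 H).ncard : ℤ) ≤ C * H ^ 3 := by
  classical
  obtain ⟨N, hN⟩ := exists_card_le_of_mulDep
  choose S hS hmem using hN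
  refine ⟨27 * N + 54, fun H hH ↦ ?_⟩
  let I := Finset.Icc (-H) H
  have hI : (I.card : ℤ) ≤ 3 * H := by
    simp only [I, Int.card_Icc]
    omega
  let A : Finset ((ℤ × ℤ × ℤ) × ℂ) := (I ×ˢ I ×ˢ I).biUnion fun p ↦
    (S p.1 p.2.1 p.2.2).image (Prod.mk p)
  let B : Finset ((ℤ × ℤ × ℤ) × ℂ) :=
    (I ×ˢ I ×ˢ ({1, -1} : Finset ℤ)) ×ˢ I.image ((↑) : ℤ → ℂ)
  let φ : ℤ[X] → (ℤ × ℤ × ℤ) × ℂ := fun f ↦ ((f.coeff 3, f.coeff 2, f.coeff 0), f.coeff 1)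
  have hA : A.card ≤ I.card ^ 3 * N := by
    refine Finset.card_biUnion_le_card_mul _ _ N (fun p _ ↦ Finset.card_image_le.trans (hS _ _ _))
      |>.trans_eq ?_
    rw [Finset.card_product, Finset.card_product]
    ring
  have hB : B.card ≤ I.card ^ 3 * 2 := by
    simp only [B, Finset.card_product]
    calc _ ≤ I.card * (I.card * 2) * I.card := by
          gcongr
          · exact Finset.card_le_two
          · exact Finset.card_image_le
      _ = _ := by ring
  have hmaps : Set.MapsTo φ (Iset 4 H) ↑(A ∪ B) := by
    rintro f ⟨hmonic, hdeg, hH, hirr, -, hdep⟩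
    have hc (i) : f.coeff i ∈ I := Finset.mem_Icc.2 (abs_le.1 (hH i))
    rw [Finset.mem_coe, Finset.mem_union]
    by_cases hd : |f.coeff 0| = 1
    · right
      simpa [B, φ, hc] using (abs_eq zero_le_one).1 hd
    · left
      exact Finset.mem_biUnion.2 ⟨_, by simp [hc], Finset.mem_image.2
        ⟨_, hmem _ _ _ f hmonic hdeg hirr hdep rfl rfl rfl hd, rfl⟩⟩
  have hinj : Set.InjOn φ (Iset 4 H) := by
    rintro f hf g hg h
    simp only [φ, Prod.mk.injEq, Int.cast_inj] at h
    refine (ext_iff_natDegree_le (n := 4) hf.2.1.le hg.2.1.le).2 fun i hi ↦ ?_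
    interval_cases i
    · exact h.1.2.2
    · exact h.2
    · exact h.1.2.1
    · exact h.1.1
    · have h1 := hf.1.coeff_natDegree
      have h2 := hg.1.coeff_natDegree
      rw [hf.2.1] at h1
      rw [hg.2.1] at h2
      rw [h1, h2]
  refine ⟨Set.Finite.of_injOn hmaps hinj (Finset.finite_toSet _), ?_⟩
  have h1 := Set.ncard_le_ncard_of_injOn φ hmaps hinj (Finset.finite_toSet _)
  rw [Set.ncard_coe_finset] at h1
  have h2 : (Iset 4 H).ncard ≤ I.card ^ 3 * (N + 2) := by
    have := Finset.card_union_le A B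
    linarith
  calc ((Iset 4 H).ncard : ℤ) ≤ (I.card : ℤ) ^ 3 * (N + 2) := by exact_mod_cast h2
    _ ≤ (3 * H) ^ 3 * (N + 2) := by gcongr
    _ = _ := by push_cast; ring

theorem irreducible_X_pow_four_add_X_add_one :
    Irreducible (X ^ 4 + X + 1 : (ZMod 2)[X]) := by
  have hd : (X ^ 4 + X + 1 : (ZMod 2)[X]).natDegree = 4 := by compute_degree!
  have hm : (X ^ 4 + X + 1 : (ZMod 2)[X]).Monic := by monicity!
  rw [hm.irreducible_iff_natDegree', hd]
  refine ⟨fun h ↦ by simp [h] at hd, fun f g hf hg hfg hgd ↦ ?_⟩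
  have hfd : f.natDegree + g.natDegree = 4 := by rw [← hf.natDegree_mul hg, hfg, hd]
  have hgl := hg.coeff_natDegree
  have hfl := hf.coeff_natDegree
  have hg0 (n) (hn : g.natDegree < n) : g.coeff n = 0 := coeff_eq_zero_of_natDegree_lt hn
  have hf0 (n) (hn : f.natDegree < n) : f.coeff n = 0 := coeff_eq_zero_of_natDegree_lt hn
  have h (n) : (f * g).coeff n = (X ^ 4 + X + 1 : (ZMod 2)[X]).coeff n := by rw [hfg]
  have h0 := h 0
  have h1 := h 1
  have h2 := h 2
  have h3 := h 3
  simp only [coeff_mul, Finset.Nat.antidiagonal_succ, Finset.Nat.antidiagonal_zero,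
    Finset.sum_cons, Finset.map_cons, coeff_add, coeff_X_pow, coeff_X, coeff_one,
    Finset.sum_singleton, Finset.map_singleton, Function.Embedding.prodMap,
    Function.Embedding.coeFn_mk, Prod.map] at h0 h1 h2 h3
  obtain ⟨hg1, hg2⟩ := Finset.mem_Ioc.1 hgd
  obtain hgd | hgd : g.natDegree = 1 ∨ g.natDegree = 2 := by omega
  · have hfd : f.natDegree = 3 := by omega
    rw [hgd] at hgl hg0
    rw [hfd] at hfl hf0
    have e1 := hg0 2 (by norm_num)
    have e2 := hg0 3 (by norm_num)
    simp [hgl, hfl, e1, e2] at h0 h1 h2 h3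
    generalize f.coeff 0 = a0, f.coeff 1 = a1, f.coeff 2 = a2, g.coeff 0 = b0 at *
    revert a0 a1 a2 b0
    decide
  · have hfd : f.natDegree = 2 := by omega
    rw [hgd] at hgl hg0
    rw [hfd] at hfl hf0
    have e1 := hg0 3 (by norm_num)
    have e2 := hf0 3 (by norm_num)
    simp [hgl, hfl, e1, e2] at h0 h1 h2 h3
    generalize f.coeff 0 = a0, f.coeff 1 = a1, g.coeff 0 = b0, g.coeff 1 = b1 at *
    revert a0 a1 b0 b1
    decide

/-- The polynomial `X ^ 4 + 2 a X ^ 3 + 2 b X ^ 2 + (2 c + 1) X + 1`. -/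
noncomputable def unitQuartic (p : ℤ × ℤ × ℤ) : ℤ[X] :=
  X ^ 4 + C (2 * p.1) * X ^ 3 + C (2 * p.2.1) * X ^ 2 + C (2 * p.2.2 + 1) * X + C 1

theorem unitQuartic_coeff (p : ℤ × ℤ × ℤ) :
    (unitQuartic p).coeff 3 = 2 * p.1 ∧ (unitQuartic p).coeff 2 = 2 * p.2.1 ∧
    (unitQuartic p).coeff 1 = 2 * p.2.2 + 1 ∧ (unitQuartic p).coeff 0 = 1 :=
  coeff_quartic _ _ _ _

theorem natDegree_unitQuartic (p : ℤ × ℤ × ℤ) : (unitQuartic p).natDegree = 4 := by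
  unfold unitQuartic
  compute_degree!

theorem monic_unitQuartic (p : ℤ × ℤ × ℤ) : (unitQuartic p).Monic := by
  unfold unitQuartic
  monicity!

theorem irreducible_unitQuartic (p : ℤ × ℤ × ℤ) : Irreducible (unitQuartic p) := by
  refine (monic_unitQuartic p).irreducible_of_irreducible_map (Int.castRingHom (ZMod 2)) _ ?_
  have h2 : (2 : (ZMod 2)[X]) = 0 := CharTwo.two_eq_zero
  convert irreducible_X_pow_four_add_X_add_one using 1
  simp [unitQuartic, h2]

theorem mulDep_nzRoots_of_coeff_zero_eq_one (f : ℤ[X]) (hmonic : f.Monic)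
    (hirr : Irreducible f) (hdeg : Even f.natDegree) (h1 : f.coeff 0 = 1) :
    MulDep (nzRoots f) := by
  classical
  have hd0 : f.natDegree ≠ 0 := fun h ↦ hirr.not_isUnit <| by
    rw [hmonic.natDegree_eq_zero.1 h]
    exact isUnit_one
  have hm := hmonic.map (Int.castRingHom ℂ)
  have hs := IsAlgClosed.splits (f.map (Int.castRingHom ℂ))
  have hsep : (f.map (Int.castRingHom ℂ)).Separable := by
    have := ((hmonic.irreducible_iff_irreducible_map_fraction_map (K := ℚ)).1 hirr).separable.map
      (f := algebraMap ℚ ℂ)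
    rwa [map_map, RingHom.ext_int ((algebraMap ℚ ℂ).comp (algebraMap ℤ ℚ)) (Int.castRingHom ℂ)]
      at this
  have hnd := nodup_roots hsep
  have hprod : (f.map (Int.castRingHom ℂ)).roots.prod = 1 := by
    have := hs.coeff_zero_eq_prod_roots_of_monic hm
    rw [coeff_map, h1, hmonic.natDegree_map, hdeg.neg_one_pow] at this
    simpa using this.symm
  have hnz : nzRoots f = (f.map (Int.castRingHom ℂ)).roots.toFinset := by
    refine Finset.filter_true_of_mem fun z hz h0 ↦ ?_
    rw [Multiset.mem_toFinset] at hz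
    rw [Multiset.prod_eq_zero (h0 ▸ hz)] at hprod
    exact zero_ne_one hprod
  refine ⟨fun _ ↦ 1, ?_, ?_⟩
  · have : 0 < (f.map (Int.castRingHom ℂ)).roots.card := by
      rw [← hs.natDegree_eq_card_roots, hmonic.natDegree_map]
      omega
    obtain ⟨z, hz⟩ := Multiset.card_pos_iff_exists_mem.1 this
    exact ⟨z, by rwa [hnz, Multiset.mem_toFinset], one_ne_zero⟩
  · simp only [hnz, zpow_one]
    refine (Finset.prod_val _).symm.trans ?_
    rw [Multiset.toFinset_val, hnd.dedup, hprod]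

theorem le_ncard_Iset_four {H : ℤ} (hH : 1 ≤ H) (hfin : (Iset 4 H).Finite) :
    H ^ 3 ≤ (Iset 4 H).ncard := by
  let I := Finset.Icc (-(H / 2)) (H / 2)
  let J := Finset.Icc (-((H + 1) / 2)) ((H - 1) / 2)
  have hinj : Function.Injective unitQuartic := by
    rintro ⟨a, b, c⟩ ⟨a', b', c'⟩ h
    obtain ⟨h3, h2, h1, -⟩ := unitQuartic_coeff (a, b, c)
    obtain ⟨h3', h2', h1', -⟩ := unitQuartic_coeff (a', b', c')
    rw [h] at h1 h2 h3
    dsimp only at *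
    simp only [Prod.mk.injEq]
    omega
  have hmaps : ∀ p ∈ ((I ×ˢ I ×ˢ J : Finset _) : Set (ℤ × ℤ × ℤ)), unitQuartic p ∈ Iset 4 H := by
    intro p hp
    obtain ⟨h3, h2, h1, h0⟩ := unitQuartic_coeff p
    simp only [Finset.mem_coe, Finset.mem_product, I, J, Finset.mem_Icc] at hp
    refine ⟨monic_unitQuartic p, natDegree_unitQuartic p, fun i ↦ ?_, irreducible_unitQuartic p,
      (natDegree_unitQuartic p).symm ▸ by norm_num,
      mulDep_nzRoots_of_coeff_zero_eq_one _ (monic_unitQuartic p) (irreducible_unitQuartic p)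
        ((natDegree_unitQuartic p).symm ▸ by decide) h0⟩
    rcases lt_or_ge 4 i with hi | hi
    · rw [coeff_eq_zero_of_natDegree_lt (by rwa [natDegree_unitQuartic])]
      simpa using by omega
    · have h4 := (monic_unitQuartic p).coeff_natDegree
      rw [natDegree_unitQuartic] at h4
      rw [abs_le]
      interval_cases i <;> omega
  have hcard := Set.ncard_le_ncard_of_injOn unitQuartic hmaps hinj.injOn hfin
  rw [Set.ncard_coe_finset, Finset.card_product, Finset.card_product] at hcard
  have hI : H ≤ I.card := by
    simp only [I, Int.card_Icc]
    omega
  have hJ : H ≤ J.card := by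
    simp only [J, Int.card_Icc]
    omega
  calc H ^ 3 = H * (H * H) := by ring
    _ ≤ I.card * (I.card * J.card) := by gcongr
    _ ≤ _ := by exact_mod_cast hcard

theorem stmt_3 :
    ∃ c1 c2 : ℝ, 0 < c1 ∧ 0 < c2 ∧ ∀ H : ℤ, 3 ≤ H →
      c1 * (H : ℝ) ^ 3 ≤ ((Iset 4 H).ncard : ℝ) ∧
      ((Iset 4 H).ncard : ℝ) ≤ c2 * (H : ℝ) ^ 3 := by
  obtain ⟨C, hC⟩ := ncard_Iset_four_le
  refine ⟨1, C + 1, one_pos, by positivity, fun H hH ↦ ?_⟩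
  obtain ⟨hfin, hle⟩ := hC H (by omega)
  have hge := le_ncard_Iset_four (by omega) hfin
  have hpos : (0 : ℝ) ≤ (H : ℝ) ^ 3 := by positivity
  have hle' : ((Iset 4 H).ncard : ℝ) ≤ C * (H : ℝ) ^ 3 := by exact_mod_cast hle
  refine ⟨by rw [one_mul]; exact_mod_cast hge, by linarith⟩
end
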